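/- There exists a unital C*-algebra A with the following properties: A is separable; A is simple (its only closed two-sided ideals are {0} and A); A is stably finite, i.e., for every positive integer n and every x in the n×n matrix algebra M_n(A), x*x = 1 implies xx* = 1; the invertible elements of A are dense in A (A has stable rank one); the invertible self-adjoint elements of A are dense in the set of self-adjoint elements of A (A has real rank zero); A has exactly one tracial state; and A is not isomorphic to its opposite algebra Aᵒᵖ, i.e., there is no ℂ-linear star-algebra isomorphism from A onto the multiplicative-opposite C*-algebra Aᵒᵖ. -/

import Mathlib

/-- A *tracial state* on a unital C*-algebra `D` is a continuous linear functional
`τ : D → ℂ` with `τ 1 = 1`, taking nonnegative real values on elements of the form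
`x* x`, and satisfying the trace identity `τ (a b) = τ (b a)`. -/
def IsTracialState {D : Type*} [NormedRing D] [StarRing D] [NormedAlgebra ℂ D]
    (τ : D →L[ℂ] ℂ) : Prop :=
  τ 1 = 1 ∧ (∀ x : D, ∃ r : ℝ, 0 ≤ r ∧ τ (star x * x) = r) ∧
    ∀ a b : D, τ (a * b) = τ (b * a)

open Filter Topology
open scoped InnerProductSpace

section Convergence

variable {E F : Type*} [NormedAddCommGroup E] [NormedSpace ℂ E]
  [NormedAddCommGroup F] [NormedSpace ℂ F]

/-- Uniformly bounded operators tending to zero on a set with dense span tend to zero pointwise. -/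
theorem tendsto_apply_zero_of_dense_span {ι : Type*} {l : Filter ι}
    (T : ι → E →L[ℂ] F) {C : ℝ} (hT : ∀ i, ‖T i‖ ≤ C) {S : Set E}
    (hS : Dense (Submodule.span ℂ S : Set E))
    (h : ∀ s ∈ S, Tendsto (fun i => T i s) l (𝓝 0)) (x : E) :
    Tendsto (fun i => T i x) l (𝓝 0) := by
  have hspan : ∀ y ∈ Submodule.span ℂ S, Tendsto (fun i => T i y) l (𝓝 0) := by
    intro y hy
    induction hy using Submodule.span_induction with
    | mem y hy => exact h y hy
    | zero => simpa using tendsto_const_nhds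
    | add y z _ _ hy hz => simpa using hy.add hz
    | smul c y _ hy => simpa using hy.const_smul c
  rw [Metric.tendsto_nhds]
  intro ε hε
  have hC : 0 < |C| + 1 := by positivity
  obtain ⟨y, hy, hxy⟩ := Metric.mem_closure_iff.1 (hS x) (ε / 2 / (|C| + 1)) (by positivity)
  filter_upwards [Metric.tendsto_nhds.1 (hspan y hy) (ε / 2) (by positivity)] with i hi
  rw [dist_zero_right] at hi ⊢
  have h1 : ‖T i (x - y)‖ ≤ ε / 2 := by
    calc ‖T i (x - y)‖ ≤ ‖T i‖ * ‖x - y‖ := (T i).le_opNorm _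
      _ ≤ (|C| + 1) * (ε / 2 / (|C| + 1)) := by
        gcongr
        · exact (hT i).trans ((le_abs_self C).trans (by linarith))
        · rw [← dist_eq_norm]; exact hxy.le
      _ = ε / 2 := by field_simp
  have h2 : T i x = T i (x - y) + T i y := by simp
  rw [h2]
  linarith [norm_add_le (T i (x - y)) (T i y)]

theorem cauchySeq_apply_of_dense_span (T : ℕ → E →L[ℂ] F) {C : ℝ} (hT : ∀ i, ‖T i‖ ≤ C)
    {S : Set E} (hS : Dense (Submodule.span ℂ S : Set E))
    (h : ∀ s ∈ S, CauchySeq (fun i => T i s)) (x : E) : CauchySeq (fun i => T i x) := by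
  have key := tendsto_apply_zero_of_dense_span (l := atTop) (fun p : ℕ × ℕ => T p.1 - T p.2)
    (C := C + C) (fun p => (norm_sub_le _ _).trans (add_le_add (hT _) (hT _))) hS
    (fun s hs => by
      have := (cauchySeq_iff_tendsto_dist_atTop_0.1 (h s hs))
      rw [tendsto_zero_iff_norm_tendsto_zero]
      simpa [dist_eq_norm] using this) x
  rw [cauchySeq_iff_tendsto_dist_atTop_0]
  rw [tendsto_zero_iff_norm_tendsto_zero] at key
  simpa [dist_eq_norm] using key

end Convergence

section TracialFactor

variable {H : Type*} [NormedAddCommGroup H] [InnerProductSpace ℂ H] [CompleteSpace H]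

/-- `M` is the commutant of `R`, has trivial center, and the unit vector `Ω`, cyclic for `R`,
is a trace vector for `M`. -/
structure IsTracialFactor (M : StarSubalgebra ℂ (H →L[ℂ] H)) (R : Set (H →L[ℂ] H)) (Ω : H) :
    Prop where
  mem_iff : ∀ x, x ∈ M ↔ ∀ r ∈ R, Commute x r
  cyclic : Dense (Submodule.span ℂ ((fun r : H →L[ℂ] H => r Ω) '' R) : Set H)
  norm_vec : ‖Ω‖ = 1
  trace : ∀ x ∈ M, ∀ y ∈ M, ⟪Ω, x (y Ω)⟫_ℂ = ⟪Ω, y (x Ω)⟫_ℂ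
  center : ∀ x ∈ M, (∀ y ∈ M, Commute x y) → ∃ c : ℂ, x = c • 1

namespace IsTracialFactor

variable {M : StarSubalgebra ℂ (H →L[ℂ] H)} {R : Set (H →L[ℂ] H)} {Ω : H}

theorem commute_star (hM : IsTracialFactor M R Ω) {x : H →L[ℂ] H} (hx : x ∈ M)
    {r : H →L[ℂ] H} (hr : r ∈ R) : Commute x (star r) := by
  have := ((hM.mem_iff _).1 (star_mem hx) r hr).star_star
  simpa using this

theorem eq_zero (hM : IsTracialFactor M R Ω) {x : H →L[ℂ] H} (hx : x ∈ M) (h : x Ω = 0) :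
    x = 0 := by
  refine ContinuousLinearMap.ext_on hM.cyclic ?_
  rintro _ ⟨r, hr, rfl⟩
  have := congrArg (fun T : H →L[ℂ] H => T Ω) ((hM.mem_iff x).1 hx r hr).eq
  simpa [h] using this

theorem ext (hM : IsTracialFactor M R Ω) {x y : H →L[ℂ] H} (hx : x ∈ M) (hy : y ∈ M)
    (h : x Ω = y Ω) : x = y :=
  sub_eq_zero.1 (hM.eq_zero (sub_mem hx hy) (by simp [h]))

theorem inner_apply (x y : H →L[ℂ] H) (v w : H) :
    ⟪x v, y w⟫_ℂ = ⟪v, (star x * y) w⟫_ℂ := by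
  rw [mul_apply_eq_comp, ContinuousLinearMap.star_eq_adjoint,
    ContinuousLinearMap.adjoint_inner_right]

theorem inner_star (hM : IsTracialFactor M R Ω) {x y : H →L[ℂ] H} (hx : x ∈ M) (hy : y ∈ M) :
    ⟪star x Ω, star y Ω⟫_ℂ = ⟪y Ω, x Ω⟫_ℂ := by
  rw [inner_apply, inner_apply, star_star]
  exact hM.trace _ hx _ (star_mem hy)

theorem norm_star (hM : IsTracialFactor M R Ω) {x : H →L[ℂ] H} (hx : x ∈ M) :
    ‖star x Ω‖ = ‖x Ω‖ := by
  have := hM.inner_star hx hx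
  rw [inner_self_eq_norm_sq_to_K, inner_self_eq_norm_sq_to_K] at this
  have h2 : ‖star x Ω‖ ^ 2 = ‖x Ω‖ ^ 2 := by exact_mod_cast this
  exact (sq_eq_sq₀ (norm_nonneg _) (norm_nonneg _)).1 h2

theorem norm_mul_le (hM : IsTracialFactor M R Ω) {x y : H →L[ℂ] H} (hx : x ∈ M) (hy : y ∈ M) :
    ‖x (y Ω)‖ ≤ ‖y‖ * ‖x Ω‖ := by
  rw [← mul_apply_eq_comp, ← hM.norm_star (mul_mem hx hy), star_mul,
    mul_apply_eq_comp, ← hM.norm_star hx, ← _root_.norm_star y]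
  exact (star y).le_opNorm _

/-- A bounded sequence in `M` which is Cauchy at the trace vector converges pointwise, together
with its adjoints. -/
theorem exists_lim (hM : IsTracialFactor M R Ω) {x : ℕ → H →L[ℂ] H} (hx : ∀ n, x n ∈ M) {C : ℝ}
    (hC : ∀ n, ‖x n‖ ≤ C) (h : CauchySeq fun n => x n Ω) :
    ∃ y ∈ M, ‖y‖ ≤ C ∧ ∀ v, Tendsto (fun n => x n v) atTop (𝓝 (y v)) := by
  have h1 : ∀ v, CauchySeq fun n => x n v := by
    refine cauchySeq_apply_of_dense_span x hC hM.cyclic ?_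
    rintro _ ⟨r, hr, rfl⟩
    have : (fun n => x n (r Ω)) = fun n => r (x n Ω) := by
      ext1 n
      have := congrArg (fun T : H →L[ℂ] H => T Ω) ((hM.mem_iff _).1 (hx n) r hr).eq
      simpa using this
    simp only [this]
    exact r.uniformContinuous.comp_cauchySeq h
  choose f hf using fun v => cauchySeq_tendsto_of_complete (h1 v)
  refine ⟨continuousLinearMapOfTendsto (l := atTop) x (f := f) (tendsto_pi_nhds.2 hf), ?_, ?_, hf⟩
  · rw [hM.mem_iff]
    intro r hr
    ext v
    have h2 : Tendsto (fun n => r (x n v)) atTop (𝓝 (r (f v))) :=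
      (r.continuous.tendsto _).comp (hf v)
    refine tendsto_nhds_unique (hf (r v)) (h2.congr fun n => ?_)
    have := congrArg (fun T : H →L[ℂ] H => T v) ((hM.mem_iff _).1 (hx n) r hr).eq
    simpa using this.symm
  · have hC0 : 0 ≤ C := (norm_nonneg _).trans (hC 0)
    refine ContinuousLinearMap.opNorm_le_bound _ hC0 fun v => ?_
    exact le_of_tendsto (hf v).norm (Eventually.of_forall fun n =>
      ((x n).le_opNorm v).trans (by gcongr; exact hC n))

theorem tendsto_star (hM : IsTracialFactor M R Ω) {x : ℕ → H →L[ℂ] H} (hx : ∀ n, x n ∈ M)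
    {y : H →L[ℂ] H} (hy : y ∈ M) (h : Tendsto (fun n => x n Ω) atTop (𝓝 (y Ω))) :
    Tendsto (fun n => star (x n) Ω) atTop (𝓝 (star y Ω)) := by
  rw [tendsto_iff_norm_sub_tendsto_zero] at h ⊢
  refine h.congr fun n => ?_
  have := hM.norm_star (sub_mem (hx n) hy)
  simpa using this.symm

theorem tendsto_mul (hM : IsTracialFactor M R Ω) {x x' : ℕ → H →L[ℂ] H} (hx : ∀ n, x n ∈ M)
    {C : ℝ} (hC : ∀ n, ‖x n‖ ≤ C) {y y' : H →L[ℂ] H} (hy : y ∈ M) (hy' : y' ∈ M)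
    (h : Tendsto (fun n => x n Ω) atTop (𝓝 (y Ω)))
    (h' : Tendsto (fun n => x' n Ω) atTop (𝓝 (y' Ω))) :
    Tendsto (fun n => (x n * x' n) Ω) atTop (𝓝 ((y * y') Ω)) := by
  rw [tendsto_iff_norm_sub_tendsto_zero] at h h' ⊢
  have hlim : Tendsto (fun n => C * ‖x' n Ω - y' Ω‖ + ‖y'‖ * ‖x n Ω - y Ω‖) atTop (𝓝 0) := by
    simpa using (h'.const_mul C).add (h.const_mul ‖y'‖)
  refine squeeze_zero (fun _ => norm_nonneg _) (fun n => ?_) hlim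
  have e : (x n * x' n) Ω - (y * y') Ω = x n (x' n Ω - y' Ω) + (x n - y) (y' Ω) := by
    simp
  rw [e]
  refine (norm_add_le _ _).trans (add_le_add ?_ ?_)
  · exact ((x n).le_opNorm _).trans (by gcongr; exact hC n)
  · simpa using hM.norm_mul_le (sub_mem (hx n) hy) hy'

end IsTracialFactor

end TracialFactor

theorem cfc_mul_cfc {A : Type*} [CStarAlgebra A] (x : A) {f g : ℝ → ℝ} (hf : Continuous f)
    (hg : Continuous g) : cfc f x * cfc g x = cfc (fun t => f t * g t) x :=
  (cfc_mul f g x hf.continuousOn hg.continuousOn).symm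

theorem cfc_add_cfc {A : Type*} [CStarAlgebra A] (x : A) {f g : ℝ → ℝ} (hf : Continuous f)
    (hg : Continuous g) : cfc f x + cfc g x = cfc (fun t => f t + g t) x :=
  (cfc_add (a := x) f g hf.continuousOn hg.continuousOn).symm

theorem cfc_sub_cfc {A : Type*} [CStarAlgebra A] (x : A) {f g : ℝ → ℝ} (hf : Continuous f)
    (hg : Continuous g) : cfc f x - cfc g x = cfc (fun t => f t - g t) x :=
  (cfc_sub (a := x) f g hf.continuousOn hg.continuousOn).symm

theorem smul_one_eq_cfc {A : Type*} [CStarAlgebra A] {x : A} (hx : IsSelfAdjoint x) (c : ℝ) :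
    (c • 1 : A) = cfc (fun _ : ℝ => c) x := by
  rw [cfc_const c x hx, Algebra.algebraMap_eq_smul_one]

theorem isUnit_of_mul_eq_one_of_mul_eq_one {A : Type*} [Monoid A] {x y : A} (h : x * y = 1)
    (h' : y * x = 1) : IsUnit x :=
  ⟨⟨x, y, h, h'⟩, rfl⟩

section TracialFactor

variable {H : Type*} [NormedAddCommGroup H] [InnerProductSpace ℂ H] [CompleteSpace H]

namespace IsTracialFactor

variable {M : StarSubalgebra ℂ (H →L[ℂ] H)} {R : Set (H →L[ℂ] H)} {Ω : H}

theorem cfc_mem (hM : IsTracialFactor M R Ω) {x : H →L[ℂ] H} (hx : x ∈ M) (f : ℝ → ℝ) :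
    cfc f x ∈ M :=
  (hM.mem_iff _).2 fun r hr => ((hM.mem_iff x).1 hx r hr).cfc_real f

theorem commute_starProjection {K : Submodule ℂ H} [K.HasOrthogonalProjection] {r : H →L[ℂ] H}
    (h1 : ∀ v ∈ K, r v ∈ K) (h2 : ∀ v ∈ K, star r v ∈ K) : Commute K.starProjection r := by
  rw [ContinuousLinearMap.IsIdempotentElem.commute_iff K.isIdempotentElem_starProjection]
  rw [Submodule.range_starProjection, Submodule.ker_starProjection]
  refine ⟨h1, ?_⟩
  have : star r = r.adjoint := rfl
  exact ContinuousLinearMap.orthogonal_mem_invtSubmodule (T := r) (U := K) (by rw [← this]; exact h2)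

/-- The support projection of the positive part of `x`. -/
theorem exists_support (hM : IsTracialFactor M R Ω) {x : H →L[ℂ] H} (hx : x ∈ M)
    :
    ∃ e ∈ M, IsStarProjection e ∧ e * cfc (fun t : ℝ => max t 0) x = cfc (fun t : ℝ => max t 0) x ∧
      cfc (fun t : ℝ => max t 0) x * e = cfc (fun t : ℝ => max t 0) x ∧
      e * cfc (fun t : ℝ => max (-t) 0) x = 0 ∧ cfc (fun t : ℝ => max (-t) 0) x * e = 0 := by
  set p := cfc (fun t : ℝ => max t 0) x with hp
  set n := cfc (fun t : ℝ => max (-t) 0) x with hn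
  have hpn : p * n = 0 := by
    rw [hp, hn, cfc_mul_cfc x (by fun_prop) (by fun_prop), ← cfc_const_zero ℝ x]
    refine cfc_congr fun t _ => ?_
    rcases le_total t 0 with h | h <;> simp [h]
  have hps : IsSelfAdjoint p := cfc_predicate _ _
  have hns : IsSelfAdjoint n := cfc_predicate _ _
  let K : Submodule ℂ H := LinearMap.ker (p : H →ₗ[ℂ] H)
  have hK : IsClosed (K : Set H) := ContinuousLinearMap.isClosed_ker p
  have : CompleteSpace K := hK.completeSpace_coe
  set f : H →L[ℂ] H := K.starProjection with hf
  have hfp : IsStarProjection f := isStarProjection_starProjection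
  have hfM : f ∈ M := by
    rw [hM.mem_iff]
    intro r hr
    have hpM := hM.cfc_mem hx (fun t : ℝ => max t 0)
    refine commute_starProjection (fun v hv => ?_) (fun v hv => ?_)
    · have := congrArg (fun T : H →L[ℂ] H => T v) ((hM.mem_iff _).1 hpM r hr).eq
      have hv' : p v = 0 := hv
      change p (r v) = 0
      simpa [← hp, hv'] using this
    · have := congrArg (fun T : H →L[ℂ] H => T v) (hM.commute_star hpM hr).eq
      have hv' : p v = 0 := hv
      change p (star r v) = 0
      simpa [← hp, hv'] using this
  have hpf : p * f = 0 := by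
    ext v
    exact Submodule.starProjection_apply_mem K v
  have hfpp : f * p = 0 := by
    have := congrArg star hpf
    simpa [hps.star_eq, hfp.isSelfAdjoint.star_eq] using this
  have hfn : f * n = n := by
    ext v
    have : n v ∈ K := by
      have := congrArg (fun T : H →L[ℂ] H => T v) hpn
      simpa [K] using this
    simpa using Submodule.starProjection_eq_self_iff.2 this
  have hnf : n * f = n := by
    have := congrArg star hfn
    simpa [hns.star_eq, hfp.isSelfAdjoint.star_eq] using this
  refine ⟨1 - f, sub_mem (one_mem _) hfM, hfp.one_sub, ?_, ?_, ?_, ?_⟩ <;>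
    simp [sub_mul, mul_sub, hpf, hfpp, hfn, hnf]

/-- Real rank zero. -/
theorem exists_isUnit_selfAdjoint (hM : IsTracialFactor M R Ω) {x : H →L[ℂ] H} (hx : x ∈ M)
    (hs : IsSelfAdjoint x) {ε : ℝ} (hε : 0 < ε) :
    ∃ y ∈ M, IsSelfAdjoint y ∧ IsUnit y ∧ ‖x - y‖ ≤ ε := by
  obtain ⟨e, heM, he, h1, h2, h3, h4⟩ := hM.exists_support hx
  set p := cfc (fun t : ℝ => max t 0) x with hp
  set n := cfc (fun t : ℝ => max (-t) 0) x with hn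
  have hxpn : x = p - n := by
    rw [hp, hn, ← cfc_sub _ _ x (by fun_prop) (by fun_prop)]
    conv_lhs => rw [← cfc_id' ℝ x]
    refine cfc_congr fun t _ => ?_
    rcases le_total t 0 with h | h <;> simp [h]
  set s := 2 * e - 1 with hsdef
  have hee : e * e = e := he.isIdempotentElem
  have hss : s * s = 1 := by
    have : s * s = (4 : ℤ) • (e * e) - (4 : ℤ) • e + 1 := by rw [hsdef]; noncomm_ring
    rw [this, hee]; simp
  have hsp : s * p = p ∧ p * s = p ∧ s * n = -n ∧ n * s = -n := by
    simp [hsdef, two_mul, sub_mul, mul_sub, add_mul, mul_add, h1, h2, h3, h4]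
  have hsM : s ∈ M := by
    rw [hsdef, two_mul]; exact sub_mem (add_mem heM heM) (one_mem _)
  have hssa : IsSelfAdjoint s := by
    rw [hsdef, two_mul]
    exact (he.isSelfAdjoint.add he.isSelfAdjoint).sub (IsSelfAdjoint.one _)
  have hsn : ‖s‖ ≤ 1 := by
    have h := CStarRing.norm_self_mul_star (x := s)
    rw [hssa.star_eq, hss] at h
    have h1 : ‖(1 : H →L[ℂ] H)‖ ≤ 1 := ContinuousLinearMap.norm_id_le
    nlinarith [norm_nonneg s]
  set k := cfc (fun t : ℝ => max t 0 + max (-t) 0 + ε) x with hk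
  have hkpn : k = p + n + (ε : ℂ) • 1 := by
    change k = p + n + ε • (1 : H →L[ℂ] H)
    rw [hk, hp, hn, cfc_add_cfc x (by fun_prop) (by fun_prop), smul_one_eq_cfc hs,
      cfc_add_cfc x (by fun_prop) (by fun_prop)]
  have hpos : ∀ t : ℝ, 0 < max t 0 + max (-t) 0 + ε := fun t => by positivity
  have hkk : IsUnit k := by
    have h1 : k * cfc (fun t : ℝ => (max t 0 + max (-t) 0 + ε)⁻¹) x = 1 := by
      rw [hk, cfc_mul_cfc x (by fun_prop) (Continuous.fun_inv₀ (by fun_prop)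
        fun t => (hpos t).ne'), ← cfc_one ℝ x]
      exact cfc_congr fun t _ => mul_inv_cancel₀ (hpos t).ne'
    exact isUnit_of_mul_eq_one_of_mul_eq_one h1 ((cfc_commute_cfc _ _ x).eq.symm.trans h1)
  have hy : s * k = x + (ε : ℂ) • s := by
    simp [hkpn, mul_add, hsp.1, hsp.2.2.1, hxpn, sub_eq_add_neg]
  have hy' : k * s = x + (ε : ℂ) • s := by
    simp [hkpn, add_mul, hsp.2.1, hsp.2.2.2, hxpn, sub_eq_add_neg]
  refine ⟨s * k, mul_mem hsM (hM.cfc_mem hx _), ?_,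
    IsUnit.mul (isUnit_of_mul_eq_one_of_mul_eq_one hss hss) hkk, ?_⟩
  · have hks : IsSelfAdjoint k := cfc_predicate _ _
    rw [IsSelfAdjoint, star_mul, hks.star_eq, hssa.star_eq, hy, hy']
  · rw [hy, sub_add_cancel_left, norm_neg, norm_smul]
    simp only [Complex.norm_real, Real.norm_eq_abs, abs_of_pos hε]
    nlinarith

/-- Cut-off polar decomposition. -/
theorem exists_polar (hM : IsTracialFactor M R Ω) {x : H →L[ℂ] H} (hx : x ∈ M)
    {ε : ℝ} (hε : 0 < ε) :
    ∃ p ∈ M, ∃ v ∈ M, ∃ r ∈ M, IsStarProjection p ∧ star v * v = p ∧ (∃ l, v = x * l) ∧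
      (∃ m, p = m * x) ∧ v * r = x * p ∧ v * p = v ∧ r * (1 - p) = (ε : ℂ) • (1 - p) ∧
      p * r = r * p ∧ IsUnit r ∧ ‖x * (1 - p)‖ ≤ ε := by
  set h := star x * x with hh
  have hhM : h ∈ M := mul_mem (star_mem hx) hx
  have hhs : IsSelfAdjoint h := IsSelfAdjoint.star_mul_self x
  have hεC : ∀ z : H →L[ℂ] H, (ε : ℂ) • z = ε • z := fun z => rfl
  obtain ⟨p, hpM, hp, h1, h2, h3, h4⟩ := hM.exists_support
    (x := h - (ε ^ 2) • 1) (sub_mem hhM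
    (M.smul_mem (one_mem M) ((ε ^ 2 : ℝ) : ℂ)))
  have hshift1 : h - (ε ^ 2) • 1 = cfc (fun t : ℝ => t - ε ^ 2) h := by
    rw [smul_one_eq_cfc hhs]
    conv_lhs => enter [1]; rw [← cfc_id' ℝ h]
    rw [cfc_sub_cfc h (by fun_prop) (by fun_prop)]
  have hshift : ∀ f : ℝ → ℝ, Continuous f →
      cfc f (h - (ε ^ 2) • 1) = cfc (fun t => f (t - ε ^ 2)) h := by
    intro f hf
    rw [hshift1, ← cfc_comp' f _ h (by fun_prop) (by fun_prop)]
  rw [hshift _ (by fun_prop)] at h1 h2 h3 h4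
  -- continuity and positivity of the cut-off
  have hpos : ∀ t : ℝ, 0 < max t (ε ^ 2) := fun t => lt_max_of_lt_right (by positivity)
  have hc : Continuous fun t : ℝ => √(max t (ε ^ 2)) := by fun_prop
  have hg : Continuous fun t : ℝ => (√(max t (ε ^ 2)))⁻¹ :=
    hc.inv₀ fun t => (Real.sqrt_pos.2 (hpos t)).ne'
  set r := cfc (fun t : ℝ => √(max t (ε ^ 2))) h with hr
  set g := cfc (fun t : ℝ => (√(max t (ε ^ 2)))⁻¹) h with hgdef
  have hgr : g * r = 1 := by
    rw [hr, hgdef, cfc_mul_cfc h hg hc, ← cfc_one ℝ h]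
    exact cfc_congr fun t _ => inv_mul_cancel₀ (Real.sqrt_pos.2 (hpos t)).ne'
  have hrg : r * g = 1 := (cfc_commute_cfc _ _ h).eq.trans hgr
  have hgs : IsSelfAdjoint g := cfc_predicate _ _
  have hps : IsSelfAdjoint p := hp.isSelfAdjoint
  have hpp : p * p = p := hp.isIdempotentElem
  set P := cfc (fun t : ℝ => max (t - ε ^ 2) 0) h with hP
  set N := cfc (fun t : ℝ => max (-(t - ε ^ 2)) 0) h with hN
  have hhPN : h = P - N + (ε ^ 2) • 1 := by
    have : P - N = h - (ε ^ 2) • 1 := by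
      rw [hshift1, hP, hN, cfc_sub_cfc h (by fun_prop) (by fun_prop)]
      refine cfc_congr fun t _ => ?_
      rcases le_total (t - ε ^ 2) 0 with h | h
      · simp only [max_eq_right h, max_eq_left (neg_nonneg.2 h)]; ring
      · simp only [max_eq_left h, max_eq_right (neg_nonpos.2 h)]; ring
    rw [this]; simp
  have hcomm_h : p * h = h * p := by
    rw [hhPN]; simp [mul_add, add_mul, mul_sub, sub_mul, h1, h2, h3, h4]
  have hpc : ∀ f : ℝ → ℝ, p * cfc f h = cfc f h * p := fun f =>
    ((show Commute h p from hcomm_h.symm).cfc_real f).eq.symm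
  have hgp : p * g = g * p := hpc _
  have hrp : p * r = r * p := hpc _
  -- `g * h * g * p = p`
  have hghg : p * (g * (h * g)) = p := by
    have hk : Continuous fun t : ℝ => -(max t (ε ^ 2))⁻¹ :=
      ((continuous_id.max continuous_const).inv₀ fun t => (hpos t).ne').neg
    have e1 : g * (h * g) = 1 + N * cfc (fun t : ℝ => -(max t (ε ^ 2))⁻¹) h := by
      conv_lhs => enter [2, 1]; rw [← cfc_id' ℝ h]
      rw [hgdef, hN, cfc_mul_cfc h (by fun_prop) hg,
        cfc_mul_cfc h hg (.fun_mul (f := fun t : ℝ => t) (by fun_prop) hg),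
        cfc_mul_cfc h (by fun_prop) hk,
        ← cfc_one ℝ h, Pi.one_def, cfc_add_cfc h (by fun_prop) (.fun_mul (by fun_prop) hk)]
      refine cfc_congr fun t _ => ?_
      have hsq : √(max t (ε ^ 2)) * √(max t (ε ^ 2)) = max t (ε ^ 2) :=
        Real.mul_self_sqrt (hpos t).le
      have e2 : (√(max t (ε ^ 2)))⁻¹ * (t * (√(max t (ε ^ 2)))⁻¹) = t * (max t (ε ^ 2))⁻¹ := by
        rw [← hsq, mul_inv, hsq]; ring
      simp only [e2]
      have := (hpos t).ne'
      rcases le_total t (ε ^ 2) with h | h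
      · rw [max_eq_right h] at this ⊢
        rw [max_eq_left (by linarith)]
        field_simp
        simp
      · rw [max_eq_left h] at this ⊢
        rw [max_eq_right (by linarith)]
        field_simp
        simp
    rw [e1, mul_add, mul_one, ← mul_assoc, h3, zero_mul, add_zero]
  have hvv : star (x * g * p) * (x * g * p) = p := by
    rw [star_mul, star_mul, hps.star_eq, hgs.star_eq]
    calc p * (g * star x) * (x * g * p) = p * (g * (h * g)) * p := by
          rw [hh]; simp only [mul_assoc]
      _ = p := by rw [hghg, hpp]
  refine ⟨p, hpM, x * g * p, mul_mem (mul_mem hx (hM.cfc_mem hhM _)) hpM, r, hM.cfc_mem hhM _,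
    hp, hvv, ⟨g * p, by rw [mul_assoc]⟩, ⟨p * g * g * star x, ?_⟩, ?_, ?_, ?_, hrp,
    isUnit_of_mul_eq_one_of_mul_eq_one hrg hgr, ?_⟩
  · have e : h * g = g * h := by
      have := cfc_commute_cfc (fun t : ℝ => t) (fun t : ℝ => (√(max t (ε ^ 2)))⁻¹) h
      rw [cfc_id' ℝ h] at this
      exact this.eq
    calc p = p * (g * (h * g)) := hghg.symm
      _ = p * g * g * star x * x := by rw [e, hh]; simp only [mul_assoc]
  · rw [mul_assoc, hrp, mul_assoc, ← mul_assoc g r p, hgr, one_mul]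
  · rw [mul_assoc, hpp]
  · have hk : Continuous fun t : ℝ => (√(max t (ε ^ 2)) + ε)⁻¹ :=
      (hc.add continuous_const).inv₀ fun t => (add_pos_of_nonneg_of_pos (Real.sqrt_nonneg _) hε).ne'
    have e1 : r = cfc (fun t : ℝ => (√(max t (ε ^ 2)) + ε)⁻¹) h * P + ε • 1 := by
      rw [smul_one_eq_cfc hhs, hr, hP, cfc_mul_cfc h hk (by fun_prop),
        cfc_add_cfc h (.fun_mul hk (by fun_prop)) continuous_const]
      refine cfc_congr fun t _ => ?_
      have hsq : √(max t (ε ^ 2)) ^ 2 = max t (ε ^ 2) := Real.sq_sqrt (hpos t).le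
      have h0 : √(max t (ε ^ 2)) + ε ≠ 0 := by positivity
      have hm : max (t - ε ^ 2) 0 = max t (ε ^ 2) - ε ^ 2 := by
        rcases le_total t (ε ^ 2) with h | h
        · rw [max_eq_right h, max_eq_right (by linarith)]; ring
        · rw [max_eq_left h, max_eq_left (by linarith)]
      simp only [hm]
      field_simp
      linear_combination hsq
    rw [hεC]
    conv_lhs => rw [e1, add_mul, mul_assoc, mul_sub, mul_one, h2, sub_self, mul_zero, zero_add]
    simp
  · have hps' : IsSelfAdjoint (1 - p) := (IsSelfAdjoint.one _).sub hps
    have e0 : cfc (fun t : ℝ => ε ^ 2 - max (-(t - ε ^ 2)) 0) h = (ε ^ 2) • 1 - N := by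
      rw [smul_one_eq_cfc hhs, hN, cfc_sub_cfc h (by fun_prop) (by fun_prop)]
    have e1 : star (x * (1 - p)) * (x * (1 - p)) =
        (1 - p) * (cfc (fun t : ℝ => ε ^ 2 - max (-(t - ε ^ 2)) 0) h * (1 - p)) := by
      have : h * (1 - p) = ((ε ^ 2) • 1 - N) * (1 - p) := by
        conv_lhs => rw [hhPN]
        simp [add_mul, sub_mul, mul_sub, h2]
        abel
      rw [e0, ← this, star_mul, hps'.star_eq, hh]
      simp only [mul_assoc]
    have hn1 : ‖1 - p‖ ≤ 1 := hp.one_sub.norm_le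
    have hn2 : ‖cfc (fun t : ℝ => ε ^ 2 - max (-(t - ε ^ 2)) 0) h‖ ≤ ε ^ 2 := by
      refine norm_cfc_le (by positivity) fun t ht => ?_
      have ht0 : 0 ≤ t := spectrum_star_mul_self_nonneg t ht
      rw [Real.norm_eq_abs, abs_le]
      constructor
      · rcases le_total (-(t - ε ^ 2)) 0 with h | h
        · rw [max_eq_right h]; nlinarith
        · rw [max_eq_left h]; nlinarith
      · linarith [le_max_right (-(t - ε ^ 2)) 0]
    have e2 : ‖x * (1 - p)‖ * ‖x * (1 - p)‖ ≤ ε ^ 2 := by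
      rw [← CStarRing.norm_star_mul_self, e1]
      calc _ ≤ ‖1 - p‖ * (‖cfc (fun t : ℝ => ε ^ 2 - max (-(t - ε ^ 2)) 0) h‖ * ‖1 - p‖) :=
            (_root_.norm_mul_le _ _).trans (by gcongr; exact _root_.norm_mul_le _ _)
        _ ≤ 1 * (ε ^ 2 * 1) := by gcongr
        _ = ε ^ 2 := by ring
    nlinarith [norm_nonneg (x * (1 - p))]

end IsTracialFactor
end TracialFactor

section TracialFactor

variable {H : Type*} [NormedAddCommGroup H] [InnerProductSpace ℂ H] [CompleteSpace H]

namespace IsTracialFactor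

variable {M : StarSubalgebra ℂ (H →L[ℂ] H)} {R : Set (H →L[ℂ] H)} {Ω : H}

theorem eq_zero_of_forall_mul_mul_eq_zero (hM : IsTracialFactor M R Ω) {e f : H →L[ℂ] H}
    (hf : f ∈ M) (he : e ≠ 0) (h : ∀ y ∈ M, f * y * e = 0) : f = 0 := by
  let K : Submodule ℂ H := ⨅ y : M, LinearMap.ker ((f * y : H →L[ℂ] H) : H →ₗ[ℂ] H)
  have hKm : ∀ v, v ∈ K ↔ ∀ y ∈ M, f (y v) = 0 := by
    intro v
    simp [K, Submodule.mem_iInf]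
  have hK : IsClosed (K : Set H) := by
    simp only [K, Submodule.coe_iInf]
    exact isClosed_iInter fun y => ContinuousLinearMap.isClosed_ker (f * y : H →L[ℂ] H)
  have : CompleteSpace K := hK.completeSpace_coe
  have hKM : ∀ x ∈ M, ∀ v ∈ K, x v ∈ K := by
    intro x hx v hv
    rw [hKm] at hv ⊢
    exact fun y hy => hv _ (mul_mem hy hx)
  have hKc : ∀ r : H →L[ℂ] H, (∀ x ∈ M, Commute x r) → ∀ v ∈ K, r v ∈ K := by
    intro r hr v hv
    rw [hKm] at hv ⊢
    intro y hy
    have := congrArg (fun T : H →L[ℂ] H => T v) (hr _ (mul_mem hf hy)).eq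
    simp only [mul_apply_eq_comp] at this
    rw [this, hv y hy, map_zero]
  have hPM : K.starProjection ∈ M := by
    rw [hM.mem_iff]
    exact fun r hr => commute_starProjection (hKc r fun x hx => (hM.mem_iff x).1 hx r hr)
      (hKc _ fun x hx => hM.commute_star hx hr)
  obtain ⟨c, hc⟩ := hM.center _ hPM fun y hy =>
    commute_starProjection (hKM y hy) (hKM _ (star_mem hy))
  obtain ⟨v, hv⟩ : ∃ v, e v ≠ 0 := by
    by_contra! h0
    exact he (ContinuousLinearMap.ext h0)
  have hev : e v ∈ K := (hKm _).2 fun y hy => by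
    simpa using congrArg (fun T : H →L[ℂ] H => T v) (h y hy)
  have h1 : c • e v = e v := by
    have := Submodule.starProjection_eq_self_iff.2 hev
    rwa [hc] at this
  have hc1 : c = 1 := by
    have : (c - 1) • e v = 0 := by rw [sub_smul, h1, one_smul, sub_self]
    rcases smul_eq_zero.1 this with h | h
    · exact sub_eq_zero.1 h
    · exact absurd h hv
  ext w
  have hw : w ∈ K := by
    rw [← Submodule.starProjection_eq_self_iff, hc, hc1]; simp
  simpa using (hKm w).1 hw 1 (one_mem M)

/-- Any isometry in `M` is unitary. -/
theorem mul_star_eq_one (hM : IsTracialFactor M R Ω) {x : H →L[ℂ] H} (hx : x ∈ M)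
    (h : star x * x = 1) : x * star x = 1 := by
  have hg : 1 - x * star x ∈ M := sub_mem (one_mem _) (mul_mem hx (star_mem hx))
  have hgg : star (1 - x * star x) * (1 - x * star x) = 1 - x * star x := by
    have : x * star x * (x * star x) = x * star x := by
      rw [mul_assoc, ← mul_assoc (star x), h, one_mul]
    simp [mul_sub, sub_mul, this]
  have h0 : ⟪(1 - x * star x) Ω, (1 - x * star x) Ω⟫_ℂ = 0 := by
    rw [inner_apply, hgg]
    have := hM.trace x hx _ (star_mem hx)
    simp only [← mul_apply_eq_comp, h] at this
    simp only [sub_apply, inner_sub_right, mul_apply_eq_comp] at this ⊢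
    simp [this]
  exact (sub_eq_zero.1 (hM.eq_zero hg (inner_self_eq_zero.1 h0))).symm

/-- `w` extends the partial isometry `v`. -/
def Extends (v w : H →L[ℂ] H) : Prop :=
  star w * v = star v * v ∧ w * star v = v * star v

/-- `v` is a partial isometry in `M` with initial projection below `e` and final projection
below `f`. -/
structure IsPartialIsometryBelow (M : StarSubalgebra ℂ (H →L[ℂ] H)) (e f v : H →L[ℂ] H) :
    Prop where
  mem : v ∈ M
  pi : v * star v * v = v
  left : f * v = v
  right : v * e = v

theorem Extends.refl (v : H →L[ℂ] H) : Extends v v := ⟨rfl, rfl⟩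

theorem Extends.trans {e f v w u : H →L[ℂ] H} (hv : IsPartialIsometryBelow M e f v)
    (h : Extends v w) (h' : Extends w u) : Extends v u := by
  have h2 : star v * v * star v = star v := by
    have := congrArg star hv.pi
    simpa [mul_assoc] using this
  constructor
  · calc star u * v = star u * (v * star v * v) := by rw [hv.pi]
      _ = star u * w * (star v * v) := by rw [← h.2]; simp only [mul_assoc]
      _ = star w * (w * star v) * v := by rw [h'.1]; simp only [mul_assoc]
      _ = star w * v := by rw [h.2, mul_assoc, hv.pi]
      _ = star v * v := h.1
  · calc u * star v = u * (star v * v * star v) := by rw [h2]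
      _ = u * star w * (v * star v) := by rw [← h.1]; simp only [mul_assoc]
      _ = w * (star w * v) * star v := by rw [h'.2]; simp only [mul_assoc]
      _ = w * star v := by rw [h.1, mul_assoc, h2]
      _ = v * star v := h.2

theorem Extends.norm_sub_sq {v w : H →L[ℂ] H} (h : Extends v w) (Ω : H) :
    ‖w Ω - v Ω‖ ^ 2 = ‖w Ω‖ ^ 2 - ‖v Ω‖ ^ 2 := by
  have h1 : ⟪w Ω, v Ω⟫_ℂ = ⟪v Ω, v Ω⟫_ℂ := by
    rw [inner_apply, h.1, ← inner_apply]
  rw [@_root_.norm_sub_sq ℂ, h1, inner_self_eq_norm_sq_to_K]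
  norm_cast
  ring

theorem IsPartialIsometryBelow.norm_le {e f v : H →L[ℂ] H}
    (hv : IsPartialIsometryBelow M e f v) : ‖v‖ ≤ 1 := by
  have hp : IsStarProjection (star v * v) :=
    ⟨by rw [IsIdempotentElem, mul_assoc, ← mul_assoc v, hv.pi], IsSelfAdjoint.star_mul_self v⟩
  have h1 := hp.norm_le
  rw [CStarRing.norm_star_mul_self] at h1
  nlinarith [norm_nonneg v]

theorem IsPartialIsometryBelow.extend (hM : IsTracialFactor M R Ω) {e f v : H →L[ℂ] H}
    (hv : IsPartialIsometryBelow M e f v) (heM : e ∈ M) (hfM : f ∈ M)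
    (he : IsStarProjection e) (hf : IsStarProjection f)
    (h1 : star v * v ≠ e) (h2 : v * star v ≠ f) :
    ∃ w, IsPartialIsometryBelow M e f w ∧ Extends v w ∧ ‖v Ω‖ ^ 2 < ‖w Ω‖ ^ 2 := by
  set e' := e - star v * v with he'
  set f' := f - v * star v with hf'
  have he'0 : e' ≠ 0 := fun h => h1 (sub_eq_zero.1 h).symm
  have hf'0 : f' ≠ 0 := fun h => h2 (sub_eq_zero.1 h).symm
  have hsv := star_mem hv.mem
  have he'M : e' ∈ M := sub_mem heM (mul_mem hsv hv.mem)
  have hf'M : f' ∈ M := sub_mem hfM (mul_mem hv.mem hsv)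
  have hpi' : star v * v * star v = star v := by
    have := congrArg star hv.pi
    simpa [mul_assoc] using this
  have hl' : star v * f = star v := by
    have := congrArg star hv.left
    simpa [hf.isSelfAdjoint.star_eq] using this
  have hr' : e * star v = star v := by
    have := congrArg star hv.right
    simpa [he.isSelfAdjoint.star_eq] using this
  have hee : e * e = e := he.isIdempotentElem
  have hff : f * f = f := hf.isIdempotentElem
  have hpi := hv.pi
  have hvf' : star v * f' = 0 := by
    rw [hf', mul_sub, hl', ← mul_assoc, hpi', sub_self]
  have hev' : e' * star v = 0 := by
    rw [he', sub_mul, hr', hpi', sub_self]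
  have hf'v : f' * v = 0 := by rw [hf', sub_mul, hv.left, hpi, sub_self]
  have hff' : f * f' = f' := by rw [hf', mul_sub, hff, ← mul_assoc, hv.left]
  have he'e : e' * e = e' := by rw [he', sub_mul, hee, mul_assoc, hv.right]
  have he'e' : e' * e' = e' := by
    conv_lhs => rw [he', mul_sub, ← mul_assoc, ← he', he'e, hev']
    simp
  have hf'f' : f' * f' = f' := by
    conv_lhs => rw [hf', sub_mul, mul_assoc, ← hf', hff', hvf']
    simp
  obtain ⟨y, hy, hz⟩ : ∃ y ∈ M, f' * y * e' ≠ 0 := by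
    by_contra! h
    exact hf'0 (hM.eq_zero_of_forall_mul_mul_eq_zero hf'M he'0 h)
  set z := f' * y * e' with hzdef
  have hzM : z ∈ M := mul_mem (mul_mem hf'M hy) he'M
  have hz0 : 0 < ‖z‖ := norm_pos_iff.2 hz
  obtain ⟨p, hpM, u, huM, r, hrM, hp, huu, ⟨l, hl⟩, ⟨m, hm⟩, -, hup, -, -, -, hn⟩ :=
    hM.exists_polar hzM (half_pos hz0)
  have hp0 : p ≠ 0 := by
    rintro rfl
    rw [sub_zero, mul_one] at hn
    linarith
  have hu0 : u ≠ 0 := by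
    rintro rfl
    simp at huu
    exact hp0 huu.symm
  have hf'u : f' * u = u := by
    rw [hl, hzdef]; simp only [← mul_assoc]; rw [hf'f']
  have hpe' : p * e' = p := by
    rw [hm, hzdef]; simp only [mul_assoc]; rw [he'e']
  have hue' : u * e' = u := by rw [← hup, mul_assoc, hpe']
  have a1 : star v * u = 0 := by rw [← hf'u, ← mul_assoc, hvf', zero_mul]
  have a2 : u * star v = 0 := by rw [← hue', mul_assoc, hev', mul_zero]
  have a3 : star u * v = 0 := by simpa using congrArg star a1
  have a4 : v * star u = 0 := by simpa using congrArg star a2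
  have hext : Extends v (v + u) := by
    constructor <;> simp [add_mul, a2, a3]
  refine ⟨v + u, ⟨add_mem hv.mem huM, ?_, ?_, ?_⟩, hext, ?_⟩
  · have : u * star u * u = u := by rw [mul_assoc, huu, hup]
    simp only [star_add, add_mul, mul_add, a4, a2, hpi, this, mul_assoc, a1, a3]
    simp
  · rw [mul_add, hv.left, ← hf'u, ← mul_assoc, hff']
  · rw [add_mul, hv.right, ← hue', mul_assoc, he'e]
  · have h3 := hext.norm_sub_sq Ω
    have h4 : 0 < ‖u Ω‖ := norm_pos_iff.2 fun h => hu0 (hM.eq_zero huM h)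
    have h5 : (v + u) Ω - v Ω = u Ω := by simp
    rw [h5] at h3
    have := pow_pos h4 2
    linarith

theorem exists_maximal_extension (hM : IsTracialFactor M R Ω) {e f v₀ : H →L[ℂ] H}
    (heM : e ∈ M) (hfM : f ∈ M) (he : IsStarProjection e) (hf : IsStarProjection f)
    (hv₀ : IsPartialIsometryBelow M e f v₀) :
    ∃ v, IsPartialIsometryBelow M e f v ∧ Extends v₀ v ∧ (star v * v = e ∨ v * star v = f) := by
  have hbd : ∀ w, IsPartialIsometryBelow M e f w → ‖w Ω‖ ^ 2 ≤ 1 := fun w hw => by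
    have h1 : ‖w Ω‖ ≤ 1 := by
      have := w.le_opNorm Ω
      rw [hM.norm_vec, mul_one] at this
      exact this.trans hw.norm_le
    nlinarith [norm_nonneg (w Ω)]
  have step : ∀ v : {v // IsPartialIsometryBelow M e f v}, ∀ δ : ℝ, 0 < δ →
      ∃ w : {v // IsPartialIsometryBelow M e f v}, Extends v.1 w.1 ∧
        ∀ u, IsPartialIsometryBelow M e f u → Extends v.1 u → ‖u Ω‖ ^ 2 ≤ ‖w.1 Ω‖ ^ 2 + δ := by
    intro v δ hδ
    let S : Set ℝ := {t | ∃ w, IsPartialIsometryBelow M e f w ∧ Extends v.1 w ∧ t = ‖w Ω‖ ^ 2}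
    have hne : S.Nonempty := ⟨_, v.1, v.2, .refl _, rfl⟩
    have hb : BddAbove S := ⟨1, by rintro _ ⟨w, hw, _, rfl⟩; exact hbd w hw⟩
    obtain ⟨_, ⟨w, hw, hvw, rfl⟩, hlt⟩ := exists_lt_of_lt_csSup hne (sub_lt_self (sSup S) hδ)
    refine ⟨⟨w, hw⟩, hvw, fun u hu hvu => ?_⟩
    have := le_csSup hb (show ‖u Ω‖ ^ 2 ∈ S from ⟨u, hu, hvu, rfl⟩)
    linarith
  choose F hF1 hF2 using step
  let V : ℕ → {v // IsPartialIsometryBelow M e f v} := fun n =>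
    Nat.rec ⟨v₀, hv₀⟩ (fun n v => F v (1 / ((n : ℝ) + 1)) Nat.one_div_pos_of_nat) n
  have hVs : ∀ n : ℕ, V (n + 1) = F (V n) (1 / ((n : ℝ) + 1)) Nat.one_div_pos_of_nat :=
    fun n => rfl
  have hmono : ∀ m n, m ≤ n → Extends (V m).1 (V n).1 := by
    intro m n hmn
    induction n, hmn using Nat.le_induction with
    | base => exact .refl _
    | succ n _ ih =>
      refine ih.trans (V m).2 ?_
      rw [hVs]; exact hF1 _ _ _
  set a : ℕ → ℝ := fun n => ‖(V n).1 Ω‖ ^ 2 with ha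
  have hVa : ∀ m n, m ≤ n → ‖(V n).1 Ω - (V m).1 Ω‖ ^ 2 = a n - a m := fun m n h =>
    (hmono m n h).norm_sub_sq Ω
  have hamono : Monotone a := fun m n h => by
    have := hVa m n h
    nlinarith [sq_nonneg ‖(V n).1 Ω - (V m).1 Ω‖]
  have hacs : CauchySeq a :=
    (tendsto_atTop_ciSup hamono ⟨1, by rintro _ ⟨n, rfl⟩; exact hbd _ (V n).2⟩).cauchySeq
  have hcs : CauchySeq fun n => (V n).1 Ω := by
    rw [Metric.cauchySeq_iff'] at hacs ⊢
    intro ε hε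
    obtain ⟨N, hN⟩ := hacs (ε ^ 2) (by positivity)
    refine ⟨N, fun n hn => ?_⟩
    have h1 := hN n hn
    rw [Real.dist_eq] at h1
    have h2 := hVa N n hn
    rw [dist_eq_norm]
    have h3 := le_abs_self (a n - a N)
    exact lt_of_pow_lt_pow_left₀ 2 hε.le (by linarith)
  obtain ⟨v, hvM, hv1, hlim⟩ := hM.exists_lim (fun n => (V n).2.mem) (fun n => (V n).2.norm_le) hcs
  have hlimΩ := hlim Ω
  have hlims := hM.tendsto_star (fun n => (V n).2.mem) hvM hlimΩ
  have hbs : ∀ n, ‖star (V n).1‖ ≤ 1 := fun n => by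
    rw [_root_.norm_star]; exact (V n).2.norm_le
  have hsm : ∀ n, star (V n).1 ∈ M := fun n => star_mem (V n).2.mem
  have hvsM := star_mem hvM
  have hvbelow : IsPartialIsometryBelow M e f v := by
    refine ⟨hvM, ?_, ?_, ?_⟩
    · have l1 := hM.tendsto_mul hsm hbs hvsM hvM hlims hlimΩ
      have l2 := hM.tendsto_mul (fun n => (V n).2.mem) (fun n => (V n).2.norm_le) hvM
        (mul_mem hvsM hvM) hlimΩ l1
      rw [mul_assoc]
      refine hM.ext (mul_mem hvM (mul_mem hvsM hvM)) hvM (tendsto_nhds_unique l2 ?_)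
      simpa only [← mul_assoc, (V _).2.pi] using hlimΩ
    · refine hM.ext (mul_mem hfM hvM) hvM (tendsto_nhds_unique
        ((f.continuous.tendsto _).comp hlimΩ) (hlimΩ.congr fun n => ?_))
      conv_lhs => rw [← (V n).2.left]
      rfl
    · refine hM.ext (mul_mem hvM heM) hvM (tendsto_nhds_unique (hlim (e Ω))
        (hlimΩ.congr fun n => ?_))
      conv_lhs => rw [← (V n).2.right]
      rfl
  have hVext : ∀ m, Extends (V m).1 v := by
    intro m
    have hm := (V m).2.mem
    constructor
    · have l1 := hM.tendsto_mul hsm hbs hvsM hm hlims tendsto_const_nhds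
      refine hM.ext (mul_mem hvsM hm) (mul_mem (hsm m) hm) (tendsto_nhds_unique l1 ?_)
      refine tendsto_const_nhds.congr' ?_
      filter_upwards [eventually_ge_atTop m] with n hn
      rw [(hmono m n hn).1]
    · refine hM.ext (mul_mem hvM (hsm m)) (mul_mem hm (hsm m))
        (tendsto_nhds_unique (hlim (star (V m).1 Ω)) ?_)
      refine tendsto_const_nhds.congr' ?_
      filter_upwards [eventually_ge_atTop m] with n hn
      rw [← mul_apply_eq_comp, (hmono m n hn).2]
  refine ⟨v, hvbelow, hVext 0, ?_⟩
  by_contra! hne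
  obtain ⟨w, hw, hvw, hlt⟩ := hvbelow.extend hM heM hfM he hf hne.1 hne.2
  have hle : ∀ n : ℕ, ‖w Ω‖ ^ 2 ≤ ‖v Ω‖ ^ 2 + 1 / ((n : ℝ) + 1) := by
    intro n
    have h1 := hF2 (V n) (1 / ((n : ℝ) + 1)) Nat.one_div_pos_of_nat w hw
      ((hVext n).trans (V n).2 hvw)
    rw [← hVs] at h1
    have h2 := (hVext (n + 1)).norm_sub_sq Ω
    nlinarith [sq_nonneg ‖v Ω - (V (n + 1)).1 Ω‖]
  have := ge_of_tendsto' (tendsto_const_nhds.add tendsto_one_div_add_atTop_nhds_zero_nat) hle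
  linarith

/-- Stable rank one. -/
theorem exists_isUnit (hM : IsTracialFactor M R Ω) {x : H →L[ℂ] H} (hx : x ∈ M)
    {ε : ℝ} (hε : 0 < ε) : ∃ y ∈ M, IsUnit y ∧ ‖x - y‖ ≤ ε := by
  obtain ⟨p, hpM, v, hvM, r, hrM, hp, hvv, -, -, hvr, hvp, hr1, hpr, hru, hn⟩ :=
    hM.exists_polar hx (half_pos hε)
  obtain ⟨U, hU, hext, hU1⟩ := hM.exists_maximal_extension (one_mem M) (one_mem M)
    (.one _) (.one _) (v₀ := v)
    ⟨hvM, by rw [mul_assoc, hvv, hvp], one_mul _, mul_one _⟩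
  have hUU : star U * U = 1 ∧ U * star U = 1 := by
    rcases hU1 with h | h
    · exact ⟨h, hM.mul_star_eq_one hU.mem h⟩
    · exact ⟨by simpa using hM.mul_star_eq_one (star_mem hU.mem) (by simpa using h), h⟩
  have hUp : U * p = v := by
    rw [← hvv, ← hext.1, ← mul_assoc, hUU.2, one_mul]
  refine ⟨U * r, mul_mem hU.mem hrM,
    (isUnit_of_mul_eq_one_of_mul_eq_one hUU.2 hUU.1).mul hru, ?_⟩
  have hUn : ‖U‖ ≤ 1 := hU.norm_le
  have hpn : ‖1 - p‖ ≤ 1 := hp.one_sub.norm_le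
  have key : x - U * r = x * (1 - p) - ((ε / 2 : ℝ) : ℂ) • (U * (1 - p)) := by
    have h1 : U * r = U * (r * (1 - p)) + U * p * r := by
      rw [mul_assoc, hpr]; noncomm_ring
    rw [h1, hUp, hvr, hr1, mul_smul_comm]
    noncomm_ring
  rw [key]
  calc _ ≤ ‖x * (1 - p)‖ + ‖((ε / 2 : ℝ) : ℂ) • (U * (1 - p))‖ := norm_sub_le _ _
    _ ≤ ε / 2 + ε / 2 * (1 * 1) := by
      rw [norm_smul, Complex.norm_real, Real.norm_of_nonneg (half_pos hε).le]
      gcongr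
      exact (_root_.norm_mul_le _ _).trans (by gcongr)
    _ = ε := by ring

end IsTracialFactor
end TracialFactor

section TracialFactor

variable {H : Type*} [NormedAddCommGroup H] [InnerProductSpace ℂ H] [CompleteSpace H]

namespace IsTracialFactor

variable {M : StarSubalgebra ℂ (H →L[ℂ] H)} {R : Set (H →L[ℂ] H)} {Ω : H}

theorem norm_le_of_mem_Icc {x : H →L[ℂ] H} (hx : IsSelfAdjoint x) {N : ℝ} (hN : 0 ≤ N)
    (h1 : x ≤ N • 1) (h2 : -(N • 1) ≤ x) : ‖x‖ ≤ N := by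
  rw [← Algebra.algebraMap_eq_smul_one] at h1
  rw [← neg_smul, ← Algebra.algebraMap_eq_smul_one] at h2
  rw [← cfc_id' ℝ x]
  refine norm_cfc_le hN fun t ht => ?_
  rw [Real.norm_eq_abs, abs_le]
  exact ⟨(algebraMap_le_iff_le_spectrum (R := ℝ)).1 h2 t ht,
    (le_algebraMap_iff_spectrum_le (R := ℝ)).1 h1 t ht⟩

theorem exists_swap {e v : H →L[ℂ] H}
    (heM : e ∈ M) (he : IsStarProjection e) (hv : IsPartialIsometryBelow M e (1 - e) v)
    (hve : star v * v = e) :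
    ∃ w ∈ M, star w = w ∧ w * w = 1 ∧ e + w * e * w ≤ 1 := by
  have hee : e * e = e := he.isIdempotentElem
  have hes : star e = e := he.isSelfAdjoint
  have a1 : e * v = 0 := by
    have := hv.left
    rw [sub_mul, one_mul, sub_eq_self] at this
    exact this
  have a2 : v * e = v := hv.right
  have a3 : star v * e = 0 := by simpa [hes] using congrArg star a1
  have a4 : e * star v = star v := by simpa [hes] using congrArg star a2
  have a5 : v * v = 0 := by
    calc v * v = v * e * v := by rw [a2]
      _ = 0 := by rw [mul_assoc, a1, mul_zero]
  have a6 : star v * star v = 0 := by simpa using congrArg star a5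
  set q := v * star v with hq
  have b1 : v * q = 0 := by rw [hq, ← mul_assoc, a5, zero_mul]
  have b2 : star v * q = star v := by rw [hq, ← mul_assoc, hve, a4]
  have b3 : q * v = v := hv.pi
  have b4 : q * star v = 0 := by rw [hq, mul_assoc, a6, mul_zero]
  have b5 : e * q = 0 := by rw [hq, ← mul_assoc, a1, zero_mul]
  have b6 : q * e = 0 := by rw [hq, mul_assoc, a3, mul_zero]
  have b7 : q * q = q := by
    conv_lhs => rw [hq, ← mul_assoc, ← hq, b3]
  have hqs : star q = q := by simp [hq]
  set w := v + star v + (1 - e - q) with hw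
  have hwM : w ∈ M := add_mem (add_mem hv.mem (star_mem hv.mem))
    (sub_mem (sub_mem (one_mem _) heM) (mul_mem hv.mem (star_mem hv.mem)))
  have hws : star w = w := by
    simp only [hw, star_add, star_sub, star_star, star_one, hes, hqs]; abel
  have hww : w * w = 1 := by
    simp only [hw, add_mul, mul_add, sub_mul, mul_sub, one_mul, mul_one, a1, a2, a3, a4, a5, a6,
      hve, b1, b2, b3, b4, b5, b6, b7, hee, ← hq]
    abel
  have hwe : w * e * w = q := by
    have : w * e = v := by
      simp only [hw, add_mul, sub_mul, one_mul, a2, a3, hee, b6]; abel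
    rw [this]
    simp only [hw, mul_add, mul_sub, mul_one, a5, a2, b1, ← hq]; abel
  refine ⟨w, hwM, hws, hww, ?_⟩
  rw [hwe]
  have : IsStarProjection (1 - e - q) := by
    refine ⟨?_, ?_⟩
    · simp only [IsIdempotentElem, mul_sub, sub_mul, mul_one, one_mul, hee, b5, b6, b7]; abel
    · simp [IsSelfAdjoint, hes, hqs]
  have h := this.nonneg
  rw [sub_sub] at h
  exact sub_nonneg.1 h

theorem exists_average {x e v : H →L[ℂ] H}
    (hs : IsSelfAdjoint x) {N : ℝ} (hN : 0 ≤ N) (h1 : x ≤ N • e) (h2 : -(N • 1) ≤ x)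
    (heM : e ∈ M) (he : IsStarProjection e) (hv : IsPartialIsometryBelow M e (1 - e) v)
    (hve : star v * v = e) :
    ∃ w ∈ M, star w * w = 1 ∧ w * star w = 1 ∧
      ‖(2⁻¹ : ℝ) • (x + w * x * star w) - (-(N / 4)) • 1‖ ≤ 3 / 4 * N := by
  obtain ⟨w, hwM, hws, hww, c3⟩ := exists_swap heM he hv hve
  have hwsa : IsSelfAdjoint w := hws
  refine ⟨w, hwM, by rw [hws, hww], by rw [hws, hww], ?_⟩
  rw [hws]
  have hwxw : IsSelfAdjoint (w * x * w) := by
    have := hs.conjugate w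
    rwa [hws] at this
  have c1 : w * x * w ≤ N • (w * e * w) := by
    have := hwsa.conjugate_le_conjugate h1
    rwa [mul_smul_comm, smul_mul_assoc] at this
  have c2 : -(N • 1) ≤ w * x * w := by
    have := hwsa.conjugate_le_conjugate h2
    rwa [mul_neg, neg_mul, mul_smul_comm, smul_mul_assoc, mul_one, hww] at this
  have c4 : x + w * x * w ≤ N • 1 :=
    (add_le_add h1 c1).trans (by rw [← smul_add]; exact smul_le_smul_of_nonneg_left c3 hN)
  have c5 : -((2 * N) • 1) ≤ x + w * x * w := by
    have := add_le_add h2 c2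
    rwa [← neg_add, ← add_smul, ← two_mul] at this
  have d1 : (2⁻¹ : ℝ) • (x + w * x * w) ≤ (2⁻¹ : ℝ) • N • 1 :=
    smul_le_smul_of_nonneg_left c4 (by norm_num)
  have d2 : (2⁻¹ : ℝ) • -((2 * N) • 1) ≤ (2⁻¹ : ℝ) • (x + w * x * w) :=
    smul_le_smul_of_nonneg_left c5 (by norm_num)
  refine norm_le_of_mem_Icc ?_ (by positivity) ?_ ?_
  · rw [IsSelfAdjoint, star_sub, star_smul, star_smul, star_add, hs.star_eq, hwxw.star_eq, star_one,
      star_trivial, star_trivial]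
  · calc _ ≤ (2⁻¹ : ℝ) • N • 1 - (-(N / 4)) • (1 : H →L[ℂ] H) := sub_le_sub_right d1 _
      _ = _ := by module
  · calc _ = (2⁻¹ : ℝ) • -((2 * N) • 1) - (-(N / 4)) • (1 : H →L[ℂ] H) := by module
      _ ≤ _ := sub_le_sub_right d2 _

/-- One step of Dixmier averaging. -/
theorem exists_average_norm_le (hM : IsTracialFactor M R Ω) {x : H →L[ℂ] H} (hx : x ∈ M)
    (hs : IsSelfAdjoint x) :
    ∃ w ∈ M, star w * w = 1 ∧ w * star w = 1 ∧ ∃ c : ℝ,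
      ‖(2⁻¹ : ℝ) • (x + w * x * star w) - c • 1‖ ≤ 3 / 4 * ‖x‖ := by
  have hspec : ∀ t ∈ spectrum ℝ x, |t| ≤ ‖x‖ := fun t ht => by
    have h1 := hs.le_algebraMap_norm_self
    have h2 := hs.neg_algebraMap_norm_le_self
    rw [← map_neg] at h2
    exact abs_le.2 ⟨(algebraMap_le_iff_le_spectrum (R := ℝ)).1 h2 t ht,
      (le_algebraMap_iff_spectrum_le (R := ℝ)).1 h1 t ht⟩
  obtain ⟨e, heM, he, h1, h2, h3, h4⟩ := hM.exists_support hx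
  set p := cfc (fun t : ℝ => max t 0) x with hp
  set n := cfc (fun t : ℝ => max (-t) 0) x with hn
  have hxpn : x = p - n := by
    rw [hp, hn, cfc_sub_cfc x (by fun_prop) (by fun_prop)]
    conv_lhs => rw [← cfc_id' ℝ x]
    refine cfc_congr fun t _ => ?_
    rcases le_total t 0 with h | h <;> simp [h]
  have hes : IsSelfAdjoint e := he.isSelfAdjoint
  have hee : e * e = e := he.isIdempotentElem
  have hp1 : p ≤ ‖x‖ • 1 := by
    rw [← Algebra.algebraMap_eq_smul_one]
    exact cfc_le_algebraMap _ _ _ fun t ht =>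
      max_le ((le_abs_self t).trans (hspec t ht)) (norm_nonneg _)
  have hn1 : n ≤ ‖x‖ • 1 := by
    rw [← Algebra.algebraMap_eq_smul_one]
    exact cfc_le_algebraMap _ _ _ fun t ht =>
      max_le ((neg_le_abs t).trans (hspec t ht)) (norm_nonneg _)
  have hp0 : 0 ≤ p := cfc_nonneg fun t _ => le_max_right _ _
  have hn0 : 0 ≤ n := cfc_nonneg fun t _ => le_max_right _ _
  have hpe : p ≤ ‖x‖ • e := by
    have := hes.conjugate_le_conjugate hp1
    rwa [h1, h2, mul_smul_comm, smul_mul_assoc, mul_one, hee] at this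
  have hne : n ≤ ‖x‖ • (1 - e) := by
    have := he.one_sub.isSelfAdjoint.conjugate_le_conjugate hn1
    rwa [sub_mul, one_mul, h3, sub_zero, mul_sub, mul_one, h4, sub_zero, mul_smul_comm,
      smul_mul_assoc, mul_one, he.one_sub.isIdempotentElem.eq] at this
  have hxe : x ≤ ‖x‖ • e := by
    rw [hxpn] at *
    exact (sub_le_self _ hn0).trans hpe
  have hxe' : -x ≤ ‖x‖ • (1 - e) := by
    refine le_trans ?_ hne
    nth_rw 1 [hxpn]
    rw [neg_sub]; exact sub_le_self _ hp0
  have hx1 : -(‖x‖ • 1) ≤ x := by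
    have := hs.neg_algebraMap_norm_le_self
    rwa [Algebra.algebraMap_eq_smul_one] at this
  have hx2 : -(‖x‖ • 1) ≤ -x := by
    have := hs.le_algebraMap_norm_self
    rw [Algebra.algebraMap_eq_smul_one] at this
    exact neg_le_neg this
  obtain ⟨v, hv, -, hv1 | hv1⟩ := hM.exists_maximal_extension heM
    (sub_mem (one_mem M) heM) he he.one_sub (v₀ := 0) ⟨zero_mem _, by simp, by simp, by simp⟩
  · obtain ⟨w, hw, hw1, hw2, h⟩ := exists_average hs (norm_nonneg x) hxe hx1 heM he hv hv1
    exact ⟨w, hw, hw1, hw2, _, h⟩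
  · have hv' : IsPartialIsometryBelow M (1 - e) (1 - (1 - e)) (star v) := by
      refine ⟨star_mem hv.mem, ?_, ?_, ?_⟩
      · simpa [mul_assoc] using congrArg star hv.pi
      · rw [sub_sub_cancel]
        simpa [hes.star_eq] using congrArg star hv.right
      · simpa [hes.star_eq] using congrArg star hv.left
    obtain ⟨w, hw, hw1, hw2, h⟩ := exists_average hs.neg (norm_nonneg x) hxe' hx2
      (sub_mem (one_mem M) heM) he.one_sub hv' (by simpa using hv1)
    refine ⟨w, hw, hw1, hw2, ‖x‖ / 4, ?_⟩
    rw [← norm_neg]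
    have h' : -((2⁻¹ : ℝ) • (x + w * x * star w) - (‖x‖ / 4) • 1) =
        (2⁻¹ : ℝ) • (-x + w * -x * star w) - (-(‖x‖ / 4)) • 1 := by
      rw [mul_neg, neg_mul]
      module
    rw [h']
    exact h

end IsTracialFactor
end TracialFactor

theorem Set.Countable.exists_closed_image2 {α : Type*} {𝓕 : Set (α → α → α)} (h𝓕 : 𝓕.Countable)
    {M D₀ : Set α} (hM : ∀ f ∈ 𝓕, ∀ x ∈ M, ∀ y ∈ M, f x y ∈ M) (hD₀ : D₀.Countable)
    (hDM : D₀ ⊆ M) :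
    ∃ D : Set α, D₀ ⊆ D ∧ D ⊆ M ∧ D.Countable ∧ ∀ f ∈ 𝓕, ∀ x ∈ D, ∀ y ∈ D, f x y ∈ D := by
  let step : Set α → Set α := fun S => S ∪ ⋃ f ∈ 𝓕, Set.image2 f S S
  have hstep : ∀ k, step^[k] D₀ ⊆ step^[k + 1] D₀ := fun k => by
    rw [Function.iterate_succ_apply']; exact Set.subset_union_left
  have hmono : Monotone fun k => step^[k] D₀ := monotone_nat_of_le_succ hstep
  refine ⟨⋃ k, step^[k] D₀, Set.subset_iUnion (fun k => step^[k] D₀) 0, Set.iUnion_subset ?_,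
    Set.countable_iUnion ?_, ?_⟩
  · intro k
    induction k with
    | zero => exact hDM
    | succ k ih =>
      rw [Function.iterate_succ_apply']
      refine Set.union_subset ih (Set.iUnion₂_subset fun f hf => ?_)
      rintro _ ⟨x, hx, y, hy, rfl⟩
      exact hM f hf x (ih hx) y (ih hy)
  · intro k
    induction k with
    | zero => exact hD₀
    | succ k ih =>
      rw [Function.iterate_succ_apply']
      exact ih.union (h𝓕.biUnion fun f _ => ih.image2 ih f)
  · intro f hf x hx y hy
    obtain ⟨i, hi⟩ := Set.mem_iUnion.1 hx
    obtain ⟨j, hj⟩ := Set.mem_iUnion.1 hy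
    refine Set.mem_iUnion.2 ⟨max i j + 1, ?_⟩
    rw [Function.iterate_succ_apply']
    exact Or.inr (Set.mem_iUnion₂.2 ⟨f, hf, x, hmono (le_max_left i j) hi, y,
      hmono (le_max_right i j) hj, rfl⟩)

section TracialFactor

variable {H : Type*} [NormedAddCommGroup H] [InnerProductSpace ℂ H] [CompleteSpace H]

/-- A separable C⋆-subalgebra with the approximation and averaging properties of a factor. -/
structure IsElementarySubalgebra (A : StarSubalgebra ℂ (H →L[ℂ] H)) : Prop where
  isClosed : IsClosed (A : Set (H →L[ℂ] H))
  isSeparable : TopologicalSpace.IsSeparable (A : Set (H →L[ℂ] H))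
  exists_isUnit : ∀ x ∈ A, ∀ ε > 0, ∃ y ∈ A, IsUnit y ∧ ‖x - y‖ < ε
  exists_isUnit_selfAdjoint : ∀ x ∈ A, IsSelfAdjoint x → ∀ ε > 0,
    ∃ y ∈ A, IsSelfAdjoint y ∧ IsUnit y ∧ ‖x - y‖ < ε
  exists_average : ∀ x ∈ A, IsSelfAdjoint x → ∃ w ∈ A, star w * w = 1 ∧ w * star w = 1 ∧
    ∃ c : ℝ, ‖(2⁻¹ : ℝ) • (x + w * x * star w) - c • 1‖ ≤ 7 / 8 * ‖x‖

namespace IsTracialFactor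

variable {M : StarSubalgebra ℂ (H →L[ℂ] H)} {R : Set (H →L[ℂ] H)} {Ω : H}

theorem exists_isElementarySubalgebra (hM : IsTracialFactor M R Ω) {D₀ : Set (H →L[ℂ] H)}
    (hc : D₀.Countable) (hD₀ : D₀ ⊆ M) :
    ∃ A : StarSubalgebra ℂ (H →L[ℂ] H), D₀ ⊆ A ∧ A ≤ M ∧ IsElementarySubalgebra A := by
  have e1 : ∀ (n : ℕ) (x : H →L[ℂ] H), ∃ y, x ∈ M → y ∈ M ∧ IsUnit y ∧ ‖x - y‖ ≤ 1 / (n + 1) := by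
    intro n x
    by_cases hx : x ∈ M
    · obtain ⟨y, hy⟩ := hM.exists_isUnit hx (ε := 1 / (n + 1)) (by positivity)
      exact ⟨y, fun _ => hy⟩
    · exact ⟨0, fun h => absurd h hx⟩
  have e2 : ∀ (n : ℕ) (x : H →L[ℂ] H), ∃ y ∈ M, x ∈ M → IsSelfAdjoint x →
      IsSelfAdjoint y ∧ IsUnit y ∧ ‖x - y‖ ≤ 1 / (n + 1) := by
    intro n x
    by_cases hx : x ∈ M ∧ IsSelfAdjoint x
    · obtain ⟨y, hyM, hy⟩ := hM.exists_isUnit_selfAdjoint hx.1 hx.2 (ε := 1 / (n + 1))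
        (by positivity)
      exact ⟨y, hyM, fun _ _ => hy⟩
    · exact ⟨0, zero_mem _, fun h h' => absurd ⟨h, h'⟩ hx⟩
  have e3 : ∀ x : H →L[ℂ] H, ∃ w ∈ M, x ∈ M → IsSelfAdjoint x → star w * w = 1 ∧ w * star w = 1 ∧
      ∃ c : ℝ, ‖(2⁻¹ : ℝ) • (x + w * x * star w) - c • 1‖ ≤ 3 / 4 * ‖x‖ := by
    intro x
    by_cases hx : x ∈ M ∧ IsSelfAdjoint x
    · obtain ⟨y, hyM, hy⟩ := hM.exists_average_norm_le hx.1 hx.2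
      exact ⟨y, hyM, fun _ _ => hy⟩
    · exact ⟨0, zero_mem _, fun h h' => absurd ⟨h, h'⟩ hx⟩
  choose f hf using e1
  choose g hgM hg using e2
  choose w hwM hw using e3
  obtain ⟨Q, hQc, hQd⟩ := TopologicalSpace.exists_countable_dense ℂ
  have hreal : ∀ (r : ℝ), ∀ x ∈ M, r • x ∈ M := fun r x hx => by
    rw [← Complex.coe_smul]; exact M.smul_mem hx _
  let 𝓕 : Set ((H →L[ℂ] H) → (H →L[ℂ] H) → (H →L[ℂ] H)) :=
    {(· + ·), (· * ·), fun x _ => star x, fun x _ => (2⁻¹ : ℝ) • (x + star x), fun x _ => w x} ∪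
      ((fun n x _ => f n x) '' Set.univ ∪ (fun n x _ => g n x) '' Set.univ)
  have h𝓕 : 𝓕.Countable := by
    refine Set.Countable.union (Set.toFinite _).countable (Set.Countable.union ?_ ?_)
    · exact Set.countable_univ.image _
    · exact Set.countable_univ.image _
  obtain ⟨D, hDD, hDM, hDc, hD⟩ := h𝓕.exists_closed_image2 (M := (M : Set (H →L[ℂ] H)))
    (D₀ := D₀ ∪ (fun q : ℂ => algebraMap ℂ (H →L[ℂ] H) q) '' Q) (by
      rintro _ ((rfl | rfl | rfl | rfl | rfl) | ⟨n, -, rfl⟩ | ⟨n, -, rfl⟩) x hx y hy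
      · exact add_mem hx hy
      · exact mul_mem hx hy
      · exact star_mem hx
      · exact hreal _ _ (add_mem hx (star_mem hx))
      · exact hwM x
      · exact (hf n x hx).1
      · exact hgM n x) (hc.union (hQc.image _))
      (Set.union_subset hD₀ (by rintro _ ⟨q, -, rfl⟩; exact M.algebraMap_mem q))
  have dadd : ∀ x ∈ D, ∀ y ∈ D, x + y ∈ D := hD _ (by simp [𝓕])
  have dmul : ∀ x ∈ D, ∀ y ∈ D, x * y ∈ D := hD _ (by simp [𝓕])
  have dstar : ∀ x ∈ D, star x ∈ D := fun x hx => hD (fun x _ => star x) (by simp [𝓕]) x hx x hx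
  have dhalf : ∀ x ∈ D, (2⁻¹ : ℝ) • (x + star x) ∈ D := fun x hx =>
    hD (fun x _ => (2⁻¹ : ℝ) • (x + star x)) (by simp [𝓕]) x hx x hx
  have dw : ∀ x ∈ D, w x ∈ D := fun x hx => hD (fun x _ => w x) (by simp [𝓕]) x hx x hx
  have df : ∀ n, ∀ x ∈ D, f n x ∈ D := fun n x hx =>
    hD (fun x _ => f n x) (Or.inr (Or.inl ⟨n, trivial, rfl⟩)) x hx x hx
  have dg : ∀ n, ∀ x ∈ D, g n x ∈ D := fun n x hx =>
    hD (fun x _ => g n x) (Or.inr (Or.inr ⟨n, trivial, rfl⟩)) x hx x hx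
  have dalg : ∀ c : ℂ, algebraMap ℂ (H →L[ℂ] H) c ∈ closure D := fun c =>
    closure_mono (Set.subset_union_right.trans hDD)
      (mem_closure_image (continuous_algebraMap ℂ (H →L[ℂ] H)).continuousAt (hQd c))
  let A : StarSubalgebra ℂ (H →L[ℂ] H) :=
    { carrier := closure D
      mul_mem' := fun hx hy => map_mem_closure₂ continuous_mul hx hy dmul
      add_mem' := fun hx hy => map_mem_closure₂ continuous_add hx hy dadd
      algebraMap_mem' := dalg
      star_mem' := fun hx => map_mem_closure continuous_star hx dstar }
  have hMc : IsClosed (M : Set (H →L[ℂ] H)) := by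
    have : (M : Set (H →L[ℂ] H)) = ⋂ r ∈ R, {x | x * r = r * x} := by
      ext x; simp only [SetLike.mem_coe, hM.mem_iff, Set.mem_iInter]; rfl
    rw [this]
    exact isClosed_biInter fun r _ => isClosed_eq (by fun_prop) (by fun_prop)
  have happ : ∀ x ∈ A, ∀ ε > 0, ∃ d ∈ D, ‖x - d‖ < ε := fun x hx ε hε => by
    obtain ⟨d, hd, h⟩ := Metric.mem_closure_iff.1 hx ε hε
    exact ⟨d, hd, by rwa [← dist_eq_norm]⟩
  have happs : ∀ x ∈ A, IsSelfAdjoint x → ∀ ε > 0, ∃ d ∈ D, IsSelfAdjoint d ∧ ‖x - d‖ < ε := by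
    intro x hx hs ε hε
    obtain ⟨d, hd, h⟩ := happ x hx ε hε
    refine ⟨_, dhalf d hd, ?_, ?_⟩
    · rw [IsSelfAdjoint, star_smul, star_add, star_star, add_comm, star_trivial]
    · have h2 : ‖x - star d‖ < ε := by
        have : x - star d = star (x - d) := by rw [star_sub, hs.star_eq]
        rwa [this, _root_.norm_star]
      have h3 : x - (2⁻¹ : ℝ) • (d + star d) = (2⁻¹ : ℝ) • ((x - d) + (x - star d)) := by module
      rw [h3, norm_smul]
      have := norm_add_le (x - d) (x - star d)
      rw [Real.norm_of_nonneg (by norm_num)]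
      linarith
  have hDA : D ⊆ A := subset_closure
  refine ⟨A, (Set.subset_union_left.trans hDD).trans hDA, closure_minimal hDM hMc,
    isClosed_closure, hDc.isSeparable.closure, ?_, ?_, ?_⟩
  · intro x hx ε hε
    obtain ⟨d, hd, h⟩ := happ x hx (ε / 2) (half_pos hε)
    obtain ⟨n, hn⟩ := exists_nat_one_div_lt (half_pos hε)
    refine ⟨f n d, hDA (df n d hd), (hf n d (hDM hd)).2.1, ?_⟩
    have := norm_sub_le_norm_sub_add_norm_sub x d (f n d)
    linarith [(hf n d (hDM hd)).2.2]
  · intro x hx hs ε hε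
    obtain ⟨d, hd, hds, h⟩ := happs x hx hs (ε / 2) (half_pos hε)
    obtain ⟨n, hn⟩ := exists_nat_one_div_lt (half_pos hε)
    obtain ⟨h1, h2, h3⟩ := hg n d (hDM hd) hds
    refine ⟨g n d, hDA (dg n d hd), h1, h2, ?_⟩
    have := norm_sub_le_norm_sub_add_norm_sub x d (g n d)
    linarith
  · intro x hx hs
    rcases eq_or_ne x 0 with rfl | hx0
    · exact ⟨1, one_mem _, by simp, by simp, 0, by simp⟩
    obtain ⟨d, hd, hds, h⟩ := happs x hx hs (‖x‖ / 14) (by have := norm_pos_iff.2 hx0; positivity)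
    obtain ⟨h1, h2, c, h3⟩ := hw d (hDM hd) hds
    refine ⟨w d, hDA (dw d hd), h1, h2, c, ?_⟩
    have hU : w d ∈ unitary (H →L[ℂ] H) := ⟨h1, h2⟩
    have h4 : ‖w d * (x - d) * star (w d)‖ = ‖x - d‖ := by
      rw [CStarRing.norm_mul_mem_unitary _ (Unitary.star_mem hU), CStarRing.norm_mem_unitary_mul _ hU]
    have h5 : (2⁻¹ : ℝ) • (x + w d * x * star (w d)) - c • 1 =
        (2⁻¹ : ℝ) • ((x - d) + w d * (x - d) * star (w d)) +
          ((2⁻¹ : ℝ) • (d + w d * d * star (w d)) - c • 1) := by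
      rw [mul_sub, sub_mul]; module
    have h6 : ‖(2⁻¹ : ℝ) • ((x - d) + w d * (x - d) * star (w d))‖ ≤ ‖x - d‖ := by
      rw [norm_smul, Real.norm_of_nonneg (by norm_num)]
      linarith [norm_add_le (x - d) (w d * (x - d) * star (w d))]
    have h7 : ‖d‖ ≤ ‖x‖ + ‖x - d‖ := norm_le_insert x d
    rw [h5]
    refine (norm_add_le _ _).trans ?_
    linarith

end IsTracialFactor
end TracialFactor

section Averaging

variable {A : Type*} [CStarAlgebra A]

theorem exists_iterated_average (hav : ∀ x : A, IsSelfAdjoint x → ∃ w, star w * w = 1 ∧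
      w * star w = 1 ∧ ∃ c : ℝ, ‖(2⁻¹ : ℝ) • (x + w * x * star w) - c • 1‖ ≤ 7 / 8 * ‖x‖)
    {y : A} (hy : IsSelfAdjoint y) (k : ℕ) :
    ∃ z : A, IsSelfAdjoint z ∧ (∃ c : ℝ, ‖z - c • 1‖ ≤ (7 / 8) ^ k * ‖y‖) ∧
      (∀ I : TwoSidedIdeal A, y ∈ I → z ∈ I) ∧
      ∀ τ : A →L[ℂ] ℂ, (∀ a b, τ (a * b) = τ (b * a)) → τ z = τ y := by
  induction k with
  | zero => exact ⟨y, hy, ⟨0, by simp⟩, fun _ h => h, fun _ _ => rfl⟩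
  | succ k ih =>
    obtain ⟨z, hz, ⟨c, hc⟩, hI, hτ⟩ := ih
    have hx : IsSelfAdjoint (z - c • (1 : A)) := by
      rw [IsSelfAdjoint, star_sub, star_smul, hz.star_eq, star_one, star_trivial]
    obtain ⟨w, hw1, hw2, d, hd⟩ := hav _ hx
    refine ⟨(2⁻¹ : ℝ) • (z + w * z * star w), ?_, ⟨c + d, ?_⟩, fun I h => ?_, fun τ h => ?_⟩
    · simp [IsSelfAdjoint, hz.star_eq, mul_assoc]
    · have h : (2⁻¹ : ℝ) • (z + w * z * star w) - (c + d) • (1 : A) =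
          (2⁻¹ : ℝ) • (z - c • 1 + w * (z - c • 1) * star w) - d • 1 := by
        rw [mul_sub, sub_mul, mul_smul_comm, smul_mul_assoc, mul_one, hw2]; module
      rw [h, pow_succ]
      linarith
    · have hz' := I.add_mem (hI I h) (I.mul_mem_right _ (star w) (I.mul_mem_left w _ (hI I h)))
      have := I.mul_mem_left ((2⁻¹ : ℝ) • 1) _ hz'
      rwa [smul_mul_assoc, one_mul] at this
    · have h1 : τ (w * z * star w) = τ z := by rw [h, ← mul_assoc, hw1, one_mul]
      rw [← Complex.coe_smul, map_smul, map_add, h1, hτ τ h, smul_eq_mul]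
      push_cast; ring

theorem exists_norm_average_lt (hav : ∀ x : A, IsSelfAdjoint x → ∃ w, star w * w = 1 ∧
      w * star w = 1 ∧ ∃ c : ℝ, ‖(2⁻¹ : ℝ) • (x + w * x * star w) - c • 1‖ ≤ 7 / 8 * ‖x‖)
    {y : A} (hy : IsSelfAdjoint y) {ε : ℝ} (hε : 0 < ε) :
    ∃ z : A, (∃ c : ℝ, ‖z - c • 1‖ < ε) ∧
      (∀ I : TwoSidedIdeal A, y ∈ I → z ∈ I) ∧
      ∀ τ : A →L[ℂ] ℂ, (∀ a b, τ (a * b) = τ (b * a)) → τ z = τ y := by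
  have hl : Tendsto (fun k : ℕ => (7 / 8 : ℝ) ^ k * ‖y‖) atTop (𝓝 (0 * ‖y‖)) :=
    (tendsto_pow_atTop_nhds_zero_of_lt_one (by norm_num) (by norm_num)).mul_const _
  rw [zero_mul] at hl
  obtain ⟨k, hk⟩ := (hl.eventually (gt_mem_nhds hε)).exists
  obtain ⟨z, -, ⟨c, hc⟩, h⟩ := exists_iterated_average hav hy k
  exact ⟨z, ⟨c, hc.trans_lt hk⟩, h⟩

theorem norm_apply_sub_le (τ : A →L[ℂ] ℂ) (h1 : τ 1 = 1) (z : A) (c : ℝ) :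
    ‖τ z - c‖ ≤ ‖τ‖ * ‖z - c • 1‖ := by
  have : τ z - c = τ (z - c • 1) := by
    rw [map_sub, ← Complex.coe_smul, map_smul, h1, smul_eq_mul, mul_one]
  rw [this]; exact τ.le_opNorm _

theorem trace_unique (hav : ∀ x : A, IsSelfAdjoint x → ∃ w, star w * w = 1 ∧
      w * star w = 1 ∧ ∃ c : ℝ, ‖(2⁻¹ : ℝ) • (x + w * x * star w) - c • 1‖ ≤ 7 / 8 * ‖x‖)
    {τ σ : A →L[ℂ] ℂ} (h1 : τ 1 = 1) (hτ : ∀ a b, τ (a * b) = τ (b * a))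
    (h2 : σ 1 = 1) (hσ : ∀ a b, σ (a * b) = σ (b * a)) : τ = σ := by
  have key : ∀ y : A, IsSelfAdjoint y → τ y = σ y := by
    intro y hy
    rw [← sub_eq_zero, ← norm_eq_zero]
    refine le_antisymm (le_of_forall_pos_le_add fun ε hε => ?_) (norm_nonneg _)
    obtain ⟨z, ⟨c, hc⟩, -, h⟩ := exists_norm_average_lt hav hy
      (ε := ε / (‖τ‖ + ‖σ‖ + 1)) (by positivity)
    rw [← h τ hτ, ← h σ hσ, zero_add]
    have h3 : τ z - σ z = (τ z - c) - (σ z - c) := by ring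
    rw [h3]
    refine (norm_sub_le _ _).trans ((add_le_add (norm_apply_sub_le τ h1 z c)
      (norm_apply_sub_le σ h2 z c)).trans ?_)
    rw [← add_mul]
    rw [lt_div_iff₀ (by positivity)] at hc
    nlinarith [norm_nonneg (z - c • 1)]
  ext x
  rw [← realPart_add_I_smul_imaginaryPart x]
  simp only [map_add, map_smul]
  rw [key _ (realPart x).2, key _ (imaginaryPart x).2]

theorem twoSidedIdeal_eq_bot_or_top (hav : ∀ x : A, IsSelfAdjoint x → ∃ w, star w * w = 1 ∧
      w * star w = 1 ∧ ∃ c : ℝ, ‖(2⁻¹ : ℝ) • (x + w * x * star w) - c • 1‖ ≤ 7 / 8 * ‖x‖)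
    {τ : A →L[ℂ] ℂ} (h1 : τ 1 = 1) (hτ : ∀ a b, τ (a * b) = τ (b * a))
    (hf : ∀ x, τ (star x * x) = 0 → x = 0) (I : TwoSidedIdeal A) : I = ⊥ ∨ I = ⊤ := by
  by_cases hI : ∀ x ∈ I, x = 0
  · left
    rw [eq_bot_iff]
    intro x hx
    rw [hI x hx]; exact zero_mem _
  right
  push Not at hI
  obtain ⟨x, hx, hx0⟩ := hI
  have ht : τ (star x * x) ≠ 0 := fun h => hx0 (hf x h)
  set t := τ (star x * x) with htdef
  obtain ⟨z, ⟨c, hc⟩, hz, h⟩ := exists_norm_average_lt hav (IsSelfAdjoint.star_mul_self x)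
      (ε := ‖t‖ / (‖τ‖ + ‖(1 : A)‖ * ‖τ‖ + 1)) (by have := norm_pos_iff.2 ht; positivity)
  have h3 : ‖z - t • 1‖ < ‖t‖ := by
    have h4 : z - t • 1 = (z - c • 1) - ((t - c) • 1) := by
      rw [← Complex.coe_smul]; module
    have h5 := norm_apply_sub_le τ h1 z c
    rw [h τ hτ, ← htdef] at h5
    rw [lt_div_iff₀ (by positivity)] at hc
    calc ‖z - t • 1‖ ≤ ‖z - c • 1‖ + ‖t - c‖ * ‖(1 : A)‖ := by
          rw [h4, ← norm_smul]; exact norm_sub_le _ _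
      _ ≤ ‖z - c • 1‖ + ‖τ‖ * ‖z - c • 1‖ * ‖(1 : A)‖ := by gcongr
      _ < ‖t‖ := by nlinarith [norm_nonneg (z - c • 1), norm_nonneg τ, mul_nonneg (norm_nonneg τ) (norm_nonneg (z - c • 1))]
  have hu : IsUnit (1 - (1 - t⁻¹ • z)) := by
    refine isUnit_one_sub_of_norm_lt_one ?_
    have h4 : 1 - t⁻¹ • z = -(t⁻¹ • (z - t • 1)) := by
      rw [smul_sub, smul_smul, inv_mul_cancel₀ ht, one_smul, neg_sub]
    rw [h4, norm_neg, norm_smul, norm_inv, inv_mul_lt_iff₀ (norm_pos_iff.2 ht), mul_one]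
    exact h3
  rw [sub_sub_cancel] at hu
  obtain ⟨u, hu⟩ := hu
  have hmem : t⁻¹ • z ∈ I := by
    have := I.mul_mem_left (t⁻¹ • 1) _ (hz I (I.mul_mem_left _ _ hx))
    rwa [smul_mul_assoc, one_mul] at this
  rw [← TwoSidedIdeal.one_mem_iff]
  have := I.mul_mem_left (↑u⁻¹ : A) _ hmem
  rwa [← hu, u.inv_mul] at this

theorem matrix_mul_star_eq_one {τ : A →L[ℂ] ℂ} (hτ : ∀ a b, τ (a * b) = τ (b * a))
    (hpos : ∀ x, ∃ r : ℝ, 0 ≤ r ∧ τ (star x * x) = r)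
    (hf : ∀ x, τ (star x * x) = 0 → x = 0) {n : ℕ} {x : Matrix (Fin n) (Fin n) A}
    (hx : star x * x = 1) : x * star x = 1 := by
  set y := 1 - x * star x with hy
  have hxx : x * star x * (x * star x) = x * star x := by
    rw [mul_assoc, ← mul_assoc (star x), hx, one_mul]
  have hyy : star y * y = y := by
    rw [hy, star_sub, star_mul, star_star, star_one, mul_sub, mul_one, sub_mul, one_mul, hxx,
      sub_self, sub_zero]
  have h0 : ∑ i, τ (y i i) = 0 := by
    have e1 : ∀ i, τ (y i i) = τ 1 - ∑ j, τ (x i j * star (x i j)) := fun i => by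
      rw [hy, Matrix.sub_apply, Matrix.one_apply_eq, map_sub, Matrix.mul_apply, map_sum]
      rfl
    have e2 : ∀ j, ∑ i, τ (star (x i j) * x i j) = τ 1 := fun j => by
      rw [← map_sum, ← Matrix.one_apply_eq (n := Fin n) (α := A) j, ← hx, Matrix.mul_apply]
      rfl
    simp_rw [e1, Finset.sum_sub_distrib]
    rw [Finset.sum_comm, sub_eq_zero]
    refine Finset.sum_congr rfl fun j _ => ?_
    rw [← e2 j]
    exact Finset.sum_congr rfl fun i _ => hτ _ _
  choose r hr0 hr using hpos
  have h1 : ∑ i, ∑ j, r (y j i) = 0 := by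
    have : ∀ i, τ (y i i) = ((∑ j, r (y j i) : ℝ) : ℂ) := fun i => by
      nth_rw 1 [← hyy]
      rw [Matrix.mul_apply, map_sum, Complex.ofReal_sum]
      exact Finset.sum_congr rfl fun j _ => hr _
    simp_rw [this] at h0
    exact_mod_cast h0
  have hy0 : y = 0 := by
    ext i j
    have h2 := (Finset.sum_eq_zero_iff_of_nonneg
      fun i _ => Finset.sum_nonneg fun j _ => hr0 (y j i)).1 h1 j (Finset.mem_univ _)
    have h3 := (Finset.sum_eq_zero_iff_of_nonneg fun k _ => hr0 (y k j)).1 h2 i (Finset.mem_univ _)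
    refine hf _ ?_
    rw [hr, h3, Complex.ofReal_zero]
  exact (sub_eq_zero.1 hy0).symm

end Averaging

section TracialFactor

variable {H : Type*} [NormedAddCommGroup H] [InnerProductSpace ℂ H] [CompleteSpace H]

/-- The vector functional `x ↦ ⟪Ω, x Ω⟫` on a C⋆-subalgebra. -/
noncomputable def vectorFunctional (A : StarSubalgebra ℂ (H →L[ℂ] H)) (Ω : H) : A →L[ℂ] ℂ where
  toFun x := ⟪Ω, (x : H →L[ℂ] H) Ω⟫_ℂ
  map_add' x y := by simp
  map_smul' c x := by simp
  cont := by fun_prop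

namespace IsTracialFactor

variable {M A : StarSubalgebra ℂ (H →L[ℂ] H)} {R : Set (H →L[ℂ] H)} {Ω : H}

theorem vectorFunctional_star_mul_self (x : A) :
    vectorFunctional A Ω (star x * x) = ((‖(x : H →L[ℂ] H) Ω‖ ^ 2 : ℝ) : ℂ) := by
  have := inner_apply (x : H →L[ℂ] H) x Ω Ω
  rw [inner_self_eq_norm_sq_to_K] at this
  simpa [vectorFunctional] using this.symm

theorem vectorFunctional_mul_comm (hM : IsTracialFactor M R Ω) (hAM : A ≤ M) (x y : A) :
    vectorFunctional A Ω (x * y) = vectorFunctional A Ω (y * x) :=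
  hM.trace x (hAM x.2) y (hAM y.2)

theorem vectorFunctional_one (hM : IsTracialFactor M R Ω) : vectorFunctional A Ω 1 = 1 := by
  simp [vectorFunctional, hM.norm_vec]

theorem eq_zero_of_vectorFunctional (hM : IsTracialFactor M R Ω) (hAM : A ≤ M) (x : A)
    (h : vectorFunctional A Ω (star x * x) = 0) : x = 0 := by
  rw [vectorFunctional_star_mul_self] at h
  have : (x : H →L[ℂ] H) Ω = 0 := by
    rw [← norm_eq_zero]
    exact pow_eq_zero_iff two_ne_zero |>.1 (Complex.ofReal_eq_zero.1 h)
  exact Subtype.ext (hM.eq_zero (hAM x.2) this)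

theorem _root_.IsElementarySubalgebra.exists_average_coe (hA : IsElementarySubalgebra A) :
    ∀ x : A, IsSelfAdjoint x → ∃ w, star w * w = 1 ∧
      w * star w = 1 ∧ ∃ c : ℝ, ‖(2⁻¹ : ℝ) • (x + w * x * star w) - c • 1‖ ≤ 7 / 8 * ‖x‖ := by
  intro x hx
  obtain ⟨w, hw, h1, h2, c, h3⟩ := hA.exists_average x x.2 (congrArg Subtype.val hx)
  exact ⟨⟨w, hw⟩, Subtype.ext h1, Subtype.ext h2, c, h3⟩

theorem properties_of_isElementarySubalgebra (hM : IsTracialFactor M R Ω) (hAM : A ≤ M)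
    (hA : IsElementarySubalgebra A) [IsClosed (A : Set (H →L[ℂ] H))] :
    TopologicalSpace.SeparableSpace A ∧
      (∀ I : TwoSidedIdeal A, IsClosed (I : Set A) → I = ⊥ ∨ I = ⊤) ∧
      (∀ (n : ℕ), 0 < n → ∀ x : Matrix (Fin n) (Fin n) A,
        star x * x = 1 → x * star x = 1) ∧
      Dense {x : A | IsUnit x} ∧
      {x : A | IsSelfAdjoint x} ⊆ closure {x : A | IsSelfAdjoint x ∧ IsUnit x} ∧
      (∃! τ : A →L[ℂ] ℂ, IsTracialState τ) := by
  have htr := hM.vectorFunctional_mul_comm hAM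
  have hpos : ∀ x : A, ∃ r : ℝ, 0 ≤ r ∧ vectorFunctional A Ω (star x * x) = r :=
    fun x => ⟨_, by positivity, vectorFunctional_star_mul_self x⟩
  have hf := hM.eq_zero_of_vectorFunctional hAM
  have hav := hA.exists_average_coe
  refine ⟨hA.isSeparable.separableSpace,
    fun I _ => twoSidedIdeal_eq_bot_or_top hav hM.vectorFunctional_one htr hf I,
    fun n _ x => matrix_mul_star_eq_one htr hpos hf, ?_, ?_,
    vectorFunctional A Ω, ⟨hM.vectorFunctional_one, hpos, htr⟩,
    fun σ hσ => trace_unique hav hσ.1 hσ.2.2 hM.vectorFunctional_one htr⟩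
  · refine Metric.dense_iff.2 fun x ε hε => ?_
    obtain ⟨y, hy, hu, h⟩ := hA.exists_isUnit x x.2 ε hε
    refine ⟨⟨y, hy⟩, ?_, (StarSubalgebra.coe_isUnit A).1 hu⟩
    rw [Metric.mem_ball, dist_comm, dist_eq_norm]
    exact h
  · refine fun x hx => Metric.mem_closure_iff.2 fun ε hε => ?_
    obtain ⟨y, hy, hs, hu, h⟩ :=
      hA.exists_isUnit_selfAdjoint x x.2 (congrArg Subtype.val hx) ε hε
    refine ⟨⟨y, hy⟩, ⟨Subtype.ext hs, (StarSubalgebra.coe_isUnit A).1 hu⟩, ?_⟩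
    rw [dist_eq_norm]
    exact h

theorem norm_unop_apply (hM : IsTracialFactor M R Ω) (hAM : A ≤ M)
    (hA : IsElementarySubalgebra A) [IsClosed (A : Set (H →L[ℂ] H))] (Φ : A ≃⋆ₐ[ℂ] Aᵐᵒᵖ)
    (x : A) : ‖((Φ x).unop : H →L[ℂ] H) Ω‖ = ‖(x : H →L[ℂ] H) Ω‖ := by
  have htr := hM.vectorFunctional_mul_comm hAM
  let ψ : A →L[ℂ] A := LinearMap.mkContinuous
    { toFun := fun x => (Φ x).unop
      map_add' := fun x y => by simp
      map_smul' := fun c x => by simp } 1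
    fun x => by
      rw [one_mul]
      exact NonUnitalStarAlgHom.norm_apply_le Φ x
  have hψ : ∀ x, ψ x = (Φ x).unop := fun _ => rfl
  have h : (vectorFunctional A Ω).comp ψ = vectorFunctional A Ω := by
    refine trace_unique hA.exists_average_coe ?_ (fun a b => ?_) hM.vectorFunctional_one htr
    · simp [hψ, hM.vectorFunctional_one]
    · simp only [ContinuousLinearMap.comp_apply, hψ, map_mul, MulOpposite.unop_mul]
      exact htr _ _
  have h1 := DFunLike.congr_fun h (star x * x)
  rw [ContinuousLinearMap.comp_apply, hψ, map_mul, map_star, MulOpposite.unop_mul,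
    MulOpposite.unop_star, htr, vectorFunctional_star_mul_self, vectorFunctional_star_mul_self] at h1
  have h2 := Complex.ofReal_injective h1
  exact (pow_left_inj₀ (norm_nonneg _) (norm_nonneg _) two_ne_zero).1 h2

end IsTracialFactor
end TracialFactor

/-- The Hilbert space of square summable complex functions. -/
abbrev Ltwo (α : Type*) : Type _ := lp (fun _ : α => ℂ) 2

namespace Ltwo

variable {α : Type*}

theorem hasSum_norm_sq (η : Ltwo α) : HasSum (fun h => ‖η h‖ ^ 2) (‖η‖ ^ 2) := by
  have := lp.hasSum_norm (p := 2) (by norm_num) η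
  simpa using this

open scoped Classical in
/-- The canonical basis vector at `g`. -/
noncomputable def delta (g : α) : Ltwo α := lp.single 2 g 1

open scoped Classical in
theorem delta_apply (g h : α) : delta g h = if h = g then 1 else 0 := by
  rw [delta, lp.single_apply, Pi.single_apply]

theorem delta_apply_self (g : α) : delta g g = 1 := by simp [delta_apply]

theorem delta_apply_of_ne {g h : α} (hgh : h ≠ g) : delta g h = 0 := by simp [delta_apply, hgh]

theorem norm_delta (g : α) : ‖delta g‖ = 1 := by
  classical
  rw [delta, lp.norm_single (by norm_num), norm_one]

theorem inner_delta (g : α) (η : Ltwo α) : ⟪delta g, η⟫_ℂ = η g := by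
  classical
  rw [delta, lp.inner_single_left]; simp

theorem dense_span_delta : Dense (Submodule.span ℂ (Set.range (delta (α := α))) : Set (Ltwo α)) := by
  classical
  intro η
  refine mem_closure_of_tendsto (lp.hasSum_single (by norm_num) η) (Eventually.of_forall fun s => ?_)
  refine Submodule.sum_mem _ fun i _ => ?_
  have : lp.single 2 i (η i) = η i • delta (α := α) i := by
    ext h
    rw [lp.single_apply, lp.coeFn_smul, Pi.smul_apply, delta_apply, Pi.single_apply]
    split_ifs with hh <;> simp
  rw [this]
  exact Submodule.smul_mem _ _ (Submodule.subset_span ⟨i, rfl⟩)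

theorem summable_wperm (σ : Equiv.Perm α) {c : α → ℂ} (hc : ∀ h, ‖c h‖ ≤ 1) (η : Ltwo α) :
    Summable fun h => ‖c h * η (σ.symm h)‖ ^ 2 := by
  refine Summable.of_nonneg_of_le (fun _ => by positivity) (fun h => ?_)
    ((σ.symm.summable_iff (f := fun h => ‖η h‖ ^ 2)).2 (hasSum_norm_sq η).summable)
  rw [norm_mul, mul_pow]
  exact mul_le_of_le_one_left (by positivity) (pow_le_one₀ (norm_nonneg _) (hc h))

/-- The weighted permutation operator `(W η)(h) = c h * η (σ⁻¹ h)`. -/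
noncomputable def wperm (σ : Equiv.Perm α) (c : α → ℂ) (hc : ∀ h, ‖c h‖ ≤ 1) :
    Ltwo α →L[ℂ] Ltwo α :=
  LinearMap.mkContinuous
    { toFun := fun η => ⟨fun h => c h * η (σ.symm h),
        memℓp_gen (by simpa using summable_wperm σ hc η)⟩
      map_add' := fun η ξ => by ext h; exact mul_add _ _ _
      map_smul' := fun z η => by ext h; exact mul_left_comm _ _ _ } 1
    fun η => by
      rw [one_mul, ← pow_le_pow_iff_left₀ (norm_nonneg _) (norm_nonneg _) two_ne_zero]
      refine hasSum_le (fun h => ?_) (hasSum_norm_sq _)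
        ((σ.symm.hasSum_iff (f := fun h => ‖η h‖ ^ 2)).2 (hasSum_norm_sq η))
      rw [LinearMap.coe_mk, AddHom.coe_mk, norm_mul, mul_pow]
      exact mul_le_of_le_one_left (by positivity) (pow_le_one₀ (norm_nonneg _) (hc h))

@[simp]
theorem wperm_apply (σ : Equiv.Perm α) (c : α → ℂ) (hc : ∀ h, ‖c h‖ ≤ 1) (η : Ltwo α) (h : α) :
    wperm σ c hc η h = c h * η (σ.symm h) := rfl

theorem norm_wperm_apply_le (σ : Equiv.Perm α) {c : α → ℂ} (hc : ∀ h, ‖c h‖ ≤ 1) (η : Ltwo α) :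
    ‖wperm σ c hc η‖ ≤ ‖η‖ := by
  refine (ContinuousLinearMap.le_of_opNorm_le _ (LinearMap.mkContinuous_norm_le _ zero_le_one _)
    η).trans_eq (one_mul _)

theorem norm_wperm_apply (σ : Equiv.Perm α) {c : α → ℂ} (hc : ∀ h, ‖c h‖ = 1) (η : Ltwo α) :
    ‖wperm σ c (fun h => (hc h).le) η‖ = ‖η‖ := by
  rw [← pow_left_inj₀ (norm_nonneg _) (norm_nonneg _) two_ne_zero]
  refine (hasSum_norm_sq _).unique ?_
  simp only [wperm_apply, norm_mul, hc, one_mul]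
  exact (σ.symm.hasSum_iff (f := fun h => ‖η h‖ ^ 2)).2 (hasSum_norm_sq η)

theorem wperm_delta (σ : Equiv.Perm α) {c : α → ℂ} (hc : ∀ h, ‖c h‖ ≤ 1) (g : α) :
    wperm σ c hc (delta g) = c (σ g) • delta (σ g) := by
  ext h
  rw [wperm_apply, lp.coeFn_smul, Pi.smul_apply, smul_eq_mul]
  by_cases hh : h = σ g
  · rw [hh, Equiv.symm_apply_apply, delta_apply_self, delta_apply_self]
  · rw [delta_apply_of_ne hh, delta_apply_of_ne, mul_zero, mul_zero]
    rwa [ne_eq, Equiv.symm_apply_eq]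

theorem star_wperm_mul_self (σ : Equiv.Perm α) {c : α → ℂ} (hc : ∀ h, ‖c h‖ = 1) :
    star (wperm σ c fun h => (hc h).le) * wperm σ c (fun h => (hc h).le) = 1 :=
  (ContinuousLinearMap.norm_map_iff_adjoint_comp_self _).1 (norm_wperm_apply σ hc)

open scoped Classical in
/-- The projection onto the functions supported in `X`. -/
noncomputable def proj (X : Set α) : Ltwo α →L[ℂ] Ltwo α :=
  wperm (Equiv.refl α) (fun h => if h ∈ X then 1 else 0) fun h => by split_ifs <;> simp

theorem proj_apply_of_mem {X : Set α} {h : α} (hh : h ∈ X) (η : Ltwo α) : proj X η h = η h := by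
  simp [proj, hh]

theorem proj_apply_of_notMem {X : Set α} {h : α} (hh : h ∉ X) (η : Ltwo α) : proj X η h = 0 := by
  simp [proj, hh]

theorem norm_proj_le (X : Set α) (η : Ltwo α) : ‖proj X η‖ ≤ ‖η‖ := norm_wperm_apply_le _ _ _

theorem norm_proj_mono {X Y : Set α} (h : X ⊆ Y) (η : Ltwo α) : ‖proj X η‖ ≤ ‖proj Y η‖ := by
  have : proj X η = proj X (proj Y η) := by
    ext k
    by_cases hk : k ∈ X
    · rw [proj_apply_of_mem hk, proj_apply_of_mem hk, proj_apply_of_mem (h hk)]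
    · rw [proj_apply_of_notMem hk, proj_apply_of_notMem hk]
  rw [this]
  exact norm_proj_le _ _

theorem norm_proj_union_sq {X Y : Set α} (h : Disjoint X Y) (η : Ltwo α) :
    ‖proj (X ∪ Y) η‖ ^ 2 = ‖proj X η‖ ^ 2 + ‖proj Y η‖ ^ 2 := by
  refine (hasSum_norm_sq _).unique ?_
  have := (hasSum_norm_sq (proj X η)).add (hasSum_norm_sq (proj Y η))
  convert this using 2 with k
  by_cases hX : k ∈ X
  · have hY : k ∉ Y := fun hY => Set.disjoint_left.1 h hX hY
    rw [proj_apply_of_mem (Set.mem_union_left Y hX), proj_apply_of_mem hX, proj_apply_of_notMem hY]; simp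
  · by_cases hY : k ∈ Y
    · rw [proj_apply_of_mem (Set.mem_union_right X hY), proj_apply_of_mem hY, proj_apply_of_notMem hX]; simp
    · rw [proj_apply_of_notMem (by simp [hX, hY]), proj_apply_of_notMem hY,
        proj_apply_of_notMem hX]; simp

theorem proj_add_proj_compl (X : Set α) (η : Ltwo α) : proj X η + proj Xᶜ η = η := by
  ext k
  by_cases hX : k ∈ X
  · simp [proj_apply_of_mem hX, proj_apply_of_notMem (X := Xᶜ) (by simpa using hX)]
  · simp [proj_apply_of_notMem hX, proj_apply_of_mem (X := Xᶜ) hX]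

theorem norm_proj_image_wperm (σ : Equiv.Perm α) {c : α → ℂ} (hc : ∀ h, ‖c h‖ = 1) (X : Set α)
    (η : Ltwo α) : ‖proj (σ '' X) (wperm σ c (fun h => (hc h).le) η)‖ = ‖proj X η‖ := by
  rw [← norm_wperm_apply σ hc (proj X η)]
  congr 1
  ext k
  by_cases hk : k ∈ σ '' X
  · have hk' : σ.symm k ∈ X := by obtain ⟨j, hj, rfl⟩ := hk; simpa
    rw [proj_apply_of_mem hk, wperm_apply, wperm_apply, proj_apply_of_mem hk']
  · have hk' : σ.symm k ∉ X := fun h => hk ⟨_, h, by simp⟩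
    rw [proj_apply_of_notMem hk, wperm_apply, proj_apply_of_notMem hk', mul_zero]

end Ltwo

/-- The standard additive character of `ZMod N` with values in `ℂ`. -/
noncomputable def rootChar {N : ℕ} [NeZero N] (x : ZMod N) : ℂ := ZMod.toCircle x

section rootChar

variable {N : ℕ} [NeZero N]

theorem rootChar_add (x y : ZMod N) : rootChar (x + y) = rootChar x * rootChar y := by
  simp [rootChar, AddChar.map_add_eq_mul]

@[simp]
theorem rootChar_zero : rootChar (0 : ZMod N) = 1 := by simp [rootChar]

@[simp]
theorem norm_rootChar (x : ZMod N) : ‖rootChar x‖ = 1 := Circle.norm_coe _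

theorem rootChar_injective : Function.Injective (rootChar (N := N)) := fun _ _ h =>
  ZMod.injective_toCircle (Subtype.ext h)

theorem rootChar_ne_zero (x : ZMod N) : rootChar x ≠ 0 := by
  rw [← norm_ne_zero_iff, norm_rootChar]; exact one_ne_zero

theorem rootChar_neg (x : ZMod N) : rootChar (-x) = star (rootChar x) := by
  have h := rootChar_add (-x) x
  rw [neg_add_cancel, rootChar_zero] at h
  have h2 : star (rootChar x) * rootChar x = 1 := by
    have := Complex.conj_mul' (rootChar x)
    simpa using this
  exact mul_right_cancel₀ (rootChar_ne_zero x) (h.symm.trans h2.symm)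

end rootChar

/-- A bimultiplicative form on a group with values in `ZMod N`. -/
structure Bichar (G : Type*) [Group G] (N : ℕ) where
  /-- the underlying function -/
  toFun : G → G → ZMod N
  map_mul_left : ∀ g g' h, toFun (g * g') h = toFun g h + toFun g' h
  map_mul_right : ∀ g h h', toFun g (h * h') = toFun g h + toFun g h'

namespace Bichar

open Ltwo

variable {G : Type*} [Group G] {N : ℕ}

instance : CoeFun (Bichar G N) fun _ => G → G → ZMod N := ⟨toFun⟩

variable (b : Bichar G N)

@[simp]
theorem one_left (h : G) : b 1 h = 0 := by
  have := b.map_mul_left 1 1 h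
  rwa [mul_one, left_eq_add] at this

@[simp]
theorem one_right (h : G) : b h 1 = 0 := by
  have := b.map_mul_right h 1 1
  rwa [mul_one, left_eq_add] at this

@[simp]
theorem inv_left (g h : G) : b g⁻¹ h = -b g h := by
  rw [eq_neg_iff_add_eq_zero, ← b.map_mul_left, inv_mul_cancel, one_left]

@[simp]
theorem inv_right (g h : G) : b g h⁻¹ = -b g h := by
  rw [eq_neg_iff_add_eq_zero, ← b.map_mul_right, inv_mul_cancel, one_right]

/-- The commutator form `c(g, h) = b(g, h) - b(h, g)`. -/
def comm (g h : G) : ZMod N := b g h - b h g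

theorem comm_swap (g h : G) : b.comm g h = -b.comm h g := by simp [comm]

variable [NeZero N]

/-- The left twisted regular representation. -/
noncomputable def lam (g : G) : Ltwo G →L[ℂ] Ltwo G :=
  wperm (Equiv.mulLeft g) (fun h => rootChar (b g h - b g g)) fun _ => (norm_rootChar _).le

/-- The right twisted regular representation. -/
noncomputable def rho (g : G) : Ltwo G →L[ℂ] Ltwo G :=
  wperm (Equiv.mulRight g) (fun h => rootChar (b h g - b g g)) fun _ => (norm_rootChar _).le

/-- The twisted conjugation representation. -/
noncomputable def conjRep (g : G) : Ltwo G →L[ℂ] Ltwo G :=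
  wperm (MulAut.conj g).toEquiv (fun h => rootChar (b.comm g h)) fun _ => (norm_rootChar _).le

theorem lam_apply (g h : G) (η : Ltwo G) :
    b.lam g η h = rootChar (b g h - b g g) * η (g⁻¹ * h) := rfl

theorem rho_apply (g h : G) (η : Ltwo G) :
    b.rho g η h = rootChar (b h g - b g g) * η (h * g⁻¹) := rfl

theorem conjRep_apply (g h : G) (η : Ltwo G) :
    b.conjRep g η h = rootChar (b.comm g h) * η (g⁻¹ * h * g) := rfl

theorem norm_conjRep_apply (g : G) (η : Ltwo G) : ‖b.conjRep g η‖ = ‖η‖ :=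
  norm_wperm_apply _ (fun _ => norm_rootChar _) _

theorem lam_delta (g h : G) : b.lam g (delta h) = rootChar (b g h) • delta (g * h) := by
  rw [lam, wperm_delta]
  congr 2
  rw [Equiv.coe_mulLeft, b.map_mul_right]; ring

theorem rho_delta (g h : G) : b.rho g (delta h) = rootChar (b h g) • delta (h * g) := by
  rw [rho, wperm_delta]
  congr 2
  rw [Equiv.coe_mulRight, b.map_mul_left]; ring

theorem lam_mul_lam (g h : G) : b.lam g * b.lam h = rootChar (b g h) • b.lam (g * h) := by
  ext η k
  rw [mul_apply_eq_comp, lam_apply, lam_apply, _root_.smul_apply, lp.coeFn_smul,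
    Pi.smul_apply, lam_apply, smul_eq_mul, ← mul_assoc, ← mul_assoc, ← mul_assoc,
    ← rootChar_add, ← rootChar_add, mul_inv_rev]
  congr 2
  simp only [b.map_mul_left, b.map_mul_right, inv_right]; ring

@[simp]
theorem lam_one : b.lam 1 = 1 := by
  ext η k
  simp [lam_apply]

theorem lam_commute_rho (g h : G) : Commute (b.lam g) (b.rho h) := by
  ext η k
  rw [mul_apply_eq_comp, mul_apply_eq_comp, lam_apply, rho_apply, rho_apply, lam_apply,
    ← mul_assoc, ← mul_assoc, ← rootChar_add, ← rootChar_add, ← mul_assoc]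
  congr 2
  simp only [b.map_mul_left, b.map_mul_right, inv_right, inv_left]; ring

theorem star_lam_mul_self (g : G) : star (b.lam g) * b.lam g = 1 :=
  star_wperm_mul_self _ fun _ => norm_rootChar _

theorem star_rho_mul_self (g : G) : star (b.rho g) * b.rho g = 1 :=
  star_wperm_mul_self _ fun _ => norm_rootChar _

theorem star_lam (g : G) : star (b.lam g) = rootChar (b g g) • b.lam g⁻¹ := by
  have h : b.lam g * (rootChar (b g g) • b.lam g⁻¹) = 1 := by
    rw [mul_smul_comm, lam_mul_lam, smul_smul, ← rootChar_add, inv_right, add_neg_cancel,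
      mul_inv_cancel, rootChar_zero, one_smul, lam_one]
  rw [← mul_one (star (b.lam g)), ← h, ← mul_assoc, star_lam_mul_self, one_mul]

theorem lam_mul_star_self (g : G) : b.lam g * star (b.lam g) = 1 := by
  rw [star_lam, mul_smul_comm, lam_mul_lam, smul_smul, ← rootChar_add, inv_right, add_neg_cancel,
      mul_inv_cancel, rootChar_zero, one_smul, lam_one]

theorem rho_mul_rho_inv (g : G) : b.rho g * (rootChar (b g g) • b.rho g⁻¹) = 1 := by
  ext η k
  rw [mul_apply_eq_comp, rho_apply, _root_.smul_apply, lp.coeFn_smul, Pi.smul_apply,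
    rho_apply, smul_eq_mul, ← mul_assoc, ← mul_assoc, ← rootChar_add, ← rootChar_add]
  simp only [b.map_mul_left, inv_right, inv_left, inv_inv, inv_mul_cancel_right]
  ring_nf; simp

theorem star_rho (g : G) : star (b.rho g) = rootChar (b g g) • b.rho g⁻¹ := by
  rw [← mul_one (star (b.rho g)), ← b.rho_mul_rho_inv g, ← mul_assoc, star_rho_mul_self, one_mul]

theorem rho_mul_star_self (g : G) : b.rho g * star (b.rho g) = 1 := by
  rw [star_rho, rho_mul_rho_inv]

theorem rho_delta_one (g : G) : b.rho g (delta 1) = delta g := by simp [rho_delta]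

theorem lam_delta_one (g : G) : b.lam g (delta 1) = delta g := by simp [lam_delta]

/-- The twisted group von Neumann algebra, as the commutant of the right representation. -/
noncomputable def vonNeumann : StarSubalgebra ℂ (Ltwo G →L[ℂ] Ltwo G) :=
  StarSubalgebra.centralizer ℂ (Set.range b.rho)

theorem mem_vonNeumann_iff (x : Ltwo G →L[ℂ] Ltwo G) :
    x ∈ b.vonNeumann ↔ ∀ r ∈ Set.range b.rho, Commute x r := by
  rw [vonNeumann, StarSubalgebra.mem_centralizer_iff]
  refine ⟨fun h r hr => (h r hr).1.symm, fun h r hr => ⟨(h r hr).symm, ?_⟩⟩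
  obtain ⟨g, rfl⟩ := hr
  have h1 := (h _ ⟨g, rfl⟩).eq
  calc star (b.rho g) * x = star (b.rho g) * x * (b.rho g * star (b.rho g)) := by
        rw [rho_mul_star_self, mul_one]
    _ = star (b.rho g) * (x * b.rho g) * star (b.rho g) := by noncomm_ring
    _ = star (b.rho g) * b.rho g * x * star (b.rho g) := by rw [h1]; noncomm_ring
    _ = x * star (b.rho g) := by rw [star_rho_mul_self, one_mul]

theorem rho_apply_comm {x : Ltwo G →L[ℂ] Ltwo G} (hx : x ∈ b.vonNeumann) (g : G) (η : Ltwo G) :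
    x (b.rho g η) = b.rho g (x η) :=
  congrArg (fun T : Ltwo G →L[ℂ] Ltwo G => T η) ((b.mem_vonNeumann_iff x).1 hx _ ⟨g, rfl⟩).eq

theorem apply_delta {x : Ltwo G →L[ℂ] Ltwo G} (hx : x ∈ b.vonNeumann) (g : G) :
    x (delta g) = b.rho g (x (delta 1)) := by
  rw [← b.rho_delta_one g, b.rho_apply_comm hx]

theorem lam_mem (g : G) : b.lam g ∈ b.vonNeumann := by
  rw [mem_vonNeumann_iff]
  rintro _ ⟨h, rfl⟩
  exact b.lam_commute_rho g h

theorem conj_lam_apply {x : Ltwo G →L[ℂ] Ltwo G} (hx : x ∈ b.vonNeumann) (g : G) :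
    (b.lam g * x * star (b.lam g)) (delta 1) = b.conjRep g (x (delta 1)) := by
  rw [mul_apply_eq_comp, mul_apply_eq_comp, star_lam, _root_.smul_apply, map_smul,
    map_smul, lam_delta_one, b.apply_delta hx]
  ext h
  rw [lp.coeFn_smul, Pi.smul_apply, lam_apply, rho_apply, conjRep_apply, smul_eq_mul, ← mul_assoc,
    ← mul_assoc, ← rootChar_add, ← rootChar_add, inv_inv]
  congr 2
  simp only [b.map_mul_left, inv_right, inv_left, comm]; ring

theorem star_apply_one {x : Ltwo G →L[ℂ] Ltwo G} (hx : x ∈ b.vonNeumann) (g : G) :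
    star x (delta 1) g = rootChar (b g g) * star (x (delta 1) g⁻¹) := by
  rw [← inner_delta, ContinuousLinearMap.star_eq_adjoint, ContinuousLinearMap.adjoint_inner_right,
    b.apply_delta hx, ← inner_conj_symm, inner_delta, rho_apply, one_mul, map_mul, one_left,
    zero_sub, rootChar_neg]
  simp

theorem inner_one_mul {x y : Ltwo G →L[ℂ] Ltwo G} (hx : x ∈ b.vonNeumann) :
    ⟪delta 1, x (y (delta 1))⟫_ℂ =
      ∑' g, rootChar (-b g g) * (x (delta 1) g⁻¹ * y (delta 1) g) := by
  rw [← ContinuousLinearMap.adjoint_inner_left, lp.inner_eq_tsum]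
  refine tsum_congr fun g => ?_
  rw [← ContinuousLinearMap.star_eq_adjoint, b.star_apply_one hx, rootChar_neg]
  simp only [RCLike.inner_apply, map_mul, starRingEnd_apply, star_star]
  ring

/-- The twisted group von Neumann algebra is a tracial factor as soon as its center is trivial. -/
theorem isTracialFactor (hc : ∀ x ∈ b.vonNeumann, (∀ g, b.conjRep g (x (delta 1)) = x (delta 1)) →
      ∃ c : ℂ, x (delta 1) = c • delta 1) :
    IsTracialFactor b.vonNeumann (Set.range b.rho) (delta 1) where
  mem_iff := b.mem_vonNeumann_iff
  cyclic := by
    have : (fun r : Ltwo G →L[ℂ] Ltwo G => r (delta 1)) '' Set.range b.rho = Set.range delta := by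
      rw [← Set.range_comp]
      exact congrArg Set.range (funext fun g => b.rho_delta_one g)
    rw [this]
    exact dense_span_delta
  norm_vec := norm_delta 1
  trace x hx y hy := by
    rw [b.inner_one_mul hx, b.inner_one_mul hy, ← (Equiv.inv G).tsum_eq]
    refine tsum_congr fun g => ?_
    simp [mul_comm]
  center x hx h := by
    obtain ⟨c, hc⟩ := hc x hx fun g => by
      rw [← b.conj_lam_apply hx, ← (h _ (b.lam_mem g)).eq, mul_assoc, lam_mul_star_self, mul_one]
    refine ⟨c, ?_⟩
    refine ContinuousLinearMap.ext_on dense_span_delta ?_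
    rintro _ ⟨g, rfl⟩
    rw [b.apply_delta hx, hc, map_smul, rho_delta_one]; rfl

end Bichar

namespace FreeGroup

variable {α : Type*} [DecidableEq α]

theorem head?_toWord_mul_mk_singleton {x : FreeGroup α} {l p : α × Bool} {L : List (α × Bool)}
    (hx : x.toWord = l :: p :: L) (m : α × Bool) : (x * mk [m]).toWord.head? = some l := by
  obtain ⟨L₀, z, hz⟩ := (p :: L).eq_nil_or_concat'.resolve_left (by simp)
  have hred : IsReduced (l :: L₀ ++ [z]) := by
    rw [List.cons_append, ← hz, ← hx]; exact isReduced_toWord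
  have hx' : x = mk (l :: L₀ ++ [z]) := by rw [List.cons_append, ← hz, ← hx, mk_toWord]
  rw [hx', mul_mk]
  by_cases h : z.1 = m.1 → z.2 = m.2
  · have h2 : IsReduced [z, m] := by simpa using h
    have := hred.append_overlap (L₃ := [m]) h2 (by simp)
    rw [toWord_mk, this.reduce_eq]; simp
  · push Not at h
    have hm : m = (z.1, !z.2) := by
      ext
      · exact h.1.symm
      · simp only; cases hz2 : z.2 <;> cases hm2 : m.2 <;> simp_all
    have : mk (l :: L₀ ++ [z] ++ [m]) = mk (l :: L₀) := by
      rw [hm]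
      refine (reduce.exact (reduce.Step.eq ?_))
      have := Red.Step.not (L₁ := l :: L₀) (L₂ := []) (x := z.1) (b := z.2)
      simpa using this
    rw [this, toWord_mk, (hred.infix ⟨[], [z], by simp⟩).reduce_eq]; simp

theorem head?_toWord_conj {x : FreeGroup α} {l p : α × Bool} (hx : x.toWord.head? = some p)
    (hlp : l.1 ≠ p.1) : (mk [l] * x * (mk [l])⁻¹).toWord.head? = some l := by
  obtain ⟨L, hL⟩ := List.head?_eq_some_iff.1 hx
  have h : (mk [l] * x).toWord = l :: p :: L := by
    conv_lhs => rw [← mk_toWord (x := x), hL, mul_mk, toWord_mk]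
    refine IsReduced.reduce_eq ?_
    have : IsReduced (p :: L) := hL ▸ isReduced_toWord
    simp [hlp, this]
  rw [inv_mk]
  exact head?_toWord_mul_mk_singleton h (l.1, !l.2)

end FreeGroup

namespace Ltwo

variable {α : Type*}

theorem norm_proj_union_sq_le (X Y : Set α) (η : Ltwo α) :
    ‖proj (X ∪ Y) η‖ ^ 2 ≤ ‖proj X η‖ ^ 2 + ‖proj Y η‖ ^ 2 := by
  rw [← Set.union_sdiff_self, norm_proj_union_sq Set.disjoint_sdiff_right]
  gcongr
  exact norm_proj_mono Set.sdiff_subset η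

end Ltwo

namespace Bichar

open Ltwo

variable {G : Type*} [Group G] {N : ℕ} [NeZero N] (b : Bichar G N)

theorem abs_norm_proj_conj_sub_le (g : G) {c : ℂ} (hc : ‖c‖ = 1) (X : Set G) (η : Ltwo G) :
    |‖proj ((fun h => g * h * g⁻¹) '' X) η‖ - ‖proj X η‖| ≤ ‖b.conjRep g η - c • η‖ := by
  have h1 : ‖proj ((fun h => g * h * g⁻¹) '' X) (b.conjRep g η)‖ = ‖proj X η‖ :=
    norm_proj_image_wperm (MulAut.conj g).toEquiv (fun _ => norm_rootChar _) X η
  rw [← h1, abs_sub_comm]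
  calc |‖proj _ (b.conjRep g η)‖ - ‖proj _ η‖|
      = |‖proj _ (b.conjRep g η)‖ - ‖proj ((fun h => g * h * g⁻¹) '' X) (c • η)‖| := by
        rw [map_smul, norm_smul, hc, one_mul]
    _ ≤ ‖proj ((fun h => g * h * g⁻¹) '' X) (b.conjRep g η) - proj _ (c • η)‖ :=
        abs_norm_sub_norm_le _ _
    _ ≤ ‖b.conjRep g η - c • η‖ := by rw [← map_sub]; exact norm_proj_le _ _

theorem le_of_paradoxical {s t u v w ε : ℝ} (hs : 0 ≤ s) (ht : 0 ≤ t) (hε : 0 ≤ ε) (hu : 0 ≤ u)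
    (hus : |u - s| ≤ ε) (hvs : |v - s| ≤ ε) (hws : |w - s| ≤ ε)
    (h1 : t ^ 2 ≤ s ^ 2 + u ^ 2) (h2 : s ^ 2 + v ^ 2 + w ^ 2 ≤ t ^ 2) : t ≤ 14 * ε := by
  rw [abs_le] at hus hvs hws
  have hu2 : u ^ 2 ≤ (s + ε) ^ 2 := by gcongr; linarith
  have key : s ≤ 6 * ε := by
    by_contra! h
    have hv2 : (s - ε) ^ 2 ≤ v ^ 2 := by gcongr <;> linarith
    have hw2 : (s - ε) ^ 2 ≤ w ^ 2 := by gcongr <;> linarith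
    nlinarith
  rw [← pow_le_pow_iff_left₀ ht (by positivity) two_ne_zero]
  nlinarith

/-- Over a group with a free factor, almost eigenvectors of the conjugation representation
concentrate on the complementary factor. -/
theorem norm_proj_compl_le {W : Type*} [Group W] (b : Bichar (FreeGroup Bool × W) N) {ca cb : ℂ}
    (ha : ‖ca‖ = 1) (hb : ‖cb‖ = 1) (η : Ltwo (FreeGroup Bool × W)) :
    ‖proj {x | x.1 = 1}ᶜ η‖ ≤ 14 * (‖b.conjRep (FreeGroup.of true, 1) η - ca • η‖ +
      ‖b.conjRep (FreeGroup.of false, 1) η - cb • η‖) := by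
  set ga : FreeGroup Bool × W := (FreeGroup.of true, 1)
  set gb : FreeGroup Bool × W := (FreeGroup.of false, 1)
  let S : Set (FreeGroup Bool × W) := {x | ∃ s, x.1.toWord.head? = some (true, s)}
  let c : FreeGroup Bool × W → FreeGroup Bool × W → FreeGroup Bool × W := fun g h => g * h * g⁻¹
  have hA := b.abs_norm_proj_conj_sub_le ga ha S η
  have hB := b.abs_norm_proj_conj_sub_le gb hb S η
  have hB' := b.abs_norm_proj_conj_sub_le gb hb (c gb⁻¹ '' S) η
  have himg : c gb '' (c gb⁻¹ '' S) = S := by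
    rw [← Set.image_comp]
    convert Set.image_id S using 2
    simp only [c, Function.comp, id]; group
  have hgai : ∀ x ∈ c gb '' S, x.1.toWord.head? = some (false, true) := by
    rintro _ ⟨x, ⟨s, hs⟩, rfl⟩
    exact FreeGroup.head?_toWord_conj hs (l := (false, true)) (by simp)
  have hgbi : ∀ x ∈ c gb⁻¹ '' S, x.1.toWord.head? = some (false, false) := by
    rintro _ ⟨x, ⟨s, hs⟩, rfl⟩
    exact FreeGroup.head?_toWord_conj hs (l := (false, false)) (by simp)
  have h1 : {x : FreeGroup Bool × W | x.1 = 1}ᶜ ⊆ S ∪ c ga '' S := by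
    intro x hx
    obtain ⟨⟨l, s⟩, hl⟩ : ∃ l, x.1.toWord.head? = some l := by
      rcases h : x.1.toWord with _ | ⟨l, L⟩
      · exact absurd (FreeGroup.toWord_eq_nil_iff.1 h) hx
      · exact ⟨l, rfl⟩
    cases l
    · right
      refine ⟨ga⁻¹ * x * ga, ⟨false, ?_⟩, by simp only [c]; group⟩
      have := FreeGroup.head?_toWord_conj hl (l := (true, false)) (by simp)
      simpa [ga, FreeGroup.of, FreeGroup.invRev] using this
    · exact Or.inl ⟨s, hl⟩
  have h2 : S ∪ c gb '' S ∪ c gb⁻¹ '' S ⊆ {x : FreeGroup Bool × W | x.1 = 1}ᶜ := by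
    intro x hx h
    rw [Set.mem_ofPred_eq] at h
    rcases hx with (⟨s, hs⟩ | hx) | hx
    · simp [h] at hs
    · simpa [h] using hgai x hx
    · simpa [h] using hgbi x hx
  have d1 : Disjoint S (c gb '' S) := Set.disjoint_left.2 fun x ⟨s, hs⟩ hx => by
    simpa [hs] using hgai x hx
  have d2 : Disjoint (S ∪ c gb '' S) (c gb⁻¹ '' S) := Set.disjoint_left.2 fun x hx hx' => by
    rcases hx with ⟨s, hs⟩ | hx
    · simpa [hs] using hgbi x hx'
    · simpa [hgai x hx] using hgbi x hx'
  have e1 := (pow_le_pow_left₀ (norm_nonneg _) (norm_proj_mono h1 η) 2).trans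
    (norm_proj_union_sq_le _ _ η)
  have e2 := pow_le_pow_left₀ (norm_nonneg _) (norm_proj_mono h2 η) 2
  rw [norm_proj_union_sq d2, norm_proj_union_sq d1] at e2
  change |‖proj (c gb '' (c gb⁻¹ '' S)) η‖ - _| ≤ _ at hB'
  rw [himg, abs_sub_comm] at hB'
  have p1 := norm_nonneg (b.conjRep ga η - ca • η)
  have p2 := norm_nonneg (b.conjRep gb η - cb • η)
  exact le_of_paradoxical (norm_nonneg _) (norm_nonneg _) (by positivity)
    (norm_nonneg _) (hA.trans (by linarith)) (hB.trans (by linarith))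
    (hB'.trans (by linarith)) e1 e2

end Bichar

/-- The homomorphism `ZMod 3 → ZMod 9` sending `1` to `3`. -/
def threeHom : ZMod 3 →+ ZMod 9 :=
  AddMonoidHom.mk' (fun x => 3 * (x.val : ZMod 9)) (by decide)

/-- The abelian part of the group underlying the example. -/
abbrev AbelianPart : Type := Multiplicative (ZMod 3 × (ℕ →₀ ZMod 9) × (ℕ →₀ ZMod 9))

/-- The group underlying the example. -/
abbrev BaseGroup : Type := FreeGroup Bool × AbelianPart

namespace BaseGroup

/-- The homomorphism to `ZMod 9` that counts the first free generator. -/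
def expo (g : BaseGroup) : ZMod 9 :=
  (FreeGroup.lift (fun s : Bool => Multiplicative.ofAdd (if s then (1 : ZMod 9) else 0)) g.1).toAdd

/-- The torsion coordinate of `g`, embedded in `ZMod 9`. -/
def tors (g : BaseGroup) : ZMod 9 := threeHom g.2.toAdd.1

/-- The first family of coordinates. -/
def pc (g : BaseGroup) : ℕ →₀ ZMod 9 := g.2.toAdd.2.1

/-- The second family of coordinates. -/
def qc (g : BaseGroup) : ℕ →₀ ZMod 9 := g.2.toAdd.2.2

/-- The sum of the coordinates of the second family. -/
def tot (g : BaseGroup) : ZMod 9 := (qc g).sum fun _ x => x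

section

variable (g h : BaseGroup)

@[simp] theorem expo_mul : expo (g * h) = expo g + expo h := by simp [expo]
@[simp] theorem tors_mul : tors (g * h) = tors g + tors h := by simp [tors]
@[simp] theorem pc_mul : pc (g * h) = pc g + pc h := rfl
@[simp] theorem qc_mul : qc (g * h) = qc g + qc h := rfl

@[simp] theorem tot_mul : tot (g * h) = tot g + tot h := by
  rw [tot, qc_mul, Finsupp.sum_add_index' (fun _ => rfl) (fun _ _ _ => rfl)]; rfl

@[simp] theorem expo_inv : expo g⁻¹ = -expo g := by simp [expo]
@[simp] theorem tors_inv : tors g⁻¹ = -tors g := by simp [tors]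
@[simp] theorem pc_inv : pc g⁻¹ = -pc g := rfl
@[simp] theorem qc_inv : qc g⁻¹ = -qc g := rfl

@[simp] theorem tot_inv : tot g⁻¹ = -tot g := by
  rw [eq_neg_iff_add_eq_zero, ← tot_mul, inv_mul_cancel]; rfl

@[simp] theorem expo_one : expo 1 = 0 := by simp [expo]
@[simp] theorem tors_one : tors 1 = 0 := by simp [tors]
@[simp] theorem pc_one : pc 1 = 0 := rfl
@[simp] theorem qc_one : qc 1 = 0 := rfl
@[simp] theorem tot_one : tot 1 = 0 := rfl

end

/-- The standard pairing of finitely supported functions. -/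
def pairing (p q : ℕ →₀ ZMod 9) : ZMod 9 := p.sum fun i x => x * q i

theorem pairing_add_left (p p' q : ℕ →₀ ZMod 9) :
    pairing (p + p') q = pairing p q + pairing p' q :=
  Finsupp.sum_add_index' (fun _ => zero_mul _) (fun _ _ _ => add_mul _ _ _)

theorem pairing_add_right (p q q' : ℕ →₀ ZMod 9) :
    pairing p (q + q') = pairing p q + pairing p q' := by
  simp only [pairing, Finsupp.add_apply, mul_add, Finsupp.sum_add]

theorem pairing_single_left (i : ℕ) (x : ZMod 9) (q : ℕ →₀ ZMod 9) :
    pairing (Finsupp.single i x) q = x * q i := Finsupp.sum_single_index (zero_mul _)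

theorem pairing_single_right (i : ℕ) (x : ZMod 9) (p : ℕ →₀ ZMod 9) :
    pairing p (Finsupp.single i x) = p i * x := by
  classical
  simp only [pairing, Finsupp.single_apply, mul_ite, mul_zero]
  rw [Finsupp.sum_ite_eq]
  split_ifs with h
  · rfl
  · rw [Finsupp.notMem_support_iff.1 h, zero_mul]

@[simp] theorem pairing_zero_left (q : ℕ →₀ ZMod 9) : pairing 0 q = 0 := rfl

@[simp] theorem pairing_zero_right (p : ℕ →₀ ZMod 9) : pairing p 0 = 0 := by simp [pairing]

/-- The bicharacter defining the twist. -/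
def form : Bichar BaseGroup 9 where
  toFun g h := pairing (pc g) (qc h) + tors g * tot h + expo g * (tot h + tors h)
  map_mul_left g g' h := by simp only [pc_mul, tors_mul, expo_mul, pairing_add_left]; ring
  map_mul_right g h h' := by simp only [qc_mul, tors_mul, tot_mul, pairing_add_right]; ring

theorem form_apply (g h : BaseGroup) :
    form g h = pairing (pc g) (qc h) + tors g * tot h + expo g * (tot h + tors h) := rfl

/-- The generator of the torsion part. -/
def vGen : BaseGroup := (1, Multiplicative.ofAdd (1, 0, 0))

/-- The generators of the first family. -/
noncomputable def pGen (i : ℕ) : BaseGroup := (1, Multiplicative.ofAdd (0, Finsupp.single i 1, 0))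

/-- The generators of the second family. -/
noncomputable def qGen (i : ℕ) : BaseGroup := (1, Multiplicative.ofAdd (0, 0, Finsupp.single i 1))

section

variable (i : ℕ)

@[simp] theorem vGen_fst : vGen.1 = 1 := rfl
@[simp] theorem expo_vGen : expo vGen = 0 := by simp [expo]
@[simp] theorem tors_vGen : tors vGen = 3 := by decide
@[simp] theorem pc_vGen : pc vGen = 0 := rfl
@[simp] theorem qc_vGen : qc vGen = 0 := rfl
@[simp] theorem tot_vGen : tot vGen = 0 := rfl
@[simp] theorem pGen_fst : (pGen i).1 = 1 := rfl
@[simp] theorem expo_pGen : expo (pGen i) = 0 := by simp [expo]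
@[simp] theorem tors_pGen : tors (pGen i) = 0 := map_zero _
@[simp] theorem pc_pGen : pc (pGen i) = Finsupp.single i 1 := rfl
@[simp] theorem qc_pGen : qc (pGen i) = 0 := rfl
@[simp] theorem tot_pGen : tot (pGen i) = 0 := rfl
@[simp] theorem qGen_fst : (qGen i).1 = 1 := rfl
@[simp] theorem expo_qGen : expo (qGen i) = 0 := by simp [expo]
@[simp] theorem tors_qGen : tors (qGen i) = 0 := map_zero _
@[simp] theorem pc_qGen : pc (qGen i) = 0 := rfl
@[simp] theorem qc_qGen : qc (qGen i) = Finsupp.single i 1 := rfl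
@[simp] theorem tot_qGen : tot (qGen i) = 1 := Finsupp.sum_single_index rfl

end

theorem expo_eq_zero {g : BaseGroup} (hg : g.1 = 1) : expo g = 0 := by simp [expo, hg]

theorem threeHom_injective : Function.Injective threeHom := by decide

theorem tors_mul_tors (g h : BaseGroup) : tors g * tors h = 0 := by
  have : ∀ x y, threeHom x * threeHom y = 0 := by decide
  exact this _ _

theorem three_mul_tors (g : BaseGroup) : 3 * tors g = 0 := by
  have : ∀ x, 3 * threeHom x = 0 := by decide
  exact this _

theorem comm_pGen (g : BaseGroup) (i : ℕ) : form.comm g (pGen i) = -qc g i := by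
  simp [Bichar.comm, form_apply, pairing_single_left]

theorem comm_qGen (g : BaseGroup) (i : ℕ) :
    form.comm g (qGen i) = pc g i + tors g + expo g := by
  simp [Bichar.comm, form_apply, pairing_single_right]

theorem comm_vGen (g : BaseGroup) : form.comm g vGen = 3 * expo g - 3 * tot g := by
  simp [Bichar.comm, form_apply]; ring

/-- An element of the abelian part that commutes with everything in the twisted sense is trivial. -/
theorem eq_one_of_comm {g : BaseGroup} (hg : g.1 = 1) (hp : ∀ i, form.comm g (pGen i) = 0)
    (hq : ∀ i, form.comm g (qGen i) = 0) : g = 1 := by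
  simp only [comm_pGen, neg_eq_zero] at hp
  simp only [comm_qGen, expo_eq_zero hg, add_zero] at hq
  have ht : tors g = 0 := by
    obtain ⟨i, hi⟩ := Infinite.exists_notMem_finset (pc g).support
    simpa [Finsupp.notMem_support_iff.1 hi] using hq i
  have h1 : g.2.toAdd.1 = 0 := threeHom_injective (ht.trans (map_zero _).symm)
  have h2 : g.2.toAdd.2.1 = 0 := by ext i; have := hq i; rwa [ht, add_zero] at this
  have h3 : g.2.toAdd.2.2 = 0 := by ext i; exact hp i
  refine Prod.ext hg ?_
  exact Prod.ext h1 (Prod.ext h2 h3)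

open Bichar Ltwo

theorem conj_eq_self {g h : BaseGroup} (hg : g.1 = 1) : h⁻¹ * g * h = g := by
  refine Prod.ext (by simp [hg]) ?_
  change h.2⁻¹ * g.2 * h.2 = g.2
  rw [mul_comm, mul_inv_cancel_left]

theorem conj_eq_self' {g h : BaseGroup} (hg : g.1 = 1) : g⁻¹ * h * g = h := by
  refine Prod.ext (by simp [hg]) ?_
  change g.2⁻¹ * h.2 * g.2 = h.2
  rw [mul_comm, mul_inv_cancel_left]

theorem eq_smul_delta_of_conjRep {η : Ltwo BaseGroup} (h : ∀ g, form.conjRep g η = η) :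
    η = η 1 • delta 1 := by
  have h1 : proj {g : BaseGroup | g.1 = 1}ᶜ η = 0 := by
    have := norm_proj_compl_le form (ca := 1) (cb := 1) (by simp) (by simp) η
    rw [h, h, one_smul, sub_self, norm_zero, add_zero, mul_zero] at this
    exact norm_le_zero_iff.1 this
  ext g
  rw [lp.coeFn_smul, Pi.smul_apply, smul_eq_mul]
  by_cases hg1 : g = 1
  · rw [hg1, delta_apply_self, mul_one]
  rw [delta_apply_of_ne hg1, mul_zero]
  by_cases hg : g.1 = 1
  · by_contra h0
    refine hg1 ?_
    have key (k : BaseGroup) : form.comm g k = 0 := by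
      have := congrArg (fun ξ : Ltwo BaseGroup => ξ g) (h k)
      simp only [conjRep_apply, conj_eq_self hg] at this
      rw [mul_eq_right₀ h0, ← rootChar_zero (N := 9), rootChar_injective.eq_iff] at this
      rw [form.comm_swap, this, neg_zero]
    exact eq_one_of_comm hg (fun i => key _) fun i => key _
  · rw [← proj_apply_of_mem (X := {g : BaseGroup | g.1 = 1}ᶜ) hg η, h1]; rfl

/-- The twisted group von Neumann algebra of the example is a factor. -/
theorem isTracialFactor :
    IsTracialFactor form.vonNeumann (Set.range form.rho) (delta (1 : BaseGroup)) :=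
  form.isTracialFactor fun _ _ h => ⟨_, eq_smul_delta_of_conjRep h⟩

instance : Countable BaseGroup :=
  haveI : Countable (FreeGroup Bool) := Quotient.countable
  haveI : Countable AbelianPart :=
    inferInstanceAs (Countable (ZMod 3 × (ℕ →₀ ZMod 9) × (ℕ →₀ ZMod 9)))
  inferInstance

theorem pairing_eq_sum_right (p q : ℕ →₀ ZMod 9) : pairing p q = q.sum fun i x => p i * x := by
  induction q using Finsupp.induction_linear with
  | zero => simp
  | add f g hf hg =>
    rw [pairing_add_right, hf, hg, Finsupp.sum_add_index' (fun _ => mul_zero _)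
      fun _ _ _ => mul_add _ _ _]
  | single i x => rw [pairing_single_right, Finsupp.sum_single_index (mul_zero _)]

/-- A decreasing sequence of finite index subgroups. -/
def level (n : ℕ) : Subgroup BaseGroup where
  carrier := {g | expo g = 0 ∧ tot g + tors g = 0 ∧ ∀ i < n, qc g i = 0 ∧ pc g i + tors g = 0}
  one_mem' := by simp
  mul_mem' := by
    rintro g h ⟨g1, g2, g3⟩ ⟨h1, h2, h3⟩
    refine ⟨by simp [g1, h1], ?_, fun i hi => ⟨by simp [(g3 i hi).1, (h3 i hi).1], ?_⟩⟩
    · rw [tot_mul, tors_mul]; linear_combination g2 + h2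
    · rw [pc_mul, tors_mul, Finsupp.add_apply]; linear_combination (g3 i hi).2 + (h3 i hi).2
  inv_mem' := by
    rintro g ⟨g1, g2, g3⟩
    refine ⟨by simp [g1], ?_, fun i hi => ⟨by simp [(g3 i hi).1], ?_⟩⟩
    · rw [tot_inv, tors_inv]; linear_combination -g2
    · rw [pc_inv, tors_inv, Finsupp.neg_apply]; linear_combination -(g3 i hi).2

theorem mem_level {n : ℕ} {g : BaseGroup} : g ∈ level n ↔
    expo g = 0 ∧ tot g + tors g = 0 ∧ ∀ i < n, qc g i = 0 ∧ pc g i + tors g = 0 := Iff.rfl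

theorem level_anti : Antitone level := fun _ _ h _ hg =>
  ⟨hg.1, hg.2.1, fun i hi => hg.2.2 i (hi.trans_le h)⟩

/-- The invariant of an element that determines its coset modulo `level n`. -/
def levelInv (n : ℕ) (g : BaseGroup) : ZMod 9 × ZMod 9 × (Fin n → ZMod 9) × (Fin n → ZMod 9) :=
  (expo g, tot g + tors g, fun i => qc g i, fun i => pc g i + tors g)

theorem inv_mul_mem_level {n : ℕ} {g h : BaseGroup} (hgh : levelInv n g = levelInv n h) :
    g⁻¹ * h ∈ level n := by
  simp only [levelInv, Prod.mk.injEq, funext_iff] at hgh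
  obtain ⟨h1, h2, h3, h4⟩ := hgh
  refine ⟨by simp [h1], ?_, fun i hi => ⟨?_, ?_⟩⟩
  · rw [tot_mul, tors_mul, tot_inv, tors_inv]; linear_combination -h2
  · have := h3 ⟨i, hi⟩
    rw [qc_mul, qc_inv, Finsupp.add_apply, Finsupp.neg_apply]; linear_combination -this
  · have := h4 ⟨i, hi⟩
    rw [pc_mul, pc_inv, tors_mul, tors_inv, Finsupp.add_apply, Finsupp.neg_apply]
    linear_combination -this

theorem exists_finset_level (n : ℕ) :
    ∃ s : Finset BaseGroup, ∀ g, ∃ r ∈ s, r⁻¹ * g ∈ level n := by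
  classical
  refine ⟨Finset.univ.image (Function.invFun (levelInv n)), fun g =>
    ⟨Function.invFun (levelInv n) (levelInv n g), Finset.mem_image_of_mem _ (Finset.mem_univ _),
      inv_mul_mem_level (Function.invFun_eq ⟨g, rfl⟩)⟩⟩

theorem commutator_mem_level (n : ℕ) (g h : BaseGroup) : (h * g)⁻¹ * (g * h) ∈ level n := by
  refine inv_mul_mem_level ?_
  simp only [levelInv, Prod.mk.injEq, funext_iff, expo_mul, tot_mul, tors_mul, qc_mul, pc_mul,
    Finsupp.add_apply]
  refine ⟨by ring, by ring, fun _ => by ring, fun _ => by ring⟩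

theorem pow_mem_level (n : ℕ) (g : BaseGroup) : g ^ 9 ∈ level n := by
  have h9 : ∀ x : ZMod 9, x + x + x + x + x + x + x + x + x = 0 := by decide
  simp only [pow_succ, pow_zero, one_mul, mem_level, expo_mul, tot_mul, tors_mul, qc_mul, pc_mul,
    Finsupp.add_apply, h9, add_zero, true_and]
  exact fun _ _ => trivial

/-- The neighbourhood filter of the identity of the abelian part, for the topology given by the
subgroups `level n`. -/
def smallFilter : Filter BaseGroup := ⨅ n, 𝓟 {s | s.1 = 1 ∧ s ∈ level n}

theorem hasBasis_smallFilter :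
    smallFilter.HasBasis (fun _ => True) fun n => {s | s.1 = 1 ∧ s ∈ level n} := by
  refine hasBasis_iInf_principal (directed_of_isDirected_le fun m n h => ?_)
  exact fun s hs => ⟨hs.1, level_anti h hs.2⟩

theorem comm_eq_zero_of_mem_level {n : ℕ} {s g : BaseGroup} (hs : s ∈ level n)
    (hq : ∀ i ∈ (qc g).support, i < n) (hp : ∀ i ∈ (pc g).support, i < n) :
    form.comm s g = 0 := by
  obtain ⟨h1, h2, h3⟩ := hs
  have e1 : pairing (pc s) (qc g) = -tors s * tot g := by
    rw [pairing_eq_sum_right, tot, Finsupp.sum, Finsupp.sum, Finset.mul_sum]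
    refine Finset.sum_congr rfl fun i hi => ?_
    rw [eq_neg_of_add_eq_zero_left (h3 i (hq i hi)).2]
  have e2 : pairing (pc g) (qc s) = 0 :=
    Finset.sum_eq_zero fun i hi => by simp only [(h3 i (hp i hi)).1, mul_zero]
  rw [Bichar.comm, form_apply, form_apply, e1, e2, h1, h2, eq_neg_of_add_eq_zero_left h2]
  linear_combination tors_mul_tors g s

theorem eventually_comm_eq_zero (g : BaseGroup) : ∀ᶠ s in smallFilter, form.comm s g = 0 := by
  refine hasBasis_smallFilter.eventually_iff.2
    ⟨((qc g).support ∪ (pc g).support).sup id + 1, trivial, fun s hs => ?_⟩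
  have key (i : ℕ) (hi : i ∈ (qc g).support ∪ (pc g).support) :=
    Nat.lt_succ_of_le (Finset.le_sup (f := id) hi)
  exact comm_eq_zero_of_mem_level hs.2 (fun i hi => key i (Finset.mem_union_left _ hi))
    fun i hi => key i (Finset.mem_union_right _ hi)

theorem conjRep_delta_of_fst {s : BaseGroup} (hs : s.1 = 1) (g : BaseGroup) :
    form.conjRep s (delta g) = rootChar (form.comm s g) • delta g := by
  rw [conjRep, wperm_delta]
  have : (MulAut.conj s).toEquiv g = g := by
    have := conj_eq_self' (g := s⁻¹) (h := g) (by simp [hs])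
    rwa [inv_inv] at this
  rw [this]

theorem tendsto_conjRep (η : Ltwo BaseGroup) :
    Tendsto (fun s => form.conjRep s η) smallFilter (𝓝 η) := by
  rw [← tendsto_sub_nhds_zero_iff]
  refine tendsto_apply_zero_of_dense_span (T := fun s => form.conjRep s - 1) (C := 2)
    (fun s => ?_) dense_span_delta ?_ η
  · refine ContinuousLinearMap.opNorm_le_bound _ (by norm_num) fun ξ => ?_
    refine (norm_sub_le _ _).trans_eq ?_
    change ‖form.conjRep s ξ‖ + ‖ξ‖ = _
    rw [norm_conjRep_apply]; ring
  · rintro _ ⟨g, rfl⟩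
    refine tendsto_const_nhds.congr' ?_
    filter_upwards [eventually_comm_eq_zero g, hasBasis_smallFilter.mem_of_mem (i := 0) trivial]
      with s hs h1
    simp [conjRep_delta_of_fst h1.1, hs]

/-- The arithmetic obstruction. -/
theorem false_of_character {n : ℕ} {χ : BaseGroup → ZMod 9}
    (hχ : ∀ g h, χ (g * h) = χ g + χ h) (hL : ∀ g ∈ level n, χ g = 0) {u : BaseGroup}
    (hu : u.1 = 1) (h1 : χ u = 1) (hv : form.comm u vGen = χ vGen)
    (hp : ∀ i < n, form.comm u (pGen i) = χ (pGen i))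
    (hq : ∀ i < n, form.comm u (qGen i) = χ (qGen i)) : False := by
  let ψ : ZMod 3 × (ℕ →₀ ZMod 9) × (ℕ →₀ ZMod 9) →+ ZMod 9 :=
    AddMonoidHom.mk' (fun a => χ (1, Multiplicative.ofAdd a)) fun a b =>
      hχ (1, Multiplicative.ofAdd a) (1, Multiplicative.ofAdd b)
  let ψp : (ℕ →₀ ZMod 9) →+ ZMod 9 :=
    ψ.comp ((AddMonoidHom.inr _ _).comp (AddMonoidHom.inl _ _))
  let ψq : (ℕ →₀ ZMod 9) →+ ZMod 9 :=
    ψ.comp ((AddMonoidHom.inr _ _).comp (AddMonoidHom.inr _ _))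
  have e (a : ZMod 3) (p q : ℕ →₀ ZMod 9) : ψ (a, p, q) = ψ (a, 0, 0) + ψp p + ψq q := by
    simp only [ψp, ψq, AddMonoidHom.comp_apply, AddMonoidHom.inr_apply, AddMonoidHom.inl_apply]
    rw [← map_add, ← map_add]; simp
  have hψp (f : ℕ → ZMod 9) : ψp (∑ i ∈ Finset.range n, Finsupp.single i (f i)) =
      ∑ i ∈ Finset.range n, f i * χ (pGen i) := by
    rw [map_sum]
    refine Finset.sum_congr rfl fun i _ => ?_
    rw [← mul_one (f i), ← smul_eq_mul (f i), ← Finsupp.smul_single, ZMod.map_smul]; simp; rfl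
  have hψq1 (i : ℕ) (x : ZMod 9) : ψq (Finsupp.single i x) = x * χ (qGen i) := by
    rw [← mul_one x, ← smul_eq_mul x, ← Finsupp.smul_single, ZMod.map_smul]; simp; rfl
  have hψq (f : ℕ → ZMod 9) : ψq (∑ i ∈ Finset.range n, Finsupp.single i (f i)) =
      ∑ i ∈ Finset.range n, f i * χ (qGen i) := by
    rw [map_sum]
    exact Finset.sum_congr rfl fun i _ => hψq1 _ _
  have hinv {g h : BaseGroup} (hgh : levelInv n g = levelInv n h) : χ h = χ g := by
    have := hL _ (inv_mul_mem_level hgh)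
    rw [← mul_inv_cancel_left g h, hχ, this, add_zero]
  have hsum (f : ℕ → ZMod 9) (i : Fin n) :
      (∑ j ∈ Finset.range n, Finsupp.single j (f j)) (i : ℕ) = f i := by
    rw [Finsupp.finsetSum_apply]
    simp [Finsupp.single_apply]
  have htot (f : ℕ → ZMod 9) (x : ZMod 9) :
      ((∑ j ∈ Finset.range n, Finsupp.single j (f j)) + Finsupp.single n x).sum (fun _ y => y) =
        ∑ j ∈ Finset.range n, f j + x := by
    let θ : (ℕ →₀ ZMod 9) →+ ZMod 9 := Finsupp.liftAddHom fun _ => AddMonoidHom.id _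
    change θ _ = _
    rw [map_add, map_sum]
    simp [θ]
  have hsing (x : ZMod 9) (i : Fin n) : Finsupp.single n x (i : ℕ) = 0 :=
    Finsupp.single_eq_of_ne i.2.ne
  have key (f g : ℕ → ZMod 9) (x : ZMod 9) (h : BaseGroup) (h0 : h.1 = 1)
      (hq : ∀ i < n, qc h i = g i) (hp : ∀ i < n, pc h i + tors h = f i)
      (ht : tot h + tors h = ∑ j ∈ Finset.range n, g j + x) :
      χ h = ∑ i ∈ Finset.range n, f i * χ (pGen i) + ∑ i ∈ Finset.range n, g i * χ (qGen i) +
        x * χ (qGen n) := by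
    let a : ZMod 3 × (ℕ →₀ ZMod 9) × (ℕ →₀ ZMod 9) :=
      (0, ∑ j ∈ Finset.range n, Finsupp.single j (f j),
        (∑ j ∈ Finset.range n, Finsupp.single j (g j)) + Finsupp.single n x)
    have hw : levelInv n (1, Multiplicative.ofAdd a) = levelInv n h := by
      have t0 : tors (1, Multiplicative.ofAdd a) = 0 := map_zero _
      simp only [levelInv, Prod.mk.injEq, funext_iff]
      refine ⟨by rw [expo_eq_zero rfl, expo_eq_zero h0], ?_, fun i => ?_, fun i => ?_⟩
      · rw [t0, add_zero, ht]; exact htot g x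
      · rw [hq i i.2]
        change (_ + Finsupp.single n x : ℕ →₀ ZMod 9) i = _
        rw [Finsupp.add_apply, hsum, hsing, add_zero]
      · rw [hp i i.2, t0, add_zero]; exact hsum f i
    rw [hinv hw]
    change ψ a = _
    rw [e, hψp, map_add, hψq, hψq1]
    have : ψ (0, 0, 0) = 0 := map_zero ψ
    rw [this]; ring
  have e1 := key (fun i => pc u i + tors u) (fun i => qc u i)
    (tot u + tors u - ∑ i ∈ Finset.range n, qc u i) u hu (fun _ _ => rfl) (fun _ _ => rfl) (by ring)
  have e2 := key (fun _ => 3) (fun _ => 0) 3 vGen rfl (by simp) (by simp) (by simp)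
  simp only [comm_pGen] at hp
  simp only [comm_qGen, expo_eq_zero hu, add_zero] at hq
  rw [comm_vGen, expo_eq_zero hu] at hv
  rw [Finset.sum_congr rfl (g := fun i => (pc u i + tors u) * (-qc u i)) fun i hi => by
      rw [hp i (Finset.mem_range.1 hi)],
    Finset.sum_congr rfl (g := fun i => qc u i * (pc u i + tors u)) (f := fun i => qc u i * _)
      fun i hi => by rw [hq i (Finset.mem_range.1 hi)], ← Finset.sum_add_distrib,
    Finset.sum_eq_zero fun i _ => by ring, zero_add, h1] at e1
  rw [Finset.sum_congr rfl (g := fun i => -(3 * qc u i)) fun i hi => by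
      rw [← hp i (Finset.mem_range.1 hi), mul_neg], Finset.sum_neg_distrib, ← Finset.mul_sum,
    ← hv] at e2
  simp only [zero_mul, Finset.sum_const_zero, add_zero, mul_zero, zero_sub] at e2
  have fin : ∀ γ x : ZMod 9, 1 = γ * x → 3 * x = -(3 * γ) → False := by decide
  refine fin _ _ e1 ?_
  linear_combination -e2 + three_mul_tors u

end BaseGroup

/-- A closed convex set near `v` spanned by an orbit of a family of isometries contains a common
fixed point near `v`. -/
theorem exists_fixed_point {H : Type*} [NormedAddCommGroup H] [InnerProductSpace ℝ H]
    [CompleteSpace H] {𝒰 : Set (H →L[ℝ] H)} (hiso : ∀ U ∈ 𝒰, ∀ w, ‖U w‖ = ‖w‖) {K : Set H}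
    (hK : K.Nonempty) (hU : ∀ U ∈ 𝒰, Set.MapsTo U K K) {C : Set H} (hC : IsClosed C)
    (hC' : Convex ℝ C) (hKC : K ⊆ C) : ∃ ξ ∈ C, ∀ U ∈ 𝒰, U ξ = ξ := by
  set D : Set H := closure (convexHull ℝ K)
  have hDc : Convex ℝ D := (convex_convexHull ℝ K).closure
  obtain ⟨ξ, hξ, hmin⟩ := exists_norm_eq_iInf_of_complete_convex (K := D)
    (hK.mono ((subset_convexHull ℝ K).trans subset_closure)) isClosed_closure.isComplete hDc 0
  have hle (w : H) (hw : w ∈ D) : ‖ξ‖ ≤ ‖w‖ := by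
    have := ciInf_le (f := fun w : D => ‖(0 : H) - w‖)
      ⟨0, Set.forall_mem_range.2 fun _ => norm_nonneg _⟩ ⟨w, hw⟩
    rw [← hmin] at this
    simpa using this
  refine ⟨ξ, closure_minimal (convexHull_min hKC hC') hC hξ, fun U hUU => ?_⟩
  have hUξ : U ξ ∈ D := by
    refine map_mem_closure U.continuous hξ fun w hw => ?_
    have : convexHull ℝ K ⊆ U ⁻¹' convexHull ℝ K :=
      convexHull_min (fun x hx => subset_convexHull ℝ K (hU U hUU hx))
        ((convex_convexHull ℝ K).is_linear_preimage U.isLinear)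
    exact this hw
  have hmid := hle _ (hDc hUξ hξ (a := 1 / 2) (b := 1 / 2) (by norm_num) (by norm_num)
    (by norm_num))
  rw [← smul_add, norm_smul] at hmid
  have hp := parallelogram_law_with_norm ℝ (U ξ) ξ
  rw [hiso U hUU] at hp
  have h0 : ‖U ξ - ξ‖ = 0 := by
    norm_num at hmid
    have := norm_nonneg ξ
    nlinarith [norm_nonneg (U ξ - ξ), norm_nonneg (U ξ + ξ)]
  exact sub_eq_zero.1 (norm_eq_zero.1 h0)

theorem sum_rootChar_mul {N : ℕ} [NeZero N] (i : ZMod N) :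
    ∑ j : ZMod N, rootChar (i * j) = if i = 0 then (N : ℂ) else 0 := by
  have := AddChar.sum_mulShift i (ZMod.isPrimitive_stdAddChar N)
  rw [ZMod.card] at this
  simp only [mul_comm i]
  exact this.trans (by split_ifs <;> simp)

section Isometry

variable {H : Type*} [NormedAddCommGroup H] [InnerProductSpace ℂ H] [CompleteSpace H]

theorem norm_apply_of_star_mul_self {y : H →L[ℂ] H} (h : star y * y = 1) (v : H) :
    ‖y v‖ = ‖v‖ := (ContinuousLinearMap.norm_map_iff_adjoint_comp_self y).2 h v

theorem norm_le_one_of_star_mul_self {y : H →L[ℂ] H} (h : star y * y = 1) : ‖y‖ ≤ 1 :=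
  y.opNorm_le_bound zero_le_one fun v => by rw [norm_apply_of_star_mul_self h, one_mul]

theorem IsTracialFactor.norm_mul_unitary {M : StarSubalgebra ℂ (H →L[ℂ] H)}
    {R : Set (H →L[ℂ] H)} {Ω : H} (hM : IsTracialFactor M R Ω) {x y : H →L[ℂ] H} (hx : x ∈ M)
    (hy : y ∈ M) (h : y * star y = 1) : ‖x (y Ω)‖ = ‖x Ω‖ := by
  rw [← mul_apply_eq_comp, ← hM.norm_star (mul_mem hx hy), star_mul, mul_apply_eq_comp,
    norm_apply_of_star_mul_self (by rwa [star_star]), hM.norm_star hx]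

end Isometry

namespace Bichar

open Ltwo

variable {G : Type*} [Group G] {N : ℕ} [NeZero N] {b : Bichar G N}

/-- The operators `T g` are the pointwise limits of the conjugates of `λ g` by the unitaries
`y k`. -/
structure IsLimitConj (b : Bichar G N) (y : ℕ → Ltwo G →L[ℂ] Ltwo G)
    (T : G → Ltwo G →L[ℂ] Ltwo G) : Prop where
  mem : ∀ k, y k ∈ b.vonNeumann
  star_mul : ∀ k, star (y k) * y k = 1
  mul_star : ∀ k, y k * star (y k) = 1
  mem' : ∀ g, T g ∈ b.vonNeumann
  tendsto : ∀ g v, Tendsto (fun k => (y k * b.lam g * star (y k)) v) atTop (𝓝 (T g v))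

namespace IsLimitConj

variable {y : ℕ → Ltwo G →L[ℂ] Ltwo G} {T : G → Ltwo G →L[ℂ] Ltwo G}

theorem conj_mem (hT : b.IsLimitConj y T) (g : G) (k : ℕ) :
    y k * b.lam g * star (y k) ∈ b.vonNeumann :=
  mul_mem (mul_mem (hT.mem k) (b.lam_mem g)) (star_mem (hT.mem k))

theorem norm_conj (hT : b.IsLimitConj y T) (g : G) (k : ℕ) (v : Ltwo G) :
    ‖(y k * b.lam g * star (y k)) v‖ = ‖v‖ := by
  rw [mul_apply_eq_comp, mul_apply_eq_comp, norm_apply_of_star_mul_self (hT.star_mul k),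
    norm_apply_of_star_mul_self (b.star_lam_mul_self g),
    norm_apply_of_star_mul_self (by rw [star_star, hT.mul_star])]

theorem norm_apply (hT : b.IsLimitConj y T) (g : G) (v : Ltwo G) : ‖T g v‖ = ‖v‖ :=
  tendsto_nhds_unique (hT.tendsto g v).norm (by simp only [hT.norm_conj, tendsto_const_nhds])

theorem star_mul_self (hT : b.IsLimitConj y T) (g : G) : star (T g) * T g = 1 :=
  (ContinuousLinearMap.norm_map_iff_adjoint_comp_self _).1 (hT.norm_apply g)

theorem apply_one (hT : b.IsLimitConj y T) : T 1 = 1 := by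
  ext1 v
  refine tendsto_nhds_unique (hT.tendsto 1 v) ?_
  simp only [lam_one, mul_one, hT.mul_star]
  exact tendsto_const_nhds

theorem mul (hM : IsTracialFactor b.vonNeumann (Set.range b.rho) (delta 1))
    (hT : b.IsLimitConj y T) (g h : G) : T g * T h = rootChar (b g h) • T (g * h) := by
  refine hM.ext (mul_mem (hT.mem' g) (hT.mem' h))
    (b.vonNeumann.smul_mem (hT.mem' _) _) ?_
  refine tendsto_nhds_unique (hM.tendsto_mul (hT.conj_mem g) (C := 1)
    (fun k => ContinuousLinearMap.opNorm_le_bound _ zero_le_one fun v => ?_) (hT.mem' g)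
    (hT.mem' h) (hT.tendsto g _) (hT.tendsto h _)) ?_
  · rw [hT.norm_conj, one_mul]
  · rw [_root_.smul_apply]
    refine ((hT.tendsto (g * h) _).const_smul _).congr fun k => ?_
    rw [← _root_.smul_apply]
    congr 1
    calc rootChar (b g h) • (y k * b.lam (g * h) * star (y k))
        = y k * (b.lam g * b.lam h) * star (y k) := by
          rw [lam_mul_lam, mul_smul_comm, smul_mul_assoc]
      _ = y k * b.lam g * (star (y k) * y k) * b.lam h * star (y k) := by
          rw [hT.star_mul]; noncomm_ring
      _ = _ := by noncomm_ring

theorem rho_mul_rho (g h : G) : b.rho g * b.rho h = rootChar (b h g) • b.rho (h * g) := by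
  refine ContinuousLinearMap.ext_on dense_span_delta ?_
  rintro _ ⟨k, rfl⟩
  rw [mul_apply_eq_comp, _root_.smul_apply, rho_delta, rho_delta, map_smul, rho_delta, smul_smul,
    smul_smul, ← rootChar_add, ← rootChar_add, mul_assoc]
  congr 2
  simp only [b.map_mul_left, b.map_mul_right]; ring

theorem commute_star_rho {x : Ltwo G →L[ℂ] Ltwo G} (hx : x ∈ b.vonNeumann) (g : G) :
    Commute x (star (b.rho g)) := by
  have := ((b.mem_vonNeumann_iff _).1 (star_mem hx) _ ⟨g, rfl⟩).star_star
  rwa [star_star] at this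

/-- The representation `g ↦ T g (ρ g)⋆`. -/
noncomputable def rep (hM : IsTracialFactor b.vonNeumann (Set.range b.rho) (delta 1))
    (hT : b.IsLimitConj y T) : G →* (Ltwo G →L[ℂ] Ltwo G) where
  toFun g := T g * star (b.rho g)
  map_one' := by
    have : b.rho 1 = 1 := by
      ext η k
      simp [rho_apply]
    rw [hT.apply_one, this, star_one, one_mul]
  map_mul' g h := by
    symm
    calc T g * star (b.rho g) * (T h * star (b.rho h))
        = T g * (star (b.rho g) * T h) * star (b.rho h) := by noncomm_ring
      _ = (T g * T h) * star (b.rho h * b.rho g) := by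
          rw [← (commute_star_rho (hT.mem' h) g).eq, StarMul.star_mul]; noncomm_ring
      _ = T (g * h) * star (b.rho (g * h)) := by
          rw [mul hM hT, rho_mul_rho, star_smul, ← rootChar_neg, smul_mul_assoc, mul_smul_comm,
            smul_smul, ← rootChar_add, add_neg_cancel, rootChar_zero, one_smul]

theorem norm_rep_apply (hM : IsTracialFactor b.vonNeumann (Set.range b.rho) (delta 1))
    (hT : b.IsLimitConj y T) (g : G) (v : Ltwo G) : ‖rep hM hT g v‖ = ‖v‖ := by
  change ‖(T g * star (b.rho g)) v‖ = _
  rw [mul_apply_eq_comp, hT.norm_apply, norm_apply_of_star_mul_self]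
  rw [star_star, rho_mul_star_self]

theorem rep_apply_delta (hM : IsTracialFactor b.vonNeumann (Set.range b.rho) (delta 1))
    (hT : b.IsLimitConj y T) (g : G) {S : Ltwo G →L[ℂ] Ltwo G} (hS : S ∈ b.vonNeumann) :
    rep hM hT g (S (delta 1)) = (T g * S * star (b.lam g)) (delta 1) := by
  change (T g * star (b.rho g)) (S (delta 1)) = _
  rw [mul_apply_eq_comp, ← mul_apply_eq_comp (star _), ← (commute_star_rho hS g).eq,
    mul_apply_eq_comp, mul_apply_eq_comp, mul_apply_eq_comp, star_rho, star_lam,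
    _root_.smul_apply, _root_.smul_apply, rho_delta_one, lam_delta_one]

end IsLimitConj

/-- The distance of `x Ω` to its conjugate is the norm of a commutator. -/
theorem norm_conjRep_sub (hM : IsTracialFactor b.vonNeumann (Set.range b.rho) (delta 1))
    {x : Ltwo G →L[ℂ] Ltwo G} (hx : x ∈ b.vonNeumann) (g : G) :
    ‖b.conjRep g (x (delta 1)) - x (delta 1)‖ = ‖(b.lam g * x - x * b.lam g) (delta 1)‖ := by
  have hg : b.lam g ∈ b.vonNeumann := b.lam_mem g
  rw [← hM.norm_mul_unitary (x := b.lam g * x - x * b.lam g)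
    (sub_mem (mul_mem hg hx) (mul_mem hx hg)) (star_mem hg)
    (by rw [star_star, star_lam_mul_self]), ← mul_apply_eq_comp (_ - _), sub_mul, mul_assoc x,
    lam_mul_star_self, mul_one, _root_.sub_apply, conj_lam_apply b hx]

namespace IsLimitConj

variable {y : ℕ → Ltwo G →L[ℂ] Ltwo G} {T : G → Ltwo G →L[ℂ] Ltwo G}

theorem norm_conjRep_sub_eq (hM : IsTracialFactor b.vonNeumann (Set.range b.rho) (delta 1))
    (hT : b.IsLimitConj y T) (g : G) (k K : ℕ) :
    ‖b.conjRep g ((star (y k) * y K) (delta 1)) - (star (y k) * y K) (delta 1)‖ =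
      ‖(y k * b.lam g * star (y k)) (delta 1) - (y K * b.lam g * star (y K)) (delta 1)‖ := by
  rw [norm_conjRep_sub hM (mul_mem (star_mem (hT.mem k)) (hT.mem K)),
    ← norm_apply_of_star_mul_self (hT.star_mul k), ← mul_apply_eq_comp,
    ← _root_.sub_apply,
    ← hM.norm_mul_unitary (sub_mem (hT.conj_mem g k) (hT.conj_mem g K)) (hT.mem K) (hT.mul_star K),
    ← mul_apply_eq_comp]
  congr 2
  calc y k * (b.lam g * (star (y k) * y K) - star (y k) * y K * b.lam g)
      = y k * b.lam g * star (y k) * y K - y k * star (y k) * y K * b.lam g := by noncomm_ring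
    _ = y k * b.lam g * star (y k) * y K - y K * b.lam g * (star (y K) * y K) := by
      rw [hT.mul_star, hT.star_mul]; noncomm_ring
    _ = _ := by noncomm_ring

theorem norm_rep_sub_le (hM : IsTracialFactor b.vonNeumann (Set.range b.rho) (delta 1))
    (hT : b.IsLimitConj y T) (g : G) (K : ℕ) {ε : ℝ}
    (h : ∀ k ≥ K, ‖b.conjRep g ((star (y k) * y K) (delta 1)) -
      (star (y k) * y K) (delta 1)‖ ≤ ε) :
    ‖rep hM hT g (y K (delta 1)) - y K (delta 1)‖ ≤ ε := by
  rw [rep_apply_delta hM hT g (hT.mem K), mul_assoc, mul_apply_eq_comp]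
  refine le_of_tendsto ((hT.tendsto g _).sub_const _).norm ?_
  filter_upwards [eventually_ge_atTop K] with k hk
  refine le_trans (le_of_eq ?_) (h k hk)
  rw [← conj_lam_apply b (mul_mem (star_mem (hT.mem k)) (hT.mem K)),
    eq_comm, ← norm_apply_of_star_mul_self (hT.star_mul k) (_ - _), map_sub,
    ← mul_apply_eq_comp (y k), ← mul_apply_eq_comp (y k), ← mul_apply_eq_comp _ (y K * _),
    ← mul_assoc (y k) (star (y k)), hT.mul_star, one_mul]
  congr 3

end IsLimitConj

end Bichar

namespace BaseGroup

open Bichar Ltwo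

theorem norm_conjRep_sub_le {x : BaseGroup} (hx : x.2 = 1) (hx' : expo x = 0)
    (η : Ltwo BaseGroup) :
    ‖form.conjRep x η - η‖ ≤ 2 * ‖proj {g : BaseGroup | g.1 = 1}ᶜ η‖ := by
  have h1 : form.conjRep x (proj {g : BaseGroup | g.1 = 1} η) =
      proj {g : BaseGroup | g.1 = 1} η := by
    ext g
    rw [conjRep_apply]
    by_cases hg : g.1 = 1
    · rw [conj_eq_self hg]
      have ht : tors x = 0 := by rw [tors, hx]; exact map_zero _
      have hp : pc x = 0 := by rw [pc, hx]; rfl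
      have hq : qc x = 0 := by rw [qc, hx]; rfl
      have htot : tot x = 0 := by rw [tot, hq]; rfl
      have hc : form.comm x g = 0 := by
        rw [Bichar.comm, form_apply, form_apply, hx', expo_eq_zero hg, ht, htot, hp, hq]; simp
      rw [hc, rootChar_zero, one_mul]
    · have h : x⁻¹ * g * x ∉ {g : BaseGroup | g.1 = 1} := fun h => by
        refine hg ?_
        have h : x.1⁻¹ * g.1 * x.1 = 1 := h
        rwa [mul_assoc, inv_mul_eq_one, eq_comm, mul_eq_right] at h
      rw [proj_apply_of_notMem h, proj_apply_of_notMem (X := {g : BaseGroup | g.1 = 1}) hg, mul_zero]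
  have h2 : form.conjRep x η - η = form.conjRep x (proj {g : BaseGroup | g.1 = 1}ᶜ η) -
      proj {g : BaseGroup | g.1 = 1}ᶜ η := by
    conv_lhs => rw [← proj_add_proj_compl {g : BaseGroup | g.1 = 1} η, map_add, h1]
    abel
  rw [h2]
  refine (norm_sub_le _ _).trans_eq ?_
  rw [norm_conjRep_apply]; ring

/-- A vector almost fixed by the two free generators is almost fixed by the kernel of `expo`. -/
theorem norm_conjRep_sub_le_gap {x : BaseGroup} (hx : x.2 = 1) (hx' : expo x = 0)
    (η : Ltwo BaseGroup) :
    ‖form.conjRep x η - η‖ ≤ 28 * (‖form.conjRep (FreeGroup.of true, 1) η - η‖ +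
      ‖form.conjRep (FreeGroup.of false, 1) η - η‖) := by
  have h1 := norm_conjRep_sub_le hx hx' η
  have h2 := norm_proj_compl_le form (ca := 1) (cb := 1) (by simp) (by simp) η
  rw [one_smul] at h2
  linarith

variable {y : ℕ → Ltwo BaseGroup →L[ℂ] Ltwo BaseGroup}
  {T : BaseGroup → Ltwo BaseGroup →L[ℂ] Ltwo BaseGroup}

open IsLimitConj

theorem exists_near_fixed (hT : form.IsLimitConj y T)
    (hs : Tendsto (fun s => T s (delta 1) - form.lam s (delta 1)) smallFilter (𝓝 0)) :
    ∃ K n, ∀ l ∈ level n, ‖rep BaseGroup.isTracialFactor hT l (y K (delta 1)) - y K (delta 1)‖ ≤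
      1 / 2 := by
  have hM := BaseGroup.isTracialFactor
  have hcauchy (g : BaseGroup) : ∃ K, ∀ m ≥ K, ∀ n ≥ K,
      dist ((y m * form.lam g * star (y m)) (delta 1)) ((y n * form.lam g * star (y n)) (delta 1))
        < 1 / 224 :=
    Metric.cauchySeq_iff.1 (hT.tendsto g (delta 1)).cauchySeq _ (by norm_num)
  obtain ⟨K₁, hK₁⟩ := hcauchy (FreeGroup.of true, 1)
  obtain ⟨K₂, hK₂⟩ := hcauchy (FreeGroup.of false, 1)
  set K := max K₁ K₂
  have h1 (x : BaseGroup) (hx : x.2 = 1) (hx' : expo x = 0) :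
      ‖rep hM hT x (y K (delta 1)) - y K (delta 1)‖ ≤ 1 / 4 := by
    refine hT.norm_rep_sub_le hM x K fun k hk => (norm_conjRep_sub_le_gap hx hx' _).trans ?_
    rw [hT.norm_conjRep_sub_eq hM, hT.norm_conjRep_sub_eq hM, ← dist_eq_norm, ← dist_eq_norm]
    have e1 := hK₁ k ((le_max_left _ _).trans hk) K (le_max_left _ _)
    have e2 := hK₂ k ((le_max_right _ _).trans hk) K (le_max_right _ _)
    linarith
  have h2 : ∀ᶠ s in smallFilter, ‖rep hM hT s (y K (delta 1)) - y K (delta 1)‖ ≤ 1 / 4 := by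
    have e := hs.norm.add ((tendsto_conjRep (y K (delta 1))).sub_const (y K (delta 1))).norm
    rw [sub_self, norm_zero, add_zero] at e
    filter_upwards [e.eventually_le_const (by norm_num : (0 : ℝ) < 1 / 4)] with s hs
    refine le_trans ?_ hs
    have hl := form.lam_mem s
    have e1 : ‖rep hM hT s (y K (delta 1)) - form.conjRep s (y K (delta 1))‖ =
        ‖T s (delta 1) - form.lam s (delta 1)‖ := by
      rw [rep_apply_delta hM hT s (hT.mem K), ← conj_lam_apply form (hT.mem K),
        ← _root_.sub_apply, ← _root_.sub_apply,
        ← hM.norm_mul_unitary (x := T s - form.lam s) (sub_mem (hT.mem' s) hl)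
          (mul_mem (hT.mem K) (star_mem hl)), ← mul_apply_eq_comp]
      · congr 2
      · rw [StarMul.star_mul, star_star, mul_assoc, ← mul_assoc (star _) (form.lam s),
          star_lam_mul_self, one_mul, hT.mul_star]
    rw [← e1]
    exact norm_sub_le_norm_sub_add_norm_sub _ _ _
  obtain ⟨n, -, hn⟩ := hasBasis_smallFilter.eventually_iff.1 h2
  refine ⟨K, n, fun l hl => ?_⟩
  set x : BaseGroup := (l.1, 1)
  set s : BaseGroup := (1, l.2)
  have hls : l = x * s := by simp [x, s]
  have hx' : expo x = 0 := hl.1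
  have hsl : s ∈ level n := ⟨expo_eq_zero rfl, hl.2⟩
  have e1 := h1 x rfl hx'
  have e2 := hn ⟨rfl, hsl⟩
  rw [hls, map_mul, mul_apply_eq_comp]
  calc _ ≤ ‖rep hM hT x (rep hM hT s (y K (delta 1))) - rep hM hT x (y K (delta 1))‖ +
        ‖rep hM hT x (y K (delta 1)) - y K (delta 1)‖ := norm_sub_le_norm_sub_add_norm_sub _ _ _
    _ ≤ 1 / 4 + 1 / 4 := by
      rw [← map_sub, norm_rep_apply]; exact add_le_add e2 e1
    _ = _ := by norm_num

theorem exists_level_fixed (hT : form.IsLimitConj y T)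
    (hs : Tendsto (fun s => T s (delta 1) - form.lam s (delta 1)) smallFilter (𝓝 0)) :
    ∃ n, ∃ S ∈ form.vonNeumann, S (delta 1) ≠ 0 ∧
      ∀ l ∈ level n, rep BaseGroup.isTracialFactor hT l (S (delta 1)) = S (delta 1) := by
  have hM := BaseGroup.isTracialFactor
  obtain ⟨K, n, hn⟩ := exists_near_fixed hT hs
  refine ⟨n, ?_⟩
  let C : Set (Ltwo BaseGroup) := (fun S : Ltwo BaseGroup →L[ℂ] Ltwo BaseGroup => S (delta 1)) ''
    {S | S ∈ form.vonNeumann ∧ ‖S‖ ≤ 1}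
  have hCc : IsClosed C := by
    refine IsSeqClosed.isClosed fun u v hu huv => ?_
    choose S hS hSu using hu
    have hSu' : (fun n => S n (delta 1)) = u := funext hSu
    obtain ⟨R, hR, hR1, hlim⟩ := hM.exists_lim (fun n => (hS n).1) (fun n => (hS n).2)
      (hSu' ▸ huv.cauchySeq)
    exact ⟨R, ⟨hR, hR1⟩, tendsto_nhds_unique (hlim _) (hSu' ▸ huv)⟩
  have hCv : Convex ℝ C := by
    rintro _ ⟨R, ⟨hR, hR1⟩, rfl⟩ _ ⟨S, ⟨hS, hS1⟩, rfl⟩ a c ha hc hac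
    refine ⟨(a : ℂ) • R + (c : ℂ) • S, ⟨add_mem (form.vonNeumann.smul_mem hR _)
      (form.vonNeumann.smul_mem hS _), ?_⟩, ?_⟩
    · refine (norm_add_le _ _).trans ?_
      rw [norm_smul, norm_smul, Complex.norm_of_nonneg ha, Complex.norm_of_nonneg hc, ← hac]
      exact add_le_add (mul_le_of_le_one_right ha hR1) (mul_le_of_le_one_right hc hS1)
    · simp only [_root_.add_apply, Complex.coe_smul]; rfl
  let 𝒰 : Set (Ltwo BaseGroup →L[ℝ] Ltwo BaseGroup) :=
    (fun l => (rep hM hT l).restrictScalars ℝ) '' (level n : Set BaseGroup)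
  let _ : InnerProductSpace ℝ (Ltwo BaseGroup) := InnerProductSpace.rclikeToReal ℂ _
  have h1 : ∀ U ∈ 𝒰, ∀ w, ‖U w‖ = ‖w‖ := by
    rintro _ ⟨l, -, rfl⟩ w
    exact norm_rep_apply hM hT l w
  have h2 : ∀ U ∈ 𝒰, Set.MapsTo U
      ((fun l => rep hM hT l (y K (delta 1))) '' (level n : Set BaseGroup))
      ((fun l => rep hM hT l (y K (delta 1))) '' (level n : Set BaseGroup)) := by
    rintro _ ⟨l, hl, rfl⟩ _ ⟨m, hm, rfl⟩
    exact ⟨l * m, mul_mem hl hm, by simp⟩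
  have h3 : (fun l => rep hM hT l (y K (delta 1))) '' (level n : Set BaseGroup) ⊆
      C ∩ Metric.closedBall (y K (delta 1)) (1 / 2) := by
    rintro _ ⟨l, hl, rfl⟩
    refine ⟨⟨T l * y K * star (form.lam l), ⟨?_, ?_⟩,
      (rep_apply_delta hM hT l (hT.mem K)).symm⟩, ?_⟩
    · exact mul_mem (mul_mem (hT.mem' l) (hT.mem K)) (star_mem (form.lam_mem l))
    · refine norm_le_one_of_star_mul_self ?_
      refine (ContinuousLinearMap.norm_map_iff_adjoint_comp_self _).1 fun v => ?_
      rw [mul_apply_eq_comp, mul_apply_eq_comp, hT.norm_apply,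
        norm_apply_of_star_mul_self (hT.star_mul K), norm_apply_of_star_mul_self]
      rw [star_star, lam_mul_star_self]
    · rw [Metric.mem_closedBall, dist_eq_norm]
      exact hn l hl
  obtain ⟨ξ, ⟨⟨S, ⟨hS, -⟩, rfl⟩, hξ⟩, hfix⟩ := exists_fixed_point h1
    (Set.Nonempty.image _ ⟨1, one_mem (level n)⟩) h2
    (hCc.inter Metric.isClosed_closedBall) (hCv.inter (convex_closedBall _ _)) h3
  refine ⟨S, hS, fun h => ?_, fun l hl => hfix _ ⟨l, hl, rfl⟩⟩
  have hξ : S (delta 1) ∈ Metric.closedBall (y K (delta 1)) (1 / 2) := hξ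
  rw [h, Metric.mem_closedBall, dist_zero_left, norm_apply_of_star_mul_self (hT.star_mul K),
    norm_delta] at hξ
  norm_num at hξ

end BaseGroup

/-- A representation that factors, on an invariant subspace, through a finite abelian group of
exponent dividing `N` has a joint eigenvector there. -/
theorem exists_joint_eigenvector {H G : Type*} [NormedAddCommGroup H] [NormedSpace ℂ H] [Group G]
    {N : ℕ} [NeZero N] (π : G →* (H →L[ℂ] H)) {L : Subgroup G} {F : Submodule ℂ H}
    (hF : ∀ g, ∀ ξ ∈ F, π g ξ ∈ F) (hL : ∀ l ∈ L, ∀ ξ ∈ F, π l ξ = ξ)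
    (hcomm : ∀ g h : G, (h * g)⁻¹ * (g * h) ∈ L) (hN : ∀ g : G, g ^ N ∈ L) {s : Finset G}
    (hs : ∀ g, ∃ r ∈ s, r⁻¹ * g ∈ L) {ξ₀ : H} (hξ₀ : ξ₀ ∈ F) (h0 : ξ₀ ≠ 0) :
    ∃ ξ ∈ F, ξ ≠ 0 ∧ ∃ χ : G → ZMod N, (∀ g, π g ξ = rootChar (χ g) • ξ) ∧
      (∀ g h, χ (g * h) = χ g + χ h) ∧ ∀ l ∈ L, χ l = 0 := by
  classical
  have hcoset {g h : G} (hgh : h⁻¹ * g ∈ L) {ξ : H} (hξ : ξ ∈ F) : π g ξ = π h ξ := by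
    rw [← mul_inv_cancel_left h g, map_mul, mul_apply_eq_comp, hL _ hgh ξ hξ]
  have key : ∀ t : Finset G, ∃ ξ ∈ F, ξ ≠ 0 ∧ ∀ r ∈ t, ∃ j : ZMod N, π r ξ = rootChar j • ξ := by
    intro t
    induction t using Finset.induction_on with
    | empty => exact ⟨ξ₀, hξ₀, h0, by simp⟩
    | insert g t _ ih =>
      obtain ⟨ξ, hξ, hne, ht⟩ := ih
      let f (i : ZMod N) : H := π (g ^ i.val) ξ
      have hf (i : ZMod N) : π g (f i) = f (i + 1) := by
        rw [← mul_apply_eq_comp, ← map_mul, ← pow_succ']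
        refine hcoset ?_ hξ
        have e : (i + 1).val = (i.val + 1) % N := by
          rw [← ZMod.val_natCast, Nat.cast_add, ZMod.natCast_rightInverse, Nat.cast_one]
        have e' : g ^ (i.val + 1) = g ^ (i + 1).val * (g ^ N) ^ ((i.val + 1) / N) := by
          rw [e, ← pow_mul, ← pow_add, Nat.mod_add_div]
        rw [e', inv_mul_cancel_left]
        exact pow_mem (hN g) _
      have hfF (i : ZMod N) : f i ∈ F := hF _ _ hξ
      have hf0 : f 0 = ξ := by simp [f]
      let η (j : ZMod N) : H := ∑ i : ZMod N, rootChar (-i * j) • f i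
      have hsum : ∑ j, η j = (N : ℂ) • ξ := by
        simp only [η]
        rw [Finset.sum_comm]
        simp only [← Finset.sum_smul, sum_rootChar_mul, neg_eq_zero]
        simp [ite_smul, hf0]
      obtain ⟨j, hj⟩ : ∃ j, η j ≠ 0 := by
        by_contra! h
        rw [Finset.sum_eq_zero fun j _ => h j, eq_comm, smul_eq_zero] at hsum
        exact hsum.elim (by simpa using NeZero.ne N) hne
      refine ⟨η j, F.sum_mem fun i _ => F.smul_mem _ (hfF i), hj, fun r hr => ?_⟩
      rcases Finset.mem_insert.1 hr with rfl | hr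
      · refine ⟨j, ?_⟩
        simp only [η, map_sum, map_smul, hf, Finset.smul_sum, smul_smul, ← rootChar_add]
        refine Fintype.sum_equiv (Equiv.addRight 1) _ _ fun i => ?_
        rw [Equiv.coe_addRight]
        congr 2
        ring
      · obtain ⟨k, hk⟩ := ht r hr
        refine ⟨k, ?_⟩
        simp only [η, map_sum, map_smul, Finset.smul_sum]
        refine Finset.sum_congr rfl fun i _ => ?_
        rw [smul_comm]
        congr 1
        rw [← mul_apply_eq_comp, ← map_mul, hcoset (hcomm _ _) hξ, map_mul, mul_apply_eq_comp, hk,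
          map_smul]
  obtain ⟨ξ, hξ, hne, ht⟩ := key s
  have (g : G) : ∃ j : ZMod N, π g ξ = rootChar j • ξ := by
    obtain ⟨r, hr, hrg⟩ := hs g
    rw [hcoset hrg hξ]
    exact ht r hr
  choose χ hχ using this
  refine ⟨ξ, hξ, hne, χ, hχ, fun g h => rootChar_injective (smul_left_injective ℂ hne ?_),
    fun l hl => rootChar_injective (smul_left_injective ℂ hne ?_)⟩
  · change rootChar _ • ξ = rootChar _ • ξ
    rw [← hχ, map_mul, mul_apply_eq_comp, hχ h, map_smul, hχ g, smul_smul, rootChar_add, mul_comm]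
  · change rootChar _ • ξ = rootChar _ • ξ
    rw [← hχ, hL l hl ξ hξ, rootChar_zero, one_smul]

namespace BaseGroup

open Bichar Ltwo IsLimitConj

variable {y : ℕ → Ltwo BaseGroup →L[ℂ] Ltwo BaseGroup}
  {T : BaseGroup → Ltwo BaseGroup →L[ℂ] Ltwo BaseGroup}

/-- The limit representation is, up to a character of finite level, unitarily equivalent to the
left regular representation. -/
theorem exists_intertwiner (hT : form.IsLimitConj y T)
    (hs : Tendsto (fun s => T s (delta 1) - form.lam s (delta 1)) smallFilter (𝓝 0)) :
    ∃ n, ∃ χ : BaseGroup → ZMod 9, (∀ g h, χ (g * h) = χ g + χ h) ∧ (∀ l ∈ level n, χ l = 0) ∧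
      ∃ W ∈ form.vonNeumann, star W * W = 1 ∧ W * star W = 1 ∧
        ∀ g, T g * W = rootChar (χ g) • (W * form.lam g) := by
  have hM := BaseGroup.isTracialFactor
  obtain ⟨n, S₀, hS₀, hne₀, hfix⟩ := exists_level_fixed hT hs
  let F : Submodule ℂ (Ltwo BaseGroup) :=
    { carrier := {ξ | (∃ S ∈ form.vonNeumann, S (delta 1) = ξ) ∧
        ∀ l ∈ level n, rep hM hT l ξ = ξ}
      zero_mem' := ⟨⟨0, zero_mem _, rfl⟩, fun _ _ => map_zero _⟩
      add_mem' := by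
        rintro _ _ ⟨⟨S, hS, rfl⟩, h⟩ ⟨⟨S', hS', rfl⟩, h'⟩
        exact ⟨⟨S + S', add_mem hS hS', rfl⟩, fun l hl => by rw [map_add, h l hl, h' l hl]⟩
      smul_mem' := by
        rintro c _ ⟨⟨S, hS, rfl⟩, h⟩
        exact ⟨⟨c • S, form.vonNeumann.smul_mem hS c, rfl⟩, fun l hl => by rw [map_smul, h l hl]⟩ }
  have hF (g : BaseGroup) : ∀ ξ ∈ F, rep hM hT g ξ ∈ F := by
    rintro _ ⟨⟨S, hS, rfl⟩, h⟩
    refine ⟨⟨_, mul_mem (mul_mem (hT.mem' g) hS) (star_mem (form.lam_mem g)),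
      (rep_apply_delta hM hT g hS).symm⟩, fun l hl => ?_⟩
    have e : l * g = g * l * ((g * l)⁻¹ * (l * g)) := by group
    rw [← mul_apply_eq_comp, ← map_mul, e, map_mul, mul_apply_eq_comp,
      h _ (commutator_mem_level n l g), map_mul, mul_apply_eq_comp, h l hl]
  obtain ⟨ξ, ⟨⟨S, hS, rfl⟩, -⟩, hne, χ, hχ, hadd, hzero⟩ := exists_joint_eigenvector
    (rep hM hT) (L := level n) (F := F) (N := 9) hF (fun l hl ξ hξ => hξ.2 l hl)
    (commutator_mem_level n) (pow_mem_level n) (exists_finset_level n).choose_spec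
    ⟨⟨S₀, hS₀, rfl⟩, hfix⟩ hne₀
  have hTS (g : BaseGroup) : T g * S = rootChar (χ g) • (S * form.lam g) := by
    have h1 : T g * S * star (form.lam g) = rootChar (χ g) • S := by
      refine hM.ext (mul_mem (mul_mem (hT.mem' g) hS) (star_mem (form.lam_mem g)))
        (form.vonNeumann.smul_mem hS _) ?_
      rw [← rep_apply_delta hM hT g hS, hχ]; rfl
    rw [← smul_mul_assoc, ← h1, mul_assoc, star_lam_mul_self, mul_one]
  have hSS : star S * S ∈ form.vonNeumann := mul_mem (star_mem hS) hS
  have hfixS (g : BaseGroup) : form.conjRep g ((star S * S) (delta 1)) =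
      (star S * S) (delta 1) := by
    rw [← conj_lam_apply form hSS]
    congr 1
    have h1 : star (S * form.lam g) * (S * form.lam g) = star S * S := by
      have e : S * form.lam g = rootChar (-χ g) • (T g * S) := by
        rw [hTS, smul_smul, ← rootChar_add, neg_add_cancel, rootChar_zero, one_smul]
      rw [e, star_smul, ← rootChar_neg, smul_mul_smul_comm, ← rootChar_add, neg_add_cancel,
        rootChar_zero, one_smul, StarMul.star_mul, mul_assoc, ← mul_assoc (star (T g)),
        hT.star_mul_self, one_mul]
    nth_rewrite 1 [← h1]
    calc form.lam g * (star (S * form.lam g) * (S * form.lam g)) * star (form.lam g)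
        = (form.lam g * star (form.lam g)) * (star S * S) *
          (form.lam g * star (form.lam g)) := by rw [StarMul.star_mul]; noncomm_ring
      _ = star S * S := by rw [lam_mul_star_self, one_mul, mul_one]
  obtain ⟨c, hc⟩ : ∃ c : ℂ, (star S * S) (delta 1) = c • delta 1 :=
    ⟨_, eq_smul_delta_of_conjRep hfixS⟩
  have hSc : star S * S = c • 1 := hM.ext hSS (form.vonNeumann.smul_mem (one_mem _) _) hc
  have hr : (‖S (delta 1)‖ : ℂ) ≠ 0 := by simpa using hne
  have hc' : c = (‖S (delta 1)‖ : ℂ) ^ 2 := by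
    have := IsTracialFactor.inner_apply S S (delta 1) (delta 1)
    rw [hc, inner_smul_right, inner_self_eq_norm_sq_to_K, inner_self_eq_norm_sq_to_K,
      norm_delta] at this
    simpa using this.symm
  have hW : star ((‖S (delta 1)‖ : ℂ)⁻¹ • S) * ((‖S (delta 1)‖ : ℂ)⁻¹ • S) = 1 := by
    rw [star_smul, smul_mul_smul_comm, hSc, hc', smul_smul]
    simp only [star_inv₀, RCLike.star_def, Complex.conj_ofReal]
    field_simp
    exact one_smul _ _
  have hWM : (‖S (delta 1)‖ : ℂ)⁻¹ • S ∈ form.vonNeumann := form.vonNeumann.smul_mem hS _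
  refine ⟨n, χ, hadd, hzero, _, hWM, hW, hM.mul_star_eq_one hWM hW, fun g => ?_⟩
  rw [mul_smul_comm, hTS, smul_mul_assoc, smul_comm]

end BaseGroup

theorem exists_rootChar_gap (N : ℕ) [NeZero N] :
    ∃ δ > 0, ∀ i j : ZMod N, i ≠ j → δ ≤ ‖rootChar i - rootChar j‖ := by
  have hfin : ∀ p : ZMod N × ZMod N, ∃ δ > 0, p.1 ≠ p.2 → δ ≤ ‖rootChar p.1 - rootChar p.2‖ := by
    rintro ⟨i, j⟩
    by_cases h : i = j
    · exact ⟨1, one_pos, fun h' => absurd h h'⟩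
    · exact ⟨_, norm_pos_iff.2 (sub_ne_zero.2 fun h' => h (rootChar_injective h')), fun _ => le_rfl⟩
  choose δ hδ hle using hfin
  obtain ⟨p, hp⟩ := Finite.exists_min δ
  exact ⟨δ p, hδ p, fun i j h => (hp (i, j)).trans (hle (i, j) h)⟩

namespace Ltwo

variable {α : Type*}

theorem norm_proj_le_of_forall {X : Set α} {η ζ : Ltwo α} {C : ℝ} (hC : 0 ≤ C)
    (h : ∀ x ∈ X, ‖η x‖ ≤ C * ‖ζ x‖) : ‖proj X η‖ ≤ C * ‖ζ‖ := by
  refine le_of_sq_le_sq ?_ (by positivity)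
  rw [mul_pow]
  refine hasSum_le (fun x => ?_) (hasSum_norm_sq _) ((hasSum_norm_sq ζ).mul_left (C ^ 2))
  rw [← mul_pow]
  by_cases hx : x ∈ X
  · rw [proj_apply_of_mem hx]
    gcongr
    exact h x hx
  · rw [proj_apply_of_notMem hx, norm_zero, sq, mul_zero]
    positivity

/-- The mass of the sequence `η` on `X` tends to zero. -/
def Negligible (η : ℕ → Ltwo α) (X : Set α) : Prop :=
  Tendsto (fun k => ‖proj X (η k)‖) atTop (𝓝 0)

namespace Negligible

variable {η : ℕ → Ltwo α} {X Y : Set α}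

theorem of_le (f : ℕ → ℝ) (hf : Tendsto f atTop (𝓝 0)) (h : ∀ k, ‖proj X (η k)‖ ≤ f k) :
    Negligible η X :=
  squeeze_zero (fun _ => norm_nonneg _) h hf

theorem union (hX : Negligible η X) (hY : Negligible η Y) : Negligible η (X ∪ Y) := by
  refine of_le _ (by simpa using hX.add hY) fun k => ?_
  refine le_of_sq_le_sq ((norm_proj_union_sq_le X Y _).trans ?_) (by positivity)
  nlinarith [mul_nonneg (norm_nonneg (proj X (η k))) (norm_nonneg (proj Y (η k)))]

theorem biUnion {ι : Type*} (s : Finset ι) {X : ι → Set α} (h : ∀ i ∈ s, Negligible η (X i)) :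
    Negligible η (⋃ i ∈ s, X i) := by
  classical
  induction s using Finset.induction_on with
  | empty =>
    have (k : ℕ) : proj (∅ : Set α) (η k) = 0 := by
      ext x
      rw [proj_apply_of_notMem (Set.notMem_empty x)]; rfl
    simp [Negligible, this]
  | insert i s _ ih =>
    rw [Finset.set_biUnion_insert]
    exact (h i (Finset.mem_insert_self _ _)).union
      (ih fun j hj => h j (Finset.mem_insert_of_mem hj))

theorem exists_notMem (hX : Negligible η X) (h1 : ∀ k, ‖η k‖ = 1) : ∃ x, x ∉ X := by
  by_contra! h
  have (k : ℕ) : proj X (η k) = η k := by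
    ext x
    rw [proj_apply_of_mem (h x)]
  simp [Negligible, this, h1] at hX

theorem of_rootChar {N : ℕ} [NeZero N] {ζ : ℕ → Ltwo α} (f : α → ZMod N) (j : ZMod N)
    (hζ : ∀ k, ∀ x ∈ X, ζ k x = rootChar (f x) * η k x) (hf : ∀ x ∈ X, f x ≠ j)
    (h : Tendsto (fun k => ‖ζ k - rootChar j • η k‖) atTop (𝓝 0)) : Negligible η X := by
  obtain ⟨δ, hδ, hgap⟩ := exists_rootChar_gap N
  refine of_le _ (by simpa using h.const_mul δ⁻¹) fun k => ?_
  refine norm_proj_le_of_forall (by positivity) fun x hx => ?_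
  rw [lp.coeFn_sub, Pi.sub_apply, lp.coeFn_smul, Pi.smul_apply, smul_eq_mul, hζ k x hx, ← sub_mul,
    norm_mul, ← mul_assoc]
  refine le_mul_of_one_le_left (norm_nonneg _) ?_
  rw [inv_mul_eq_div, one_le_div hδ]
  exact hgap _ _ (hf x hx)

end Negligible

end Ltwo

namespace BaseGroup

open Bichar Ltwo

/-- Approximate eigenvectors of the conjugation representation and of a diagonal operator produce
the arithmetic obstruction. -/
theorem false_of_approximate {n : ℕ} {χ : BaseGroup → ZMod 9}
    (hχ : ∀ g h, χ (g * h) = χ g + χ h) (hL : ∀ g ∈ level n, χ g = 0)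
    {η ζ : ℕ → Ltwo BaseGroup} (h1 : ∀ k, ‖η k‖ = 1)
    (hK : ∀ g, Tendsto (fun k => ‖form.conjRep g (η k) - rootChar (-χ g) • η k‖) atTop (𝓝 0))
    (hζ : ∀ k x, ζ k x = rootChar (χ x) * η k x)
    (hD : Tendsto (fun k => ‖ζ k - rootChar (1 : ZMod 9) • η k‖) atTop (𝓝 0)) : False := by
  classical
  let s : Finset BaseGroup := {vGen} ∪ (Finset.range n).image pGen ∪ (Finset.range n).image qGen
  have hV : Negligible η {g : BaseGroup | g.1 = 1}ᶜ :=
    .of_le _ (by simpa using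
      ((hK (FreeGroup.of true, 1)).add (hK (FreeGroup.of false, 1))).const_mul 14)
      fun k => norm_proj_compl_le form (norm_rootChar _) (norm_rootChar _) (η k)
  have hχ1 : Negligible η {g | χ g ≠ 1} := .of_rootChar χ 1 (fun k x _ => hζ k x) (fun _ h => h) hD
  have hs (g : BaseGroup) (hg : g.1 = 1) : Negligible η {u | form.comm g u ≠ -χ g} := by
    refine .of_rootChar (form.comm g) _ (fun k u _ => ?_) (fun _ h => h) (hK g)
    rw [conjRep_apply, conj_eq_self' hg]
  have hfst : ∀ g ∈ s, g.1 = 1 := by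
    intro g hg
    simp only [s, Finset.mem_union, Finset.mem_singleton, Finset.mem_image] at hg
    rcases hg with (rfl | ⟨i, -, rfl⟩) | ⟨i, -, rfl⟩ <;> rfl
  obtain ⟨u, hu⟩ := ((hV.union hχ1).union (.biUnion s fun g hg => hs g (hfst g hg))).exists_notMem h1
  simp only [Set.mem_union, Set.mem_iUnion, not_or, not_exists] at hu
  obtain ⟨⟨hu1, hu2⟩, hu3⟩ := hu
  have hcomm (g : BaseGroup) (hg : g ∈ s) : form.comm u g = χ g := by
    rw [comm_swap, not_not.1 (hu3 g hg), neg_neg]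
  refine false_of_character hχ hL (u := u) (not_not.1 hu1) (not_not.1 hu2) (hcomm _ ?_)
    (fun i hi => hcomm _ ?_) fun i hi => hcomm _ ?_
  · simp [s]
  · exact Finset.mem_union_left _ (Finset.mem_union_right _
      (Finset.mem_image_of_mem _ (Finset.mem_range.2 hi)))
  · exact Finset.mem_union_right _ (Finset.mem_image_of_mem _ (Finset.mem_range.2 hi))

end BaseGroup

namespace Bichar

open Ltwo

variable {G : Type*} [Group G] {N : ℕ} [NeZero N] {b : Bichar G N}

/-- If conjugation by the unitaries `r k` tends to the diagonal automorphism with coefficients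
`χ` on the generators, then it does so on all of the von Neumann algebra. -/
theorem tendsto_conj_diagonal (hM : IsTracialFactor b.vonNeumann (Set.range b.rho) (delta 1))
    {r : ℕ → Ltwo G →L[ℂ] Ltwo G} (hr : ∀ k, r k ∈ b.vonNeumann) (hr1 : ∀ k, star (r k) * r k = 1)
    {D : Ltwo G →L[ℂ] Ltwo G} (hD : ‖D‖ ≤ 1)
    (h : ∀ g, Tendsto (fun k => (r k * b.lam g * star (r k)) (delta 1)) atTop (𝓝 (D (delta g))))
    {x : Ltwo G →L[ℂ] Ltwo G} (hx : x ∈ b.vonNeumann) :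
    Tendsto (fun k => (r k * x * star (r k)) (delta 1)) atTop (𝓝 (D (x (delta 1)))) := by
  have hiso (k : ℕ) {x : Ltwo G →L[ℂ] Ltwo G} (hx : x ∈ b.vonNeumann) :
      ‖(r k * x * star (r k)) (delta 1)‖ = ‖x (delta 1)‖ := by
    rw [mul_apply_eq_comp, hM.norm_mul_unitary (mul_mem (hr k) hx) (star_mem (hr k))
      (by rw [star_star, hr1]), mul_apply_eq_comp, norm_apply_of_star_mul_self (hr1 k)]
  have hspan : ∀ p ∈ Submodule.span ℂ (Set.range (delta : G → Ltwo G)), ∃ P ∈ b.vonNeumann,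
      P (delta 1) = p ∧ Tendsto (fun k => (r k * P * star (r k)) (delta 1)) atTop (𝓝 (D p)) := by
    intro p hp
    induction hp using Submodule.span_induction with
    | mem p hp =>
      obtain ⟨g, rfl⟩ := hp
      exact ⟨b.lam g, b.lam_mem g, b.lam_delta_one g, h g⟩
    | zero => exact ⟨0, zero_mem _, rfl, by simp⟩
    | add p q _ _ ihp ihq =>
      obtain ⟨P, hP, rfl, hP'⟩ := ihp
      obtain ⟨Q, hQ, rfl, hQ'⟩ := ihq
      refine ⟨P + Q, add_mem hP hQ, rfl, ?_⟩
      rw [map_add]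
      refine (hP'.add hQ').congr fun k => ?_
      rw [← _root_.add_apply, mul_add, add_mul]
    | smul c p _ ihp =>
      obtain ⟨P, hP, rfl, hP'⟩ := ihp
      refine ⟨c • P, b.vonNeumann.smul_mem hP c, rfl, ?_⟩
      rw [map_smul]
      refine (hP'.const_smul c).congr fun k => ?_
      rw [← _root_.smul_apply, mul_smul_comm, smul_mul_assoc]
  rw [Metric.tendsto_atTop]
  intro ε hε
  obtain ⟨p, hp, hxp⟩ := Metric.mem_closure_iff.1 (dense_span_delta (x (delta 1))) (ε / 3)
    (by positivity)
  obtain ⟨P, hP, rfl, hlim⟩ := hspan p hp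
  obtain ⟨n, hn⟩ := Metric.tendsto_atTop.1 hlim (ε / 3) (by positivity)
  refine ⟨n, fun k hk => ?_⟩
  have e1 : dist ((r k * x * star (r k)) (delta 1)) ((r k * P * star (r k)) (delta 1)) < ε / 3 := by
    rw [dist_eq_norm, ← _root_.sub_apply, ← sub_mul, ← mul_sub, hiso k (sub_mem hx hP),
      _root_.sub_apply, ← dist_eq_norm]
    exact hxp
  have e2 : dist (D (P (delta 1))) (D (x (delta 1))) < ε / 3 := by
    rw [dist_comm, dist_eq_norm, ← map_sub]
    refine (D.le_of_opNorm_le hD _).trans_lt ?_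
    rwa [one_mul, ← dist_eq_norm]
  calc _ ≤ _ := dist_triangle4 _ ((r k * P * star (r k)) (delta 1)) (D (P (delta 1))) _
    _ < ε / 3 + ε / 3 + ε / 3 := by
      gcongr
      exact hn k hk
    _ = ε := by ring

theorem norm_conjRep_sub_smul (hM : IsTracialFactor b.vonNeumann (Set.range b.rho) (delta 1))
    {r : Ltwo G →L[ℂ] Ltwo G} (hr : r ∈ b.vonNeumann) (hr1 : star r * r = 1)
    (hr2 : r * star r = 1) (g : G) (i : ZMod N) :
    ‖b.conjRep g (r (delta 1)) - rootChar (-i) • r (delta 1)‖ =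
      ‖(r * b.lam g * star r) (delta 1) - rootChar i • delta g‖ := by
  have hg := b.lam_mem g
  have e1 : b.conjRep g (r (delta 1)) - rootChar (-i) • r (delta 1) =
      ((b.lam g - rootChar (-i) • (r * b.lam g * star r)) * (r * star (b.lam g))) (delta 1) := by
    rw [← conj_lam_apply b hr, sub_mul, _root_.sub_apply, mul_assoc, smul_mul_assoc]
    have : r * b.lam g * star r * (r * star (b.lam g)) = r := by
      calc _ = r * b.lam g * (star r * r) * star (b.lam g) := by noncomm_ring
        _ = _ := by rw [hr1, mul_one, mul_assoc, lam_mul_star_self, mul_one]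
    rw [this]; rfl
  rw [e1, mul_apply_eq_comp, hM.norm_mul_unitary (sub_mem hg (b.vonNeumann.smul_mem
    (mul_mem (mul_mem hr hg) (star_mem hr)) _)) (mul_mem hr (star_mem hg))]
  · have e2 : (b.lam g - rootChar (-i) • (r * b.lam g * star r)) (delta 1) =
        -(rootChar (-i) • ((r * b.lam g * star r) (delta 1) - rootChar i • delta g)) := by
      rw [_root_.sub_apply, _root_.smul_apply, lam_delta_one, smul_sub, smul_smul, ← rootChar_add,
        neg_add_cancel, rootChar_zero, one_smul, neg_sub]
    rw [e2, norm_neg, norm_smul, norm_rootChar, one_mul]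
  · rw [star_mul, star_star, mul_assoc, ← mul_assoc (star _) (b.lam g), star_lam_mul_self, one_mul,
      hr2]

end Bichar

namespace BaseGroup

open Bichar Ltwo IsLimitConj

variable {y : ℕ → Ltwo BaseGroup →L[ℂ] Ltwo BaseGroup}
  {T : BaseGroup → Ltwo BaseGroup →L[ℂ] Ltwo BaseGroup}

/-- There are no unitaries whose conjugations converge, with almost trivial limit on the small
elements, and which satisfy the commutation relation with the root of unity of order `9`. -/
theorem false_of_isLimitConj (hT : form.IsLimitConj y T)
    (hs : Tendsto (fun s => T s (delta 1) - form.lam s (delta 1)) smallFilter (𝓝 0))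
    (hy : ∀ m k, k < m → y m * y k = rootChar (1 : ZMod 9) • (y k * y m)) : False := by
  have hM := BaseGroup.isTracialFactor
  obtain ⟨n, χ, hadd, hzero, W, hW, hW1, hW2, hTW⟩ := exists_intertwiner hT hs
  let D : Ltwo BaseGroup →L[ℂ] Ltwo BaseGroup :=
    wperm (Equiv.refl _) (fun g => rootChar (χ g)) fun _ => (norm_rootChar _).le
  have hD1 : ‖D‖ ≤ 1 := ContinuousLinearMap.opNorm_le_bound _ zero_le_one fun η => by
    rw [one_mul]; exact norm_wperm_apply_le _ _ _
  let r (k : ℕ) : Ltwo BaseGroup →L[ℂ] Ltwo BaseGroup := star W * y k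
  have hr (k : ℕ) : r k ∈ form.vonNeumann := mul_mem (star_mem hW) (hT.mem k)
  have hr1 (k : ℕ) : star (r k) * r k = 1 := by
    calc star (r k) * r k = star (y k) * (W * star W) * y k := by
          simp only [r, StarMul.star_mul, star_star]; noncomm_ring
      _ = 1 := by rw [hW2, mul_one, hT.star_mul]
  have hr2 (k : ℕ) : r k * star (r k) = 1 := by
    calc r k * star (r k) = star W * (y k * star (y k)) * W := by
          simp only [r, StarMul.star_mul, star_star]; noncomm_ring
      _ = 1 := by rw [hT.mul_star, mul_one, hW1]
  have hlim (g : BaseGroup) : Tendsto (fun k => (r k * form.lam g * star (r k)) (delta 1)) atTop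
      (𝓝 (D (delta g))) := by
    have e := ((star W).continuous.tendsto _).comp (hT.tendsto g (W (delta 1)))
    have hDg : D (delta g) = star W (T g (W (delta 1))) := by
      rw [← mul_apply_eq_comp (T g), hTW, ← mul_apply_eq_comp, mul_smul_comm, ← mul_assoc, hW1,
        one_mul, _root_.smul_apply, lam_delta_one]
      exact wperm_delta _ _ _
    rw [hDg]
    refine e.congr fun k => ?_
    simp only [Function.comp_apply, ← mul_apply_eq_comp, r, StarMul.star_mul, star_star]
    congr 1
  have hconj {x : Ltwo BaseGroup →L[ℂ] Ltwo BaseGroup} (hx : x ∈ form.vonNeumann) :=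
    tendsto_conj_diagonal hM hr hr1 hD1 hlim hx
  have hrW (k : ℕ) : rootChar (1 : ZMod 9) • r k (W (delta 1)) = D (W (r k (delta 1))) := by
    rw [← mul_apply_eq_comp W]
    refine tendsto_nhds_unique (tendsto_const_nhds.congr' ?_) (hconj (mul_mem hW (hr k)))
    filter_upwards [eventually_gt_atTop k] with m hm
    have e : r m * (W * r k) * star (r m) = rootChar (1 : ZMod 9) • (r k * W) := by
      calc r m * (W * r k) * star (r m)
          = star W * y m * (W * star W) * y k * star (r m) := by simp only [r]; noncomm_ring
        _ = star W * (y m * y k) * star (r m) := by rw [hW2]; noncomm_ring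
        _ = rootChar (1 : ZMod 9) • (star W * y k * y m * star (r m)) := by
          rw [hy m k hm, mul_smul_comm, smul_mul_assoc]
          simp only [mul_assoc]
        _ = rootChar (1 : ZMod 9) • (star W * y k * (W * star W) * y m * star (r m)) := by
          rw [hW2, mul_one]
        _ = rootChar (1 : ZMod 9) • (r k * W * (r m * star (r m))) := by
          simp only [r, mul_assoc]
        _ = _ := by rw [hr2, mul_one]
    rw [e]; rfl
  have hnorm (k : ℕ) (v : Ltwo BaseGroup) : ‖(r k * W * star (r k)) v‖ = ‖v‖ := by
    rw [mul_apply_eq_comp, mul_apply_eq_comp, norm_apply_of_star_mul_self (hr1 k),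
      norm_apply_of_star_mul_self hW1, norm_apply_of_star_mul_self (by rw [star_star, hr2])]
  have hmem (k : ℕ) : r k * W * star (r k) ∈ form.vonNeumann :=
    mul_mem (mul_mem (hr k) hW) (star_mem (hr k))
  have hnorm1 (k : ℕ) : ‖r k * W * star (r k)‖ ≤ 1 :=
    ContinuousLinearMap.opNorm_le_bound _ zero_le_one fun v => by rw [hnorm, one_mul]
  obtain ⟨S, hS, -, hSlim⟩ := hM.exists_lim hmem hnorm1 (hconj hW).cauchySeq
  have hSnorm (v : Ltwo BaseGroup) : ‖S v‖ = ‖v‖ :=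
    tendsto_nhds_unique (hSlim v).norm (by simp only [hnorm, tendsto_const_nhds])
  have hSD (k : ℕ) : D (W (r k (delta 1))) = S (D (r k (delta 1))) := by
    rw [← mul_apply_eq_comp W]
    refine tendsto_nhds_unique (hconj (mul_mem hW (hr k))) ?_
    have e1 := hconj (hr k)
    have e2 := (hSlim (D (r k (delta 1)))).add (squeeze_zero_norm (fun m => ?_)
      (tendsto_iff_norm_sub_tendsto_zero.1 e1) : Tendsto (fun m => (r m * W * star (r m))
        ((r m * r k * star (r m)) (delta 1) - D (r k (delta 1)))) atTop (𝓝 0))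
    · rw [add_zero] at e2
      refine e2.congr fun m => ?_
      rw [← map_add, add_sub_cancel, ← mul_apply_eq_comp]
      congr 1
      calc r m * W * star (r m) * (r m * r k * star (r m))
          = r m * W * (star (r m) * r m) * r k * star (r m) := by noncomm_ring
        _ = _ := by rw [hr1]; noncomm_ring
    · rw [hnorm]
  refine false_of_approximate hadd hzero (η := fun k => r k (delta 1))
    (ζ := fun k => D (r k (delta 1))) (fun k => ?_) (fun g => ?_) (fun k x => rfl) ?_
  · rw [norm_apply_of_star_mul_self (hr1 k), norm_delta]
  · have e := tendsto_iff_norm_sub_tendsto_zero.1 (hlim g)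
    refine e.congr fun k => ?_
    rw [norm_conjRep_sub_smul hM (hr k) (hr1 k) (hr2 k)]
    congr 2
    exact wperm_delta _ _ _
  · have e := tendsto_iff_norm_sub_tendsto_zero.1 (hSlim (delta 1))
    refine e.congr fun k => ?_
    rw [eq_comm, ← hSnorm (_ - _), map_sub, map_smul, ← hSD, ← hrW, ← smul_sub, norm_smul, norm_rootChar,
      one_mul, ← _root_.sub_apply, ← hM.norm_mul_unitary (sub_mem (hmem k) hS) (hr k) (hr2 k),
      ← mul_apply_eq_comp, ← mul_apply_eq_comp, ← mul_apply_eq_comp, ← _root_.sub_apply, sub_mul,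
      mul_assoc _ (star (r k)), hr1, mul_one]

/-- The elements whose conjugations converge to a diagonal automorphism. -/
noncomputable def stair (k : ℕ) : BaseGroup :=
  (1, Multiplicative.ofAdd (0, ∑ i ∈ Finset.range k, Finsupp.single i 1, -Finsupp.single k 1))

/-- The limit of the characters `form.comm (stair k)`. -/
def stairChar (g : BaseGroup) : ZMod 9 := tot g + tors g + expo g

theorem tot_stair (k : ℕ) : tot (stair k) = -1 := by
  rw [eq_neg_iff_add_eq_zero, ← tot_qGen k, ← tot_mul]
  have : qc (stair k * qGen k) = 0 := by
    rw [qc_mul, qc_qGen]; exact neg_add_cancel _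
  rw [tot, this]; rfl

theorem pairing_stair (k : ℕ) (q : ℕ →₀ ZMod 9) :
    pairing (pc (stair k)) q = ∑ i ∈ Finset.range k, q i := by
  change pairing (∑ i ∈ Finset.range k, Finsupp.single i 1) q = _
  induction k with
  | zero => simp
  | succ k ih => rw [Finset.sum_range_succ, pairing_add_left, ih, pairing_single_left, one_mul,
      Finset.sum_range_succ]

theorem pairing_stair_right (k : ℕ) (p : ℕ →₀ ZMod 9) : pairing p (qc (stair k)) = -p k := by
  rw [eq_neg_iff_add_eq_zero]
  have h := pairing_single_right k (1 : ZMod 9) p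
  rw [mul_one] at h
  rw [← h, ← pairing_add_right]
  have : qc (stair k) + Finsupp.single k 1 = 0 := neg_add_cancel _
  rw [this, pairing_zero_right]

theorem comm_stair (k : ℕ) (g : BaseGroup) :
    form.comm (stair k) g = ∑ i ∈ Finset.range k, qc g i + pc g k + tors g + expo g := by
  have h1 : tors (stair k) = 0 := map_zero _
  have h2 : expo (stair k) = 0 := expo_eq_zero rfl
  rw [Bichar.comm, form_apply, form_apply, pairing_stair, pairing_stair_right, tot_stair, h1, h2]
  ring

theorem eventually_comm_stair (g : BaseGroup) :
    ∀ᶠ k in atTop, form.comm (stair k) g = stairChar g := by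
  obtain ⟨n, hn⟩ := ((pc g).support ∪ (qc g).support).exists_nat_subset_range
  filter_upwards [eventually_ge_atTop n] with k hk
  have hs : (pc g).support ∪ (qc g).support ⊆ Finset.range k :=
    hn.trans (Finset.range_mono hk)
  have hp : pc g k = 0 := by
    by_contra h
    exact absurd (hs (Finset.mem_union_left _ (Finsupp.mem_support_iff.2 h))) (by simp)
  rw [comm_stair, hp, add_zero, stairChar, tot,
    Finsupp.sum_of_support_subset _ (Finset.subset_union_right.trans hs) _ fun _ _ => rfl]

theorem comm_stair_stair {k m : ℕ} (h : k < m) : form.comm (stair m) (stair k) = -1 := by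
  have h1 : tors (stair k) = 0 := map_zero _
  have h2 : expo (stair k) = 0 := expo_eq_zero rfl
  have h3 : pc (stair k) m = 0 := by
    change (∑ i ∈ Finset.range k, Finsupp.single i (1 : ZMod 9)) m = 0
    rw [Finsupp.finsetSum_apply]
    refine Finset.sum_eq_zero fun i hi => Finsupp.single_eq_of_ne ?_
    have := Finset.mem_range.1 hi
    omega
  have h4 : ∑ i ∈ Finset.range m, qc (stair k) i = -1 := by
    rw [Finset.sum_eq_single k]
    · change (-Finsupp.single k (1 : ZMod 9)) k = -1
      simp
    · intro i _ hi
      change (-Finsupp.single k (1 : ZMod 9)) i = 0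
      simp [hi]
    · intro hk; exact absurd (Finset.mem_range.2 h) hk
  rw [comm_stair, h1, h2, h3, h4]; ring

/-- The diagonal operator with coefficients `rootChar (stairChar g)`. -/
noncomputable def stairDiag : Ltwo BaseGroup →L[ℂ] Ltwo BaseGroup :=
  wperm (Equiv.refl _) (fun g => rootChar (stairChar g)) fun _ => (norm_rootChar _).le

theorem stairDiag_apply (η : Ltwo BaseGroup) (g : BaseGroup) :
    stairDiag η g = rootChar (stairChar g) * η g := rfl

theorem tendsto_conjRep_stair (η : Ltwo BaseGroup) :
    Tendsto (fun k => form.conjRep (stair k) η) atTop (𝓝 (stairDiag η)) := by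
  rw [tendsto_iff_norm_sub_tendsto_zero, ← tendsto_zero_iff_norm_tendsto_zero]
  have := tendsto_apply_zero_of_dense_span (l := atTop)
    (fun k => form.conjRep (stair k) - stairDiag) (C := 1 + 1) (fun k => (norm_sub_le _ _).trans
      (add_le_add (ContinuousLinearMap.opNorm_le_bound _ zero_le_one fun η => by
        rw [one_mul]; exact norm_wperm_apply_le _ _ _)
        (ContinuousLinearMap.opNorm_le_bound _ zero_le_one fun η => by
        rw [one_mul]; exact norm_wperm_apply_le _ _ _))) dense_span_delta
    (by
      rintro _ ⟨g, rfl⟩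
      refine tendsto_const_nhds.congr' ?_
      filter_upwards [eventually_comm_stair g] with k hk
      rw [_root_.sub_apply, conjRep_delta_of_fst rfl, hk, eq_comm, sub_eq_zero, eq_comm]
      exact wperm_delta _ _ _) η
  exact this

theorem stairDiag_proj (η : Ltwo BaseGroup) : stairDiag (proj {g : BaseGroup | g.1 = 1} η) =
    form.conjRep (FreeGroup.of true, 1) (proj {g : BaseGroup | g.1 = 1} η) := by
  ext g
  rw [stairDiag_apply, conjRep_apply]
  by_cases hg : g.1 = 1
  · have h1 : form.comm (FreeGroup.of true, 1) g = stairChar g := by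
      have e1 : expo (FreeGroup.of true, 1) = 1 := by simp [expo]
      have e2 : tors (FreeGroup.of true, 1) = 0 := map_zero _
      have e3 : tot (FreeGroup.of true, 1) = 0 := rfl
      have e4 : pc (FreeGroup.of true, 1) = 0 := rfl
      have e5 : qc (FreeGroup.of true, 1) = 0 := rfl
      rw [Bichar.comm, form_apply, form_apply, e1, e2, e3, e4, e5, stairChar, expo_eq_zero hg]
      simp
    rw [h1, conj_eq_self hg]
  · rw [proj_apply_of_notMem (X := {g : BaseGroup | g.1 = 1}) hg,
      proj_apply_of_notMem (X := {g : BaseGroup | g.1 = 1}), mul_zero, mul_zero]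
    intro h
    refine hg ?_
    have h' : (FreeGroup.of true)⁻¹ * g.1 * FreeGroup.of true = 1 := h
    simpa [mul_assoc, inv_mul_eq_one, eq_comm] using h'

theorem norm_stairDiag_sub_le (η : Ltwo BaseGroup) : ‖stairDiag η - η‖ ≤
    57 * (‖form.conjRep (FreeGroup.of true, 1) η - η‖ +
      ‖form.conjRep (FreeGroup.of false, 1) η - η‖) := by
  have h := norm_proj_compl_le form (ca := 1) (cb := 1) (by simp) (by simp) η
  rw [one_smul] at h
  set K := form.conjRep (FreeGroup.of true, (1 : AbelianPart))
  set η0 := proj {g : BaseGroup | g.1 = 1} η with hη0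
  set η1 := proj {g : BaseGroup | g.1 = 1}ᶜ η
  have hη : η0 + η1 = η := proj_add_proj_compl _ _
  have e : stairDiag η - η = (K η - η) - K η1 + stairDiag η1 := by
    have : stairDiag η0 = K η0 := stairDiag_proj η
    rw [← hη, map_add, map_add, this]; abel
  have h1 : ‖K η1‖ ≤ ‖η1‖ := norm_wperm_apply_le _ _ _
  have h2 : ‖stairDiag η1‖ ≤ ‖η1‖ := norm_wperm_apply_le _ _ _
  rw [e]
  have h3 := norm_add_le (K η - η - K η1) (stairDiag η1)
  have h4 := norm_sub_le (K η - η) (K η1)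
  have h5 := norm_nonneg (form.conjRep (FreeGroup.of false, (1 : AbelianPart)) η - η)
  have h6 := norm_nonneg (K η - η)
  linarith

variable {A : StarSubalgebra ℂ (Ltwo BaseGroup →L[ℂ] Ltwo BaseGroup)}

/-- No C*-algebra between the reduced twisted group C*-algebra and the von Neumann algebra of the
example has an antiautomorphism that preserves the trace norm. -/
theorem false_of_antiautomorphism (hA : A ≤ form.vonNeumann) (hlam : ∀ g, form.lam g ∈ A)
    [IsClosed (A : Set (Ltwo BaseGroup →L[ℂ] Ltwo BaseGroup))]
    (Φ : A ≃⋆ₐ[ℂ] Aᵐᵒᵖ) (hΦ : ∀ x : A, ‖((Φ x).unop : Ltwo BaseGroup →L[ℂ] Ltwo BaseGroup)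
      (delta 1)‖ = ‖(x : Ltwo BaseGroup →L[ℂ] Ltwo BaseGroup) (delta 1)‖) : False := by
  have hM := BaseGroup.isTracialFactor
  let ψ (x : A) : Ltwo BaseGroup →L[ℂ] Ltwo BaseGroup := (Φ x).unop
  have hmul (x y : A) : ψ (x * y) = ψ y * ψ x := by simp [ψ]
  have hsub (x y : A) : ψ (x - y) = ψ x - ψ y := by simp [ψ]
  have hsmul (c : ℂ) (x : A) : ψ (c • x) = c • ψ x := by simp [ψ]
  have hstar (x : A) : ψ (star x) = star (ψ x) := by
    simp only [ψ]
    rw [map_star Φ x]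
    rfl
  have hone : ψ 1 = 1 := by simp [ψ]
  have hnorm (x : A) : ‖ψ x (delta 1)‖ = ‖(x : Ltwo BaseGroup →L[ℂ] Ltwo BaseGroup) (delta 1)‖ :=
    hΦ x
  have hmem (x : A) : ψ x ∈ form.vonNeumann := hA (Φ x).unop.2
  let L (g : BaseGroup) : A := ⟨form.lam g, hlam g⟩
  have hL1 (g : BaseGroup) : star (L g) * L g = 1 := Subtype.ext (form.star_lam_mul_self g)
  have hL2 (g : BaseGroup) : L g * star (L g) = 1 := Subtype.ext (form.lam_mul_star_self g)
  let X (g : BaseGroup) : A := Φ.symm (MulOpposite.op (L g))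
  have hX (g : BaseGroup) : ψ (X g) = form.lam g := by simp [ψ, X, L]
  let y (k : ℕ) : Ltwo BaseGroup →L[ℂ] Ltwo BaseGroup := ψ (star (L (stair k)))
  have hy1 (k : ℕ) : star (y k) * y k = 1 := by
    simp only [y]; rw [← hstar, ← hmul, star_star, hL1, hone]
  have hy2 (k : ℕ) : y k * star (y k) = 1 := by
    simp only [y]; rw [← hstar, ← hmul, star_star, hL2, hone]
  have hconj (g : BaseGroup) (k : ℕ) : y k * form.lam g * star (y k) =
      ψ (L (stair k) * X g * star (L (stair k))) := by
    simp only [y]; rw [hmul, hmul, hX, ← hstar, star_star, mul_assoc]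
  let η (g : BaseGroup) : Ltwo BaseGroup := (X g : Ltwo BaseGroup →L[ℂ] Ltwo BaseGroup) (delta 1)
  have hη (g : BaseGroup) (k : ℕ) : ((L (stair k) * X g * star (L (stair k)) : A) :
      Ltwo BaseGroup →L[ℂ] Ltwo BaseGroup) (delta 1) = form.conjRep (stair k) (η g) :=
    conj_lam_apply form (hA (X g).2) (stair k)
  have hlim (g : BaseGroup) : ∃ T ∈ form.vonNeumann, ‖T‖ ≤ 1 ∧ ∀ v,
      Tendsto (fun k => (y k * form.lam g * star (y k)) v) atTop (𝓝 (T v)) := by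
    refine hM.exists_lim (fun k => by rw [hconj]; exact hmem _) (fun k => ?_) ?_
    · refine ContinuousLinearMap.opNorm_le_bound _ zero_le_one fun v => le_of_eq ?_
      rw [mul_apply_eq_comp, mul_apply_eq_comp, norm_apply_of_star_mul_self (hy1 k),
        norm_apply_of_star_mul_self (form.star_lam_mul_self g),
        norm_apply_of_star_mul_self (by rw [star_star, hy2]), one_mul]
    · have h := (tendsto_conjRep_stair (η g)).cauchySeq
      rw [Metric.cauchySeq_iff] at h ⊢
      intro ε hε
      obtain ⟨N, hN⟩ := h ε hε
      refine ⟨N, fun m hm k hk => ?_⟩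
      rw [hconj, hconj, dist_eq_norm, ← _root_.sub_apply, ← hsub, hnorm, AddSubgroupClass.coe_sub,
        _root_.sub_apply, hη, hη, ← dist_eq_norm]
      exact hN m hm k hk
  choose T hT _ hTlim using hlim
  have hlimit : form.IsLimitConj y T := ⟨fun k => hmem _, hy1, hy2, hT, hTlim⟩
  refine false_of_isLimitConj hlimit ?_ fun m k hkm => ?_
  · have hTs (s : BaseGroup) : ‖T s (delta 1) - form.lam s (delta 1)‖ = ‖stairDiag (η s) - η s‖ := by
      refine tendsto_nhds_unique ((hTlim s (delta 1)).sub_const _).norm ?_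
      refine ((tendsto_conjRep_stair (η s)).sub_const (η s)).norm.congr fun k => ?_
      rw [hconj, ← _root_.sub_apply, ← hX, ← hsub, hnorm, AddSubgroupClass.coe_sub,
        _root_.sub_apply, hη]
    have hcomm (g s : BaseGroup) : ‖form.conjRep g (η s) - η s‖ =
        ‖form.conjRep s (ψ (L g) (delta 1)) - ψ (L g) (delta 1)‖ := by
      rw [norm_conjRep_sub hM (hA (X s).2), norm_conjRep_sub hM (hmem _), ← hX s, ← hmul, ← hmul,
        ← hsub, hnorm]
      rfl
    have h0 (g : BaseGroup) : Tendsto (fun s => ‖form.conjRep g (η s) - η s‖) smallFilter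
        (𝓝 0) := by
      simp only [hcomm]
      exact tendsto_iff_norm_sub_tendsto_zero.1 (tendsto_conjRep _)
    rw [tendsto_zero_iff_norm_tendsto_zero]
    refine squeeze_zero (fun _ => norm_nonneg _) (fun s => (hTs s).le.trans
      (norm_stairDiag_sub_le (η s))) ?_
    simpa using ((h0 (FreeGroup.of true, 1)).add (h0 (FreeGroup.of false, 1))).const_mul 57
  · have h1 : L (stair m) * L (stair k) = rootChar (-1 : ZMod 9) • (L (stair k) * L (stair m)) := by
      refine Subtype.ext ?_
      change form.lam (stair m) * form.lam (stair k) =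
        rootChar (-1 : ZMod 9) • (form.lam (stair k) * form.lam (stair m))
      have hc : stair m * stair k = stair k * stair m := by
        rw [← mul_right_inj (stair k)⁻¹, ← mul_assoc, conj_eq_self' rfl, inv_mul_cancel_left]
      rw [lam_mul_lam, lam_mul_lam, smul_smul, ← rootChar_add, hc, ← comm_stair_stair hkm,
        Bichar.comm, sub_add_cancel]
    have h2 := congrArg (fun x => ψ (star x)) h1
    simp only [star_smul, StarMul.star_mul, hmul, hsmul, ← rootChar_neg, neg_neg] at h2
    exact h2

end BaseGroup

/-- **Main theorem.** There exists a simple separable stably finite unital C*-algebra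
`A` with stable rank one (dense invertibles), real rank zero (invertible self-adjoint
elements dense in the self-adjoint elements), a unique tracial state, and which is not
isomorphic (as a ℂ-linear star-algebra) to its opposite algebra. -/
theorem exists_simple_separable_cstarAlgebra_not_iso_opposite :
    ∃ (A : Type) (_ : CStarAlgebra A),
      TopologicalSpace.SeparableSpace A ∧
      (∀ I : TwoSidedIdeal A, IsClosed (I : Set A) → I = ⊥ ∨ I = ⊤) ∧
      (∀ (n : ℕ), 0 < n → ∀ x : Matrix (Fin n) (Fin n) A,
        star x * x = 1 → x * star x = 1) ∧
      Dense {x : A | IsUnit x} ∧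
      {x : A | IsSelfAdjoint x} ⊆ closure {x : A | IsSelfAdjoint x ∧ IsUnit x} ∧
      (∃! τ : A →L[ℂ] ℂ, IsTracialState τ) ∧
      IsEmpty (A ≃⋆ₐ[ℂ] Aᵐᵒᵖ) := by
  have hM := BaseGroup.isTracialFactor
  obtain ⟨A, hlam, hAM, hA⟩ := hM.exists_isElementarySubalgebra
    (Set.countable_range BaseGroup.form.lam)
    (Set.range_subset_iff.2 BaseGroup.form.lam_mem)
  have := hA.isClosed
  obtain ⟨h1, h2, h3, h4, h5, h6⟩ := hM.properties_of_isElementarySubalgebra hAM hA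
  refine ⟨A, inferInstance, h1, h2, h3, h4, h5, h6, ⟨fun Φ => ?_⟩⟩
  exact BaseGroup.false_of_antiautomorphism hAM (fun g => hlam ⟨g, rfl⟩) Φ
    (hM.norm_unop_apply hAM hA Φ)
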